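/- Assume Assumption A1. Let N, M ≥ 1 be integers with N ≤ ⌈M/2⌉, and let r, μ ∈ ℕ with r ≤ μ ≤ min(2N, M). Assume N_e ≥ 1 is an integer with ν_{N_e} := N_eπ/(κh) ≥ √2. Then for any u ∈ S^{N,M}_κ(T_h): inf over v ∈ V_{N_e}(Σ_h) of ‖u − v‖_{H^r_κ(T_h)} is at most (2√2·(r+1)/√(κ·tanh(κh/ρ))) · ν_{N_e}^{r−(μ+1/2)} · |u|_{H^μ_κ(Σ_h)}, where |u|²_{H^μ_κ(Σ_h)} = Σ_{s∈Σ_h} κ^{−2μ}‖(d/dt)^μ(u|_s)‖²_{L²(s)} and ‖w‖²_{H^r_κ(T_h)} = Σ_{K∈T_h}‖w‖²_{H^r_κ(K)}. If moreover u ∈ H^{M+1}_κ(K) for every cell K, then this infimum is at most C₁·((r+1)/2)·ν_{N_e}^{r−(μ+1/2)}·(Σ_{K∈T_h}‖u‖²_{H^{μ+1}_κ(K)})^{1/2}, where C₁ = 8√ρ·max(1,κh)/√(κh·tanh(κh/ρ)). -/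

import Mathlib

open MeasureTheory Real Set
open scoped Real Classical ENNReal NNReal

noncomputable section

/-- Partial derivative in the first coordinate. -/
def pd1 (f : ℝ × ℝ → ℂ) : ℝ × ℝ → ℂ := fun x => deriv (fun t => f (t, x.2)) x.1

/-- Partial derivative in the second coordinate. -/
def pd2 (f : ℝ × ℝ → ℂ) : ℝ × ℝ → ℂ := fun x => deriv (fun t => f (x.1, t)) x.2

/-- Mixed partial derivative `∂₁^i ∂₂^j`. -/
def pdM (i j : ℕ) (f : ℝ × ℝ → ℂ) : ℝ × ℝ → ℂ := pd1^[i] (pd2^[j] f)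

/-- Multi-indices of order at most `M`. -/
def idxLe (M : ℕ) : Finset (ℕ × ℕ) :=
  (Finset.range (M + 1) ×ˢ Finset.range (M + 1)).filter fun p => p.1 + p.2 ≤ M

/-- κ-weighted Sobolev inner product of order `M` on `D`. -/
def sobInner (κ : ℝ) (M : ℕ) (D : Set (ℝ × ℝ)) (f g : ℝ × ℝ → ℂ) : ℂ :=
  ∑ p ∈ idxLe M, ((κ : ℂ) ^ (2 * (p.1 + p.2)))⁻¹ *
    ∫ x in D, pdM p.1 p.2 f x * (starRingEnd ℂ) (pdM p.1 p.2 g x)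

/-- Square of the κ-weighted Sobolev norm of order `M` on `D`. -/
def sobNormSq (κ : ℝ) (M : ℕ) (D : Set (ℝ × ℝ)) (f : ℝ × ℝ → ℂ) : ℝ :=
  ∑ p ∈ idxLe M, (κ ^ (2 * (p.1 + p.2)))⁻¹ * ∫ x in D, ‖pdM p.1 p.2 f x‖ ^ 2

/-- κ-weighted Sobolev norm of order `M` on `D`. -/
def sobNorm (κ : ℝ) (M : ℕ) (D : Set (ℝ × ℝ)) (f : ℝ × ℝ → ℂ) : ℝ :=
  Real.sqrt (sobNormSq κ M D f)

/-- Membership in `H^M_κ(D)` (for pointwise-differentiable representatives). -/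
def MemSob (M : ℕ) (D : Set (ℝ × ℝ)) (f : ℝ × ℝ → ℂ) : Prop :=
  ∀ p ∈ idxLe M, IntegrableOn (fun x => ‖pdM p.1 p.2 f x‖ ^ 2) D

/-- `ν̂_n = nπ/(κ ĥ₁)`. -/
def nuHat (κ h1 : ℝ) (n : ℕ) : ℝ := n * π / (κ * h1)

/-- Principal complex square root of a real number. -/
def csqrt (r : ℝ) : ℂ := (r : ℂ) ^ (1 / 2 : ℂ)

/-- The single-edge Helmholtz mode `φ̂_n` on the reference rectangle. -/
def phiHat (κ h1 h2 : ℝ) (n : ℕ) : ℝ × ℝ → ℂ := fun x =>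
  Complex.sin (↑(κ * nuHat κ h1 n) * (x.1 : ℂ)) *
    Complex.sin ((x.2 : ℂ) * (κ : ℂ) * csqrt (1 - nuHat κ h1 n ^ 2)) /
    Complex.sin ((h2 : ℂ) * (κ : ℂ) * csqrt (1 - nuHat κ h1 n ^ 2))

/-- The open reference rectangle `K̂ = (0,ĥ₁) × (0,ĥ₂)`. -/
def Khat (h1 h2 : ℝ) : Set (ℝ × ℝ) := Ioo 0 h1 ×ˢ Ioo 0 h2

/-- Assumption A0: `κ²` is not a Δ-Neumann eigenvalue of the rectangle with sides `h1, h2`. -/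
def A0cond (κ h1 h2 : ℝ) : Prop :=
  ∀ n m : ℕ, κ ^ 2 ≠ (n * π / h1) ^ 2 + (m * π / h2) ^ 2

/-- Distributional (weak) solution of the homogeneous Helmholtz equation on `D`. -/
def WeakHelmholtz (κ : ℝ) (D : Set (ℝ × ℝ)) (u : ℝ × ℝ → ℂ) : Prop :=
  IntegrableOn u D ∧
  ∀ φ : ℝ × ℝ → ℂ, ContDiff ℝ (⊤ : ℕ∞) φ → HasCompactSupport φ → tsupport φ ⊆ D →
    ∫ x in D, u x * (pdM 2 0 φ x + pdM 0 2 φ x + (κ : ℂ) ^ 2 * φ x) = 0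

/-- The trace of `u` on the top edge (at height `h2`). -/
def traceTop (h2 : ℝ) (u : ℝ × ℝ → ℂ) : ℝ → ℂ := fun t => u (t, h2)

/-- The class `S^{N,M}_κ(K̂, ŝ)` of Helmholtz solutions with trace supported on the top edge. -/
structure SLoc (κ h1 h2 : ℝ) (N M : ℕ) (u : ℝ × ℝ → ℂ) : Prop where
  cont : ContinuousOn u (Icc 0 h1 ×ˢ Icc 0 h2)
  mem : MemSob 1 (Khat h1 h2) u
  helm : WeakHelmholtz κ (Khat h1 h2) u
  left : ∀ y ∈ Icc (0 : ℝ) h2, u (0, y) = 0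
  right : ∀ y ∈ Icc (0 : ℝ) h2, u (h1, y) = 0
  bottom : ∀ x ∈ Icc (0 : ℝ) h1, u (x, 0) = 0
  traceReg : ContDiffOn ℝ M (traceTop h2 u) (Icc 0 h1)
  endpt0 : ∀ j < N, iteratedDerivWithin (2 * j) (traceTop h2 u) (Icc 0 h1) 0 = 0
  endpt1 : ∀ j < N, iteratedDerivWithin (2 * j) (traceTop h2 u) (Icc 0 h1) h1 = 0

/-- Square of the trace seminorm `|u|_{H^M_κ(ŝ)}`. -/
def traceSemiSq (κ h1 h2 : ℝ) (M : ℕ) (u : ℝ × ℝ → ℂ) : ℝ :=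
  (κ ^ (2 * M))⁻¹ * ∫ t in (0 : ℝ)..h1, ‖iteratedDerivWithin M (traceTop h2 u) (Icc 0 h1) t‖ ^ 2

/-- The `L²(ŝ)` inner product of traces on the top edge. -/
def traceL2Inner (h1 h2 : ℝ) (u v : ℝ × ℝ → ℂ) : ℂ :=
  ∫ t in (0 : ℝ)..h1, u (t, h2) * (starRingEnd ℂ) (v (t, h2))

/-- The squared `L²(ŝ)` norm of the trace on the top edge. -/
def traceL2Sq (h1 h2 : ℝ) (u : ℝ × ℝ → ℂ) : ℝ :=
  ∫ t in (0 : ℝ)..h1, ‖u (t, h2)‖ ^ 2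


/-! ### Cartesian mesh machinery -/

/-- The open cell of the Cartesian grid indexed by `c ∈ ℤ²`. -/
def cellO (h1 h2 : ℝ) (c : ℤ × ℤ) : Set (ℝ × ℝ) :=
  Ioo ((c.1 : ℝ) * h1) (((c.1 : ℝ) + 1) * h1) ×ˢ Ioo ((c.2 : ℝ) * h2) (((c.2 : ℝ) + 1) * h2)

/-- The closed cell of the Cartesian grid indexed by `c ∈ ℤ²`. -/
def cellC (h1 h2 : ℝ) (c : ℤ × ℤ) : Set (ℝ × ℝ) :=
  Icc ((c.1 : ℝ) * h1) (((c.1 : ℝ) + 1) * h1) ×ˢ Icc ((c.2 : ℝ) * h2) (((c.2 : ℝ) + 1) * h2)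

/-- Horizontal edges of the mesh: `(i,j)` corresponds to `[i h₁,(i+1)h₁] × {j h₂}`. -/
def hEdges (cells : Finset (ℤ × ℤ)) : Finset (ℤ × ℤ) :=
  cells ∪ cells.image fun c => (c.1, c.2 + 1)

/-- Vertical edges of the mesh: `(i,j)` corresponds to `{i h₁} × [j h₂,(j+1)h₂]`. -/
def vEdges (cells : Finset (ℤ × ℤ)) : Finset (ℤ × ℤ) :=
  cells ∪ cells.image fun c => (c.1 + 1, c.2)

/-- Nodes of the mesh: `(i,j)` corresponds to the point `(i h₁, j h₂)`. -/
def meshNodes (cells : Finset (ℤ × ℤ)) : Finset (ℤ × ℤ) :=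
  ((cells ∪ cells.image fun c => (c.1 + 1, c.2)) ∪
    cells.image fun c => (c.1, c.2 + 1)) ∪
    cells.image fun c => (c.1 + 1, c.2 + 1)

/-- The point of `ℝ²` corresponding to the node index `p`. -/
def nodePt (h1 h2 : ℝ) (p : ℤ × ℤ) : ℝ × ℝ := ((p.1 : ℝ) * h1, (p.2 : ℝ) * h2)

/-- `Ω` is exactly tessellated by the cells of the Cartesian grid indexed by `cells`. -/
def IsTessellation (h1 h2 : ℝ) (cells : Finset (ℤ × ℤ)) (Ω : Set (ℝ × ℝ)) : Prop :=
  cells.Nonempty ∧ Ω = interior (⋃ c ∈ cells, cellC h1 h2 c) ∧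
    closure Ω = ⋃ c ∈ cells, cellC h1 h2 c

/-- The edge basis function `φ_{s,n}` associated with the horizontal edge `e`. -/
def phiEdgeH (κ h1 h2 : ℝ) (cells : Finset (ℤ × ℤ)) (e : ℤ × ℤ) (n : ℕ) : ℝ × ℝ → ℂ :=
  fun x =>
    if e ∈ cells ∧ x ∈ cellC h1 h2 e then
      phiHat κ h1 h2 n (x.1 - (e.1 : ℝ) * h1, h2 + ((e.2 : ℝ) * h2 - x.2))
    else if (e.1, e.2 - 1) ∈ cells ∧ x ∈ cellC h1 h2 (e.1, e.2 - 1) then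
      phiHat κ h1 h2 n (x.1 - (e.1 : ℝ) * h1, h2 - ((e.2 : ℝ) * h2 - x.2))
    else 0

/-- The edge basis function `φ_{s,n}` associated with the vertical edge `e`. -/
def phiEdgeV (κ h1 h2 : ℝ) (cells : Finset (ℤ × ℤ)) (e : ℤ × ℤ) (n : ℕ) : ℝ × ℝ → ℂ :=
  fun x =>
    if e ∈ cells ∧ x ∈ cellC h1 h2 e then
      phiHat κ h2 h1 n (x.2 - (e.2 : ℝ) * h2, h1 + ((e.1 : ℝ) * h1 - x.1))
    else if (e.1 - 1, e.2) ∈ cells ∧ x ∈ cellC h1 h2 (e.1 - 1, e.2) then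
      phiHat κ h2 h1 n (x.2 - (e.2 : ℝ) * h2, h1 - ((e.1 : ℝ) * h1 - x.1))
    else 0

/-- The node basis function `ψ_{p,n}` associated with the node `p`. -/
def psiNode (κ h1 h2 : ℝ) (p : ℤ × ℤ) (n : ℕ) : ℝ × ℝ → ℂ :=
  fun x =>
    if x ∈ Icc (((p.1 : ℝ) - 1) * h1) (((p.1 : ℝ) + 1) * h1) ×ˢ
        Icc ((p.2 : ℝ) * h2) (((p.2 : ℝ) + 1) * h2) then
      phiHat κ (2 * h1) h2 (2 * n - 1) (h1 - ((p.1 : ℝ) * h1 - x.1), h2 + ((p.2 : ℝ) * h2 - x.2))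
    else if x ∈ Icc (((p.1 : ℝ) - 1) * h1) (((p.1 : ℝ) + 1) * h1) ×ˢ
        Icc (((p.2 : ℝ) - 1) * h2) ((p.2 : ℝ) * h2) then
      phiHat κ (2 * h1) h2 (2 * n - 1) (h1 - ((p.1 : ℝ) * h1 - x.1), h2 - ((p.2 : ℝ) * h2 - x.2))
    else 0

/-- The set of edge basis functions with at most `Ne` modes per edge. -/
def edgeFuns (κ h1 h2 : ℝ) (cells : Finset (ℤ × ℤ)) (Ne : ℕ) : Set (ℝ × ℝ → ℂ) :=
  {f | ∃ e ∈ hEdges cells, ∃ n : ℕ, 1 ≤ n ∧ n ≤ Ne ∧ f = phiEdgeH κ h1 h2 cells e n} ∪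
  {f | ∃ e ∈ vEdges cells, ∃ n : ℕ, 1 ≤ n ∧ n ≤ Ne ∧ f = phiEdgeV κ h1 h2 cells e n}

/-- The set of node basis functions with at most `Nn` modes per node. -/
def nodeFuns (κ h1 h2 : ℝ) (cells : Finset (ℤ × ℤ)) (Nn : ℕ) : Set (ℝ × ℝ → ℂ) :=
  {f | ∃ p ∈ meshNodes cells, ∃ n : ℕ, 1 ≤ n ∧ n ≤ Nn ∧ f = psiNode κ h1 h2 p n}

/-- The edge-based Trefftz space `V_{N_e}(Σ_h)`. -/
def edgeSpace (κ h1 h2 : ℝ) (cells : Finset (ℤ × ℤ)) (Ne : ℕ) :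
    Submodule ℂ (ℝ × ℝ → ℂ) :=
  Submodule.span ℂ (edgeFuns κ h1 h2 cells Ne)

/-- The combined edge-and-node Trefftz space `V_𝐍(T_h)`. -/
def combinedSpace (κ h1 h2 : ℝ) (cells : Finset (ℤ × ℤ)) (Ne Nn : ℕ) :
    Submodule ℂ (ℝ × ℝ → ℂ) :=
  Submodule.span ℂ (edgeFuns κ h1 h2 cells Ne ∪ nodeFuns κ h1 h2 cells Nn)

/-- Square of the broken Sobolev norm `‖·‖²_{H^r_κ(T_h)}`. -/
def brokenNormSq (κ : ℝ) (r : ℕ) (h1 h2 : ℝ) (cells : Finset (ℤ × ℤ))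
    (f : ℝ × ℝ → ℂ) : ℝ :=
  ∑ c ∈ cells, sobNormSq κ r (cellO h1 h2 c) f

/-- The global class `S^{N,M}_κ(T_h)`. -/
structure SGlob (κ h1 h2 : ℝ) (cells : Finset (ℤ × ℤ)) (Ω : Set (ℝ × ℝ)) (N M : ℕ)
    (u : ℝ × ℝ → ℂ) : Prop where
  cont : ContinuousOn u (closure Ω)
  mem : ∀ c ∈ cells, MemSob 1 (cellO h1 h2 c) u
  helm : ∀ c ∈ cells, WeakHelmholtz κ (cellO h1 h2 c) u
  htraceReg : ∀ e ∈ hEdges cells,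
    ContDiffOn ℝ M (fun t => u (t, (e.2 : ℝ) * h2)) (Icc ((e.1 : ℝ) * h1) (((e.1 : ℝ) + 1) * h1))
  hend : ∀ e ∈ hEdges cells, ∀ j < N,
    iteratedDerivWithin (2 * j) (fun t => u (t, (e.2 : ℝ) * h2))
        (Icc ((e.1 : ℝ) * h1) (((e.1 : ℝ) + 1) * h1)) ((e.1 : ℝ) * h1) = 0 ∧
    iteratedDerivWithin (2 * j) (fun t => u (t, (e.2 : ℝ) * h2))
        (Icc ((e.1 : ℝ) * h1) (((e.1 : ℝ) + 1) * h1)) (((e.1 : ℝ) + 1) * h1) = 0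
  vtraceReg : ∀ e ∈ vEdges cells,
    ContDiffOn ℝ M (fun t => u ((e.1 : ℝ) * h1, t)) (Icc ((e.2 : ℝ) * h2) (((e.2 : ℝ) + 1) * h2))
  vend : ∀ e ∈ vEdges cells, ∀ j < N,
    iteratedDerivWithin (2 * j) (fun t => u ((e.1 : ℝ) * h1, t))
        (Icc ((e.2 : ℝ) * h2) (((e.2 : ℝ) + 1) * h2)) ((e.2 : ℝ) * h2) = 0 ∧
    iteratedDerivWithin (2 * j) (fun t => u ((e.1 : ℝ) * h1, t))
        (Icc ((e.2 : ℝ) * h2) (((e.2 : ℝ) + 1) * h2)) (((e.2 : ℝ) + 1) * h2) = 0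

/-- Square of the skeleton seminorm `|u|²_{H^μ_κ(Σ_h)}`. -/
def skelSemiSq (κ h1 h2 : ℝ) (cells : Finset (ℤ × ℤ)) (μ : ℕ) (u : ℝ × ℝ → ℂ) : ℝ :=
  (∑ e ∈ hEdges cells, (κ ^ (2 * μ))⁻¹ *
    ∫ t in ((e.1 : ℝ) * h1)..(((e.1 : ℝ) + 1) * h1),
      ‖iteratedDerivWithin μ (fun t => u (t, (e.2 : ℝ) * h2))
          (Icc ((e.1 : ℝ) * h1) (((e.1 : ℝ) + 1) * h1)) t‖ ^ 2) +
  ∑ e ∈ vEdges cells, (κ ^ (2 * μ))⁻¹ *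
    ∫ t in ((e.2 : ℝ) * h2)..(((e.2 : ℝ) + 1) * h2),
      ‖iteratedDerivWithin μ (fun t => u ((e.1 : ℝ) * h1, t))
          (Icc ((e.2 : ℝ) * h2) (((e.2 : ℝ) + 1) * h2)) t‖ ^ 2

/-- `ν̃_n = (2n−1)π/(2κh₁)`. -/
def nuTil (κ h1 : ℝ) (n : ℕ) : ℝ := (2 * (n : ℝ) - 1) * π / (2 * (κ * h1))

/-- `d̃`: distance to the node-associated propagative resonances. -/
def dTil (κ h1 h2 : ℝ) : ℝ :=
  sInf {d : ℝ | ∃ n : ℕ, 1 ≤ n ∧ nuTil κ h1 n < 1 ∧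
    ∃ m : ℕ, d = |Real.sqrt (1 - nuTil κ h1 n ^ 2) - m * π / (κ * h2)|}

/-- `d̃₀`. -/
def dTil0 (κ h1 : ℝ) : ℝ :=
  sInf {d : ℝ | ∃ n : ℕ, 1 ≤ n ∧ 1 < nuTil κ h1 n ∧ d = Real.sqrt (nuTil κ h1 n ^ 2 - 1)}

/-- `χ_N = min(ρe^{κh}/(κh), e·max(1,κh)^{2(N−1)})`. -/
def chiN (ρ kh : ℝ) (N : ℕ) : ℝ :=
  min (ρ * Real.exp kh / kh) (Real.exp 1 * max 1 kh ^ (2 * (N - 1)))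


/-- The `k`-th phase-shifted sine mode of frequency `nπ/L`. -/
def trig (L : ℝ) (k n : ℕ) (t : ℝ) : ℝ := Real.sin (n * π / L * t + k * (π / 2))

theorem trig_hasDerivAt (L : ℝ) (k n : ℕ) (t : ℝ) :
    HasDerivAt (trig L k n) (n * π / L * trig L (k + 1) n t) t := by
  have h := (((hasDerivAt_id' t).const_mul (n * π / L)).add_const (k * (π / 2))).sin
  refine h.congr_deriv ?_
  unfold trig
  push_cast
  rw [show n * π / L * t + (k + 1) * (π / 2) = (n * π / L * t + k * (π / 2)) + π / 2 by ring,
    Real.sin_add_pi_div_two]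
  ring

theorem trig_continuous (L : ℝ) (k n : ℕ) : Continuous (trig L k n) := by
  unfold trig; fun_prop

theorem trig_add_two (L : ℝ) (k n : ℕ) (t : ℝ) : trig L (k + 2) n t = - trig L k n t := by
  unfold trig; push_cast
  rw [show n * π / L * t + (k + 2) * (π / 2) = (n * π / L * t + k * (π / 2)) + π by ring,
    Real.sin_add_pi]

theorem abs_trig_le (L : ℝ) (k n : ℕ) (t : ℝ) : |trig L k n t| ≤ 1 := Real.abs_sin_le_one _

theorem trig_even_zero (L : ℝ) (k n : ℕ) (hk : Even k) : trig L k n 0 = 0 := by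
  obtain ⟨j, rfl⟩ := hk
  unfold trig; push_cast
  rw [show n * π / L * 0 + (j + j) * (π / 2) = j * π by ring, Real.sin_nat_mul_pi]

theorem trig_even_right (L : ℝ) (hL : L ≠ 0) (k n : ℕ) (hk : Even k) : trig L k n L = 0 := by
  obtain ⟨j, rfl⟩ := hk
  unfold trig; push_cast
  rw [show n * π / L * L + (j + j) * (π / 2) = ((n + j : ℕ) : ℝ) * π by
    push_cast; field_simp; ring, Real.sin_nat_mul_pi]

theorem integral_cos_nat (L : ℝ) (hL : 0 < L) (m : ℤ) (hm : m ≠ 0) (c : ℝ) :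
    ∫ t in (0 : ℝ)..L, Real.cos (m * π / L * t + c) = Real.sin (m * π + c) * (L / (m * π))
      - Real.sin c * (L / (m * π)) := by
  have hm' : (m : ℝ) ≠ 0 := by exact_mod_cast hm
  have hpi := Real.pi_pos.ne'
  have : ∀ t ∈ uIcc 0 L, HasDerivAt (fun t => Real.sin (m * π / L * t + c) * (L / (m * π)))
      (Real.cos (m * π / L * t + c)) t := by
    intro t _
    have h := ((((hasDerivAt_id' t).const_mul (m * π / L)).add_const c).sin).mul_const (L / (m * π))
    refine h.congr_deriv ?_
    field_simp
  rw [intervalIntegral.integral_eq_sub_of_hasDerivAt this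
    (Continuous.intervalIntegrable (by fun_prop) _ _)]
  rw [show m * π / L * L + c = m * π + c by field_simp, mul_zero, zero_add]

theorem integral_trig_mul (L : ℝ) (hL : 0 < L) (k n m : ℕ) (hn : 1 ≤ n) (hm : 1 ≤ m) :
    ∫ t in (0 : ℝ)..L, trig L k n t * trig L k m t = if n = m then L / 2 else 0 := by
  have e : ∀ t, trig L k n t * trig L k m t =
      (1/2) * Real.cos (((n : ℤ) - (m : ℤ) : ℤ) * π / L * t + 0)
      - (1/2) * Real.cos (((n : ℤ) + (m : ℤ) : ℤ) * π / L * t + k * π) := by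
    intro t
    unfold trig
    generalize hx : n * π / L * t + k * (π / 2) = x
    generalize hy : m * π / L * t + k * (π / 2) = y
    have h1 : (((n : ℤ) - (m : ℤ) : ℤ) : ℝ) * π / L * t + 0 = x - y := by
      rw [← hx, ← hy]; push_cast; ring
    have h2 : (((n : ℤ) + (m : ℤ) : ℤ) : ℝ) * π / L * t + k * π = x + y := by
      rw [← hx, ← hy]; push_cast; ring
    rw [h1, h2, Real.cos_sub, Real.cos_add]; ring
  simp_rw [e]
  rw [intervalIntegral.integral_sub (Continuous.intervalIntegrable (by fun_prop) _ _)
    (Continuous.intervalIntegrable (by fun_prop) _ _), intervalIntegral.integral_const_mul,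
    intervalIntegral.integral_const_mul, integral_cos_nat L hL ((n : ℤ) + m) (by omega)]
  have h3 : Real.sin ((((n : ℤ) + (m : ℤ) : ℤ) : ℝ) * π + k * π) = 0 := by
    rw [show (((n : ℤ) + (m : ℤ) : ℤ) : ℝ) * π + k * π = ((n + m + k : ℕ) : ℝ) * π by
      push_cast; ring, Real.sin_nat_mul_pi]
  rw [h3, Real.sin_nat_mul_pi]
  split_ifs with h
  · subst h
    simp; ring
  · rw [integral_cos_nat L hL _ (by omega)]
    simp only [add_zero, Real.sin_int_mul_pi, Real.sin_zero]
    ring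

/-- The mode `trig` transported to the interval `[a, b]`. -/
def trigOn (a b : ℝ) (k n : ℕ) (t : ℝ) : ℝ := trig (b - a) k n (t - a)

theorem trigOn_hasDerivAt (a b : ℝ) (k n : ℕ) (t : ℝ) :
    HasDerivAt (trigOn a b k n) (n * π / (b - a) * trigOn a b (k + 1) n t) t := by
  have := (trig_hasDerivAt (b - a) k n (t - a)).comp_sub_const t a
  exact this

theorem trigOn_continuous (a b : ℝ) (k n : ℕ) : Continuous (trigOn a b k n) :=
  (trig_continuous _ _ _).comp (by fun_prop)

theorem integral_trigOn_mul (a b : ℝ) (hab : a < b) (k n m : ℕ) (hn : 1 ≤ n) (hm : 1 ≤ m) :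
    ∫ t in a..b, trigOn a b k n t * trigOn a b k m t = if n = m then (b - a) / 2 else 0 := by
  rw [← integral_trig_mul (b - a) (by linarith) k n m hn hm]
  unfold trigOn
  rw [intervalIntegral.integral_comp_sub_right (fun t => trig (b - a) k n t * trig (b - a) k m t) a]
  simp

/-- `L²` identity for finite trigonometric sums. -/
theorem integral_norm_sq_sum_trigOn (a b : ℝ) (hab : a < b) (k : ℕ) (F : Finset ℕ)
    (hF : ∀ n ∈ F, 1 ≤ n) (c : ℕ → ℂ) :
    ∫ t in a..b, ‖∑ n ∈ F, c n * (trigOn a b k n t : ℂ)‖ ^ 2 =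
      (b - a) / 2 * ∑ n ∈ F, ‖c n‖ ^ 2 := by
  have cont := trigOn_continuous a b k
  have e : ∀ t, ‖∑ n ∈ F, c n * (trigOn a b k n t : ℂ)‖ ^ 2 =
      ∑ n ∈ F, ∑ m ∈ F, (c n * (starRingEnd ℂ) (c m)).re *
          (trigOn a b k n t * trigOn a b k m t) := by
    intro t
    have h1 : ((‖∑ n ∈ F, c n * (trigOn a b k n t : ℂ)‖ ^ 2 : ℝ) : ℂ) =
      ∑ n ∈ F, ∑ m ∈ F, (c n * (starRingEnd ℂ) (c m)) *
        ((trigOn a b k n t * trigOn a b k m t : ℝ) : ℂ) := by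
      push_cast
      rw [← Complex.mul_conj', map_sum, Finset.sum_mul_sum]
      refine Finset.sum_congr rfl fun n _ => Finset.sum_congr rfl fun m _ => ?_
      simp; ring
    have h2 := congrArg Complex.re h1
    rw [Complex.ofReal_re] at h2
    rw [h2]
    simp only [Complex.re_sum, Complex.re_mul_ofReal]
  simp_rw [e]
  rw [intervalIntegral.integral_finsetSum
    (fun n _ => Continuous.intervalIntegrable (by fun_prop) _ _), Finset.mul_sum]
  refine Finset.sum_congr rfl fun n hn => ?_
  rw [intervalIntegral.integral_finsetSum
    (fun n _ => Continuous.intervalIntegrable (by fun_prop) _ _)]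
  rw [Finset.sum_eq_single n]
  · rw [intervalIntegral.integral_const_mul, integral_trigOn_mul a b hab k n n (hF n hn) (hF n hn)]
    rw [Complex.mul_conj']; norm_cast; simp; ring
  · intro m hm hmn
    rw [intervalIntegral.integral_const_mul, integral_trigOn_mul a b hab k n m (hF n hn) (hF m hm),
      if_neg (Ne.symm hmn), mul_zero]
  · exact fun h => absurd hn h

/-- Trigonometric coefficients on `[a, b]`. -/
def trigCoef (a b : ℝ) (k : ℕ) (g : ℝ → ℂ) (n : ℕ) : ℂ :=
  (2 / (b - a) : ℝ) * ∫ t in a..b, g t * (trigOn a b k n t : ℂ)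

theorem trig_bessel (a b : ℝ) (hab : a < b) (k : ℕ) (F : Finset ℕ)
    (hF : ∀ n ∈ F, 1 ≤ n) (g : ℝ → ℂ) (hg : ContinuousOn g (Icc a b)) :
    (b - a) / 2 * ∑ n ∈ F, ‖trigCoef a b k g n‖ ^ 2 ≤ ∫ t in a..b, ‖g t‖ ^ 2 := by
  have cont := trigOn_continuous a b k
  have hg' : ContinuousOn g (uIcc a b) := by rwa [uIcc_of_le hab.le]
  set c := trigCoef a b k g
  set S : ℝ → ℂ := fun t => ∑ n ∈ F, c n * (trigOn a b k n t : ℂ) with hS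
  have hSc : Continuous S := by simp only [hS]; fun_prop
  have h0 : 0 ≤ ∫ t in a..b, ‖g t - S t‖ ^ 2 :=
    intervalIntegral.integral_nonneg hab.le fun t _ => by positivity
  have e : ∀ t, ‖g t - S t‖ ^ 2 = ‖g t‖ ^ 2 + ‖S t‖ ^ 2 -
      2 * (∑ n ∈ F, (starRingEnd ℂ) (c n) * (g t * (trigOn a b k n t : ℂ))).re := by
    intro t
    have : (∑ n ∈ F, (starRingEnd ℂ) (c n) * (g t * (trigOn a b k n t : ℂ)))
        = g t * (starRingEnd ℂ) (S t) := by
      simp only [hS, map_sum, map_mul, Complex.conj_ofReal, Finset.mul_sum]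
      exact Finset.sum_congr rfl fun n _ => by ring
    rw [this, ← Complex.normSq_eq_norm_sq, ← Complex.normSq_eq_norm_sq, ← Complex.normSq_eq_norm_sq,
      Complex.normSq_sub]
  simp_rw [e] at h0
  have i1 : IntervalIntegrable (fun t => ‖g t‖ ^ 2) volume a b :=
    ContinuousOn.intervalIntegrable (by fun_prop)
  have i2 : IntervalIntegrable (fun t => ‖S t‖ ^ 2) volume a b :=
    Continuous.intervalIntegrable (by fun_prop) _ _
  have i4 : ∀ n ∈ F, IntervalIntegrable
      (fun t => (starRingEnd ℂ) (c n) * (g t * (trigOn a b k n t : ℂ))) volume a b := fun n _ =>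
    ContinuousOn.intervalIntegrable (by
      have : ContinuousOn (fun t => (trigOn a b k n t : ℂ)) (uIcc a b) :=
        (Complex.continuous_ofReal.comp (cont n)).continuousOn
      exact continuousOn_const.mul (hg'.mul this))
  have i3 : IntervalIntegrable (fun t => ∑ n ∈ F,
      (starRingEnd ℂ) (c n) * (g t * (trigOn a b k n t : ℂ))) volume a b := by
    have := IntervalIntegrable.sum F i4
    refine this.congr fun t _ => by simp
  have i3' : IntervalIntegrable (fun t => (∑ n ∈ F,
      (starRingEnd ℂ) (c n) * (g t * (trigOn a b k n t : ℂ))).re) volume a b := 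
    ⟨i3.1.re, i3.2.re⟩
  rw [intervalIntegral.integral_sub (i1.add i2) (i3'.const_mul 2),
    intervalIntegral.integral_add i1 i2, integral_norm_sq_sum_trigOn a b hab k F hF,
    intervalIntegral.integral_const_mul] at h0
  have h5 : ∫ t in a..b, (∑ n ∈ F,
      (starRingEnd ℂ) (c n) * (g t * (trigOn a b k n t : ℂ))).re =
      (b - a) / 2 * ∑ n ∈ F, ‖c n‖ ^ 2 := by
    have : ∫ t in a..b, (∑ n ∈ F,
      (starRingEnd ℂ) (c n) * (g t * (trigOn a b k n t : ℂ))).re =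
      (∫ t in a..b, ∑ n ∈ F,
      (starRingEnd ℂ) (c n) * (g t * (trigOn a b k n t : ℂ))).re := by
      exact Complex.reCLM.intervalIntegral_comp_comm i3
    rw [this, intervalIntegral.integral_finsetSum i4, Complex.re_sum, Finset.mul_sum]
    refine Finset.sum_congr rfl fun n _ => ?_
    rw [intervalIntegral.integral_const_mul]
    have hc : ∫ t in a..b, g t * (trigOn a b k n t : ℂ) = ((b - a) / 2 : ℝ) * c n := by
      simp only [c, trigCoef]
      rw [← mul_assoc, ← Complex.ofReal_mul]
      have : (b - a) / 2 * (2 / (b - a)) = 1 := by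
        have : b - a ≠ 0 := by linarith
        field_simp
      rw [this]; simp
    rw [hc, show (starRingEnd ℂ) (c n) * (((b - a) / 2 : ℝ) * c n) =
      (((b - a) / 2 : ℝ) : ℂ) * (c n * (starRingEnd ℂ) (c n)) by ring, Complex.mul_conj']
    norm_cast
  rw [h5] at h0
  simp only [c] at h0 ⊢
  linarith

theorem sine_unique_zero (L : ℝ) (hL : 0 < L) (g : ℝ → ℂ) (hg : ContinuousOn g (Icc 0 L))
    (h0 : g 0 = 0) (h1 : g L = 0)
    (hz : ∀ n : ℕ, 1 ≤ n → ∫ t in (0 : ℝ)..L, g t * (trig L 0 n t : ℂ) = 0) :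
    ∀ x ∈ Icc 0 L, g x = 0 := by
  have hF : Fact (0 < 2 * L) := ⟨by linarith⟩
  set F : ℝ → ℂ := fun t => if 0 ≤ t then g t else - g (-t) with hFdef
  have hFc : ContinuousOn F (Icc (-L) (-L + 2 * L)) := by
    have hs : Icc (-L) (-L + 2 * L) = Icc (-L) 0 ∪ Icc 0 L := by
      rw [Icc_union_Icc_eq_Icc (by linarith) hL.le]; congr 1; ring
    rw [hs]
    refine ContinuousOn.union_of_isClosed ?_ ?_ isClosed_Icc isClosed_Icc
    · have : ContinuousOn (fun t => - g (-t)) (Icc (-L) 0) := by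
        refine (hg.comp continuousOn_neg ?_).neg
        intro t ht; simp only [mem_Icc] at *; constructor <;> linarith [ht.1, ht.2]
      refine this.congr fun t ht => ?_
      simp only [hFdef]
      split_ifs with h
      · have : t = 0 := le_antisymm ht.2 h
        subst this; simp [h0]
      · rfl
    · refine hg.congr fun t ht => ?_
      simp [hFdef, ht.1]
  have hFe : F (-L) = F (-L + 2 * L) := by
    simp only [hFdef]
    rw [if_neg (by linarith), if_pos (by linarith)]
    simp [h1, show -L + 2 * L = L by ring]
  let f : C(AddCircle (2 * L), ℂ) :=
    ⟨AddCircle.liftIco (2 * L) (-L) F, AddCircle.liftIco_continuous hFe hFc⟩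
  have hcoef : ∀ n : ℤ, fourierCoeff f n = 0 := by
    intro n
    show fourierCoeff (AddCircle.liftIco (2 * L) (-L) F) n = 0
    rw [fourierCoeff_liftIco_eq, fourierCoeffOn_eq_integral]
    have hInt : IntervalIntegrable
        (fun x : ℝ => fourier (-n) (x : AddCircle (-L + 2 * L - -L)) • F x)
        volume (-L) (-L + 2 * L) := by
      refine ContinuousOn.intervalIntegrable ?_
      rw [uIcc_of_le (by linarith)]
      simp only [smul_eq_mul]
      refine ContinuousOn.mul ?_ hFc
      exact ((ContinuousMap.continuous _).comp (AddCircle.continuous_mk' _)).continuousOn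
    rw [← intervalIntegral.integral_add_adjacent_intervals (b := 0)
      (hInt.mono_set (by rw [uIcc_of_le (by linarith), uIcc_of_le (by linarith)]
                         exact Icc_subset_Icc le_rfl (by linarith)))
      (hInt.mono_set (by rw [uIcc_of_le (by linarith), uIcc_of_le (by linarith)]
                         exact Icc_subset_Icc (by linarith) le_rfl))]
    have e1 : ∀ G : ℝ → ℂ, ∫ x in (-L)..0, G x = ∫ x in (0:ℝ)..L, G (-x) := by
      intro G; rw [intervalIntegral.integral_comp_neg]; simp
    rw [e1, show -L + 2 * L = L by ring, ← intervalIntegral.integral_add]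
    · have e2 : ∀ x ∈ Ioc 0 L, fourier (-n) ((-x : ℝ) : AddCircle (L - -L)) • F (-x) +
          fourier (-n) (x : AddCircle (L - -L)) • F x =
          (-2 * Complex.I * (if 0 ≤ n then 1 else -1)) * (g x * (trig L 0 n.natAbs x : ℂ)) := by
        intro x hx
        have hx0 : ¬ (0 ≤ -x) := by linarith [hx.1]
        simp only [hFdef, if_neg hx0, if_pos hx.1.le, neg_neg, fourier_coe_apply, smul_eq_mul]
        have hLc : (L : ℂ) ≠ 0 := by exact_mod_cast hL.ne'
        rw [show 2 * (π : ℂ) * Complex.I * ((-n : ℤ) : ℂ) * ((-x : ℝ) : ℂ) / ((L - -L : ℝ) : ℂ) =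
            (((n : ℝ) * π / L * x : ℝ) : ℂ) * Complex.I by push_cast; field_simp; ring,
          show 2 * (π : ℂ) * Complex.I * ((-n : ℤ) : ℂ) * (x : ℂ) / ((L - -L : ℝ) : ℂ) =
            -(((n : ℝ) * π / L * x : ℝ) : ℂ) * Complex.I by push_cast; field_simp; ring]
        have hsin : (if 0 ≤ n then (1 : ℂ) else -1) * (trig L 0 n.natAbs x : ℂ) =
            Complex.sin (((n : ℝ) * π / L * x : ℝ) : ℂ) := by
          unfold trig
          have hna : ((n.natAbs : ℕ) : ℝ) = if 0 ≤ n then (n : ℝ) else -(n : ℝ) := by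
            split_ifs with h
            · rw [Nat.cast_natAbs, abs_of_nonneg h]
            · rw [Nat.cast_natAbs, abs_of_neg (by omega)]; push_cast; rfl
          rw [hna]
          split_ifs with h
          · simp
          · rw [show (-(n:ℝ)) * π / L * x + ((0:ℕ):ℝ) * (π / 2) = -((n:ℝ) * π / L * x) by
              push_cast; ring, Real.sin_neg]
            push_cast; ring
        rw [show (-2 * Complex.I * (if 0 ≤ n then (1 : ℂ) else -1)) *
          (g x * (trig L 0 n.natAbs x : ℂ)) =
          -2 * Complex.I * g x *
              ((if 0 ≤ n then (1 : ℂ) else -1) * (trig L 0 n.natAbs x : ℂ)) by ring,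
          hsin, Complex.sin]
        linear_combination (Complex.exp (-(((n : ℝ) * π / L * x : ℝ) : ℂ) * Complex.I) -
          Complex.exp ((((n : ℝ) * π / L * x : ℝ) : ℂ) * Complex.I)) * g x * Complex.I_mul_I
      rw [intervalIntegral.integral_congr_ae (g := fun x =>
        (-2 * Complex.I * (if 0 ≤ n then 1 else -1)) * (g x * (trig L 0 n.natAbs x : ℂ)))
        (Filter.Eventually.of_forall fun x hx => e2 x (by rwa [uIoc_of_le hL.le] at hx)),
        intervalIntegral.integral_const_mul]
      rcases Nat.eq_zero_or_pos n.natAbs with h | h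
      · rw [h]; simp [trig]
      · rw [hz _ h]; simp
    · have := hInt.mono_set (c := -L) (d := 0) (by
        rw [uIcc_of_le (by linarith), uIcc_of_le (by linarith)]
        exact Icc_subset_Icc le_rfl (by linarith))
      rw [show -L + 2 * L = L by ring] at this
      have h2 := (IntervalIntegrable.iff_comp_neg).1 this
      simp only [neg_neg, neg_zero] at h2
      exact h2.symm
    · have := hInt.mono_set (c := 0) (d := L) (by
        rw [uIcc_of_le (by linarith), uIcc_of_le (by linarith)]
        exact Icc_subset_Icc (by linarith) (by linarith))
      rw [show -L + 2 * L = L by ring] at this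
      exact this
  have hsum : Summable (fourierCoeff f) := by
    rw [show fourierCoeff f = fun _ => 0 from funext hcoef]; exact summable_zero
  have := hasSum_fourier_series_of_summable hsum
  simp only [hcoef, zero_smul] at this
  have hf0 : f = 0 := (this.unique hasSum_zero)
  intro x hx
  rcases eq_or_lt_of_le hx.2 with h | h
  · rw [h, h1]
  · have hmem : x ∈ Ico (-L) (-L + 2 * L) := ⟨by linarith [hx.1], by linarith⟩
    have h3 : f (x : AddCircle (2 * L)) = F x :=
      AddCircle.liftIco_coe_apply (p := 2 * L) (f := F) hmem
    rw [hf0] at h3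
    simp only [hFdef, if_pos hx.1] at h3
    simpa using h3.symm

theorem sine_unique (a b : ℝ) (hab : a < b) (g : ℝ → ℂ) (hg : ContinuousOn g (Icc a b))
    (h0 : g a = 0) (h1 : g b = 0)
    (hz : ∀ n : ℕ, 1 ≤ n → ∫ t in a..b, g t * (trigOn a b 0 n t : ℂ) = 0) :
    ∀ x ∈ Icc a b, g x = 0 := by
  have := sine_unique_zero (b - a) (by linarith) (fun s => g (s + a))
    (hg.comp (by fun_prop) fun s hs => ⟨by linarith [hs.1], by linarith [hs.2]⟩)
    (by simpa using h0) (by simpa using h1) (by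
      intro n hn
      rw [← hz n hn]
      have := intervalIntegral.integral_comp_add_right (a := 0) (b := b - a)
        (fun t => g t * (trigOn a b 0 n t : ℂ)) a
      simp only [trigOn, add_sub_cancel_right, zero_add, sub_add_cancel] at this
      exact this)
  intro x hx
  simpa using this (x - a) ⟨by linarith [hx.1], by linarith [hx.2]⟩

/-- Integration by parts for trigonometric coefficients of derivatives. -/
theorem trigCoef_iteratedDerivWithin (a b : ℝ) (hab : a < b) (N M : ℕ) (f : ℝ → ℂ)
    (hf : ContDiffOn ℝ M f (Icc a b))
    (he : ∀ j < N, iteratedDerivWithin (2 * j) f (Icc a b) a = 0 ∧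
      iteratedDerivWithin (2 * j) f (Icc a b) b = 0) (n : ℕ) :
    ∀ k : ℕ, k ≤ 2 * N → k ≤ M → trigCoef a b k (iteratedDerivWithin k f (Icc a b)) n =
      ((n * π / (b - a) : ℝ) : ℂ) ^ k * trigCoef a b 0 f n := by
  intro k
  induction k with
  | zero => intro _ _; simp [iteratedDerivWithin_zero]
  | succ k ih =>
    intro hk1 hk2
    have ih := ih (by omega) (by omega)
    rw [pow_succ, mul_comm (_ ^ k), mul_assoc, ← ih]
    set F := iteratedDerivWithin k f (Icc a b)
    have hun := uniqueDiffOn_Icc hab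
    have hF' : ∀ x ∈ Icc a b, HasDerivWithinAt F (iteratedDerivWithin (k + 1) f (Icc a b) x)
        (Icc a b) x := by
      intro x hx
      rw [iteratedDerivWithin_succ]
      exact ((hf.differentiableOn_iteratedDerivWithin (by exact_mod_cast hk2) hun)
        x hx).hasDerivWithinAt
    have hFc' : ContinuousOn (iteratedDerivWithin (k + 1) f (Icc a b)) (Icc a b) :=
      hf.continuousOn_iteratedDerivWithin (by exact_mod_cast hk2) hun
    have hv : ∀ x, HasDerivAt (fun t => (trigOn a b (k + 1) n t : ℂ))
        ((-(n * π / (b - a)) * trigOn a b k n x : ℝ) : ℂ) x := by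
      intro x
      have := (trigOn_hasDerivAt a b (k + 1) n x).ofReal_comp
      refine this.congr_deriv ?_
      rw [show trigOn a b (k + 1 + 1) n x = - trigOn a b k n x from trig_add_two _ _ _ _]
      push_cast; ring
    have hcv := (trigOn_continuous a b k n)
    have huI : uIcc a b = Icc a b := uIcc_of_le hab.le
    have key := intervalIntegral.integral_mul_deriv_eq_deriv_mul_of_hasDerivWithinAt
      (u := F) (v := fun t => (trigOn a b (k + 1) n t : ℂ))
      (u' := iteratedDerivWithin (k + 1) f (Icc a b))
      (v' := fun x => ((-(n * π / (b - a)) * trigOn a b k n x : ℝ) : ℂ)) (a := a) (b := b)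
      (by rw [huI]; exact hF') (by rw [huI]; exact fun x _ => (hv x).hasDerivWithinAt)
      (ContinuousOn.intervalIntegrable (by rw [huI]; exact hFc'))
      (Continuous.intervalIntegrable (by fun_prop) _ _)
    have hb : F b * (trigOn a b (k + 1) n b : ℂ) = 0 ∧ F a * (trigOn a b (k + 1) n a : ℂ) = 0 := by
      rcases Nat.even_or_odd k with hk | hk
      · obtain ⟨j, rfl⟩ := hk
        have := he j (by omega)
        rw [two_mul] at this
        simp [F, this.1, this.2]
      · have h2 : Even (k + 1) := hk.add_one
        simp only [trigOn, sub_self, trig_even_zero _ _ _ h2,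
          trig_even_right (b - a) (by linarith) _ _ h2]
        simp
    simp only [hb.1, hb.2, sub_zero, zero_sub] at key
    unfold trigCoef
    have e : ∫ x in a..b, F x * ((-(n * π / (b - a)) * trigOn a b k n x : ℝ) : ℂ) =
        -((n * π / (b - a) : ℝ) : ℂ) * ∫ x in a..b, F x * (trigOn a b k n x : ℂ) := by
      rw [← intervalIntegral.integral_const_mul]
      congr 1; ext x; push_cast; ring
    rw [e] at key
    linear_combination ((2 / (b - a) : ℝ) : ℂ) * key

theorem trigCoef_sum_le (a b : ℝ) (hab : a < b) (N M : ℕ) (f : ℝ → ℂ)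
    (hf : ContDiffOn ℝ M f (Icc a b))
    (he : ∀ j < N, iteratedDerivWithin (2 * j) f (Icc a b) a = 0 ∧
      iteratedDerivWithin (2 * j) f (Icc a b) b = 0) (μ : ℕ) (hμ1 : μ ≤ 2 * N) (hμ2 : μ ≤ M)
    (F : Finset ℕ) (hF : ∀ n ∈ F, 1 ≤ n) :
    ∑ n ∈ F, (b - a) / 2 * ‖trigCoef a b 0 f n‖ ^ 2 * (n * π / (b - a)) ^ (2 * μ) ≤
      ∫ t in a..b, ‖iteratedDerivWithin μ f (Icc a b) t‖ ^ 2 := by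
  have h := trig_bessel a b hab μ F hF (iteratedDerivWithin μ f (Icc a b))
    (hf.continuousOn_iteratedDerivWithin (by exact_mod_cast hμ2) (uniqueDiffOn_Icc hab))
  refine le_trans (le_of_eq ?_) h
  rw [Finset.mul_sum]
  refine Finset.sum_congr rfl fun n _ => ?_
  rw [trigCoef_iteratedDerivWithin a b hab N M f hf he n μ hμ1 hμ2, norm_mul, norm_pow,
    Complex.norm_real, mul_pow, Real.norm_eq_abs, ← pow_mul, mul_comm μ 2,
        pow_mul |_|, sq_abs, pow_mul]
  ring

theorem summable_trigCoef (a b : ℝ) (hab : a < b) (N M : ℕ) (hN : 1 ≤ N) (hM : 1 ≤ M) (f : ℝ → ℂ)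
    (hf : ContDiffOn ℝ M f (Icc a b))
    (he : ∀ j < N, iteratedDerivWithin (2 * j) f (Icc a b) a = 0 ∧
      iteratedDerivWithin (2 * j) f (Icc a b) b = 0) :
    Summable fun n => ‖trigCoef a b 0 f n‖ := by
  have hba : 0 < b - a := by linarith
  have hpi := Real.pi_pos
  rw [← summable_nat_add_iff 1]
  have s1 : Summable fun n : ℕ => (b - a) / 2 * ‖trigCoef a b 0 f (n + 1)‖ ^ 2 *
      (((n + 1 : ℕ) : ℝ) * π / (b - a)) ^ (2 * 1) := by
    refine summable_of_sum_range_le (c := ∫ t in a..b, ‖iteratedDerivWithin 1 f (Icc a b) t‖ ^ 2)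
      (fun n => by positivity) fun n => ?_
    have := trigCoef_sum_le a b hab N M f hf he 1 (by omega) hM (Finset.Ico 1 (n + 1))
      (fun m hm => (Finset.mem_Ico.1 hm).1)
    rw [Finset.sum_Ico_eq_sum_range] at this
    simpa [add_comm] using this
  have s2 : Summable fun n : ℕ => (1 : ℝ) / ((n + 1 : ℕ) : ℝ) ^ 2 :=
    (summable_nat_add_iff 1).2 (Real.summable_one_div_nat_pow.2 one_lt_two)
  refine Summable.of_nonneg_of_le (fun n => norm_nonneg _) (fun n => ?_)
    ((s1.mul_left ((b - a) / π ^ 2)).add s2)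
  set x := ‖trigCoef a b 0 f (n + 1)‖
  set m : ℝ := ((n + 1 : ℕ) : ℝ)
  have hm : 0 < m := by positivity
  have : (b - a) / π ^ 2 * ((b - a) / 2 * x ^ 2 * (m * π / (b - a)) ^ (2 * 1)) =
      (x * m) ^ 2 / 2 := by
    simp only [mul_one, mul_pow, div_pow]
    field_simp
  rw [this, div_add_div _ _ (by norm_num) (by positivity), le_div_iff₀ (by positivity)]
  nlinarith [sq_nonneg (x * m ^ 2 - 1)]

theorem hasSum_sine (a b : ℝ) (hab : a < b) (f : ℝ → ℂ) (hf : ContinuousOn f (Icc a b))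
    (h0 : f a = 0) (h1 : f b = 0) (hs : Summable fun n => ‖trigCoef a b 0 f n‖) :
    ∀ x ∈ Icc a b, ∑' n, trigCoef a b 0 f n * (trigOn a b 0 n x : ℂ) = f x := by
  set S : ℝ → ℂ := fun x => ∑' n, trigCoef a b 0 f n * (trigOn a b 0 n x : ℂ) with hS
  have hb : ∀ n x, ‖trigCoef a b 0 f n * (trigOn a b 0 n x : ℂ)‖ ≤ ‖trigCoef a b 0 f n‖ := by
    intro n x
    rw [norm_mul, Complex.norm_real]
    exact mul_le_of_le_one_right (norm_nonneg _) (abs_trig_le _ _ _ _)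
  have hSc : Continuous S := continuous_tsum
    (fun n => continuous_const.mul (Complex.continuous_ofReal.comp
        (trigOn_continuous a b 0 n))) hs hb
  have hS0 : S a = 0 := by
    simp [hS, trigOn, trig_even_zero]
  have hS1 : S b = 0 := by
    simp [hS, trigOn, trig_even_right (b - a) (by linarith)]
  have huI : uIcc a b = Icc a b := uIcc_of_le hab.le
  have key := sine_unique a b hab (fun x => f x - S x) (hf.sub hSc.continuousOn)
    (by simp [h0, hS0]) (by simp [h1, hS1]) (by
    intro m hm
    have hcm := trigOn_continuous a b 0 m
    simp_rw [sub_mul]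
    rw [intervalIntegral.integral_sub (ContinuousOn.intervalIntegrable (by
        rw [huI]; exact hf.mul (by fun_prop)))
      (Continuous.intervalIntegrable (by fun_prop) _ _)]
    have h2 : HasSum (fun n => ∫ t in a..b, trigCoef a b 0 f n * (trigOn a b 0 n t : ℂ) *
        (trigOn a b 0 m t : ℂ)) (∫ t in a..b, S t * (trigOn a b 0 m t : ℂ)) := by
      refine intervalIntegral.hasSum_integral_of_dominated_convergence
        (fun n _ => ‖trigCoef a b 0 f n‖) (fun n => ?_) (fun n => ?_) ?_ ?_ ?_
      · have := trigOn_continuous a b 0 n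
        exact Continuous.aestronglyMeasurable (by fun_prop)
      · refine Filter.Eventually.of_forall fun t _ => ?_
        rw [norm_mul]
        refine (mul_le_of_le_one_right (norm_nonneg _) ?_).trans (hb n t)
        rw [Complex.norm_real]; exact abs_trig_le _ _ _ _
      · exact Filter.Eventually.of_forall fun t _ => hs
      · simp
      · refine Filter.Eventually.of_forall fun t _ => ?_
        exact (Summable.of_norm_bounded hs (hb · t)).hasSum.mul_right _
    have h3 : ∀ n, ∫ t in a..b, trigCoef a b 0 f n * (trigOn a b 0 n t : ℂ) *
        (trigOn a b 0 m t : ℂ) = if n = m then trigCoef a b 0 f m * ((b - a) / 2 : ℝ) else 0 := by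
      intro n
      simp_rw [mul_assoc]
      rw [intervalIntegral.integral_const_mul]
      simp_rw [← Complex.ofReal_mul]
      rw [intervalIntegral.integral_ofReal]
      rcases Nat.eq_zero_or_pos n with h | h
      · subst h; rw [if_neg (by omega)]; simp [trigOn, trig]
      · rw [integral_trigOn_mul a b hab 0 n m h hm]
        split_ifs with h
        · subst h; rfl
        · simp
    simp_rw [h3] at h2
    rw [h2.unique (hasSum_ite_eq m _)]
    unfold trigCoef
    have : ((2 / (b - a) : ℝ) : ℂ) * ((b - a) / 2 : ℝ) = 1 := by
      rw [← Complex.ofReal_mul]; norm_cast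
      have : b - a ≠ 0 := by linarith
      field_simp
    linear_combination (- ∫ t in a..b, f t * (trigOn a b 0 m t : ℂ)) * this)
  intro x hx
  exact (sub_eq_zero.1 (key x hx)).symm

/-- The complex frequency of the `n`-th edge mode in the direction normal to the edge. -/
def modeFreq (κ L1 : ℝ) (n : ℕ) : ℂ := κ * csqrt (1 - nuHat κ L1 n ^ 2)

/-- The `j`-th derivative of the normal factor of the `n`-th edge mode. -/
def modeD (κ L1 L2 : ℝ) (j n : ℕ) (t : ℝ) : ℂ :=
  modeFreq κ L1 n ^ j * Complex.sin (modeFreq κ L1 n * t + j * (π / 2)) /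
    Complex.sin (modeFreq κ L1 n * L2)

theorem csqrt_sq (r : ℝ) : csqrt r ^ 2 = (r : ℂ) := by
  unfold csqrt
  rw [show (1 / 2 : ℂ) = ((2 : ℕ) : ℂ)⁻¹ by norm_num]
  exact Complex.cpow_nat_inv_pow _ (by norm_num)

theorem modeFreq_sq (κ L1 : ℝ) (hκ : 0 < κ) (hL1 : 0 < L1) (n : ℕ) :
    modeFreq κ L1 n ^ 2 = ((κ ^ 2 - (n * π / L1) ^ 2 : ℝ) : ℂ) := by
  unfold modeFreq
  rw [mul_pow, csqrt_sq, ← Complex.ofReal_pow, ← Complex.ofReal_mul]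
  congr 1
  unfold nuHat
  field_simp

theorem modeD_hasDerivAt (κ L1 L2 : ℝ) (j n : ℕ) (t : ℝ) :
    HasDerivAt (modeD κ L1 L2 j n) (modeD κ L1 L2 (j + 1) n t) t := by
  set θ := modeFreq κ L1 n with hθ
  have h1 : HasDerivAt (fun t : ℝ => θ * (t : ℂ) + j * (π / 2)) θ t := by
    simpa using ((Complex.ofRealCLM.hasDerivAt (x := t)).const_mul θ).add_const ((j : ℂ) * (π / 2))
  have h2 := ((Complex.hasDerivAt_sin _).comp t h1).const_mul (θ ^ j) |>.div_const
    (Complex.sin (θ * L2))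
  refine h2.congr_deriv ?_
  unfold modeD
  rw [← hθ]
  push_cast
  rw [show θ * t + ((j : ℂ) + 1) * (π / 2) = (θ * t + j * (π / 2)) + π / 2 by ring,
    Complex.sin_add_pi_div_two]
  ring

theorem modeD_continuous (κ L1 L2 : ℝ) (j n : ℕ) : Continuous (modeD κ L1 L2 j n) :=
  continuous_iff_continuousAt.2 fun t => (modeD_hasDerivAt κ L1 L2 j n t).continuousAt

theorem modeD_two (κ L1 L2 : ℝ) (hκ : 0 < κ) (hL1 : 0 < L1) (j n : ℕ) (t : ℝ) :
    modeD κ L1 L2 (j + 2) n t = (((n * π / L1) ^ 2 - κ ^ 2 : ℝ) : ℂ) * modeD κ L1 L2 j n t := by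
  have h := modeFreq_sq κ L1 hκ hL1 n
  unfold modeD
  push_cast at h ⊢
  rw [show modeFreq κ L1 n * t + ((j : ℂ) + 2) * (π / 2)
    = (modeFreq κ L1 n * t + j * (π / 2)) + π by ring, Complex.sin_add_pi, pow_add, h]
  ring

theorem sin_modeFreq_ne_zero (κ L1 L2 : ℝ) (hκ : 0 < κ) (hL1 : 0 < L1) (hL2 : 0 < L2)
    (h : A0cond κ L1 L2) (n : ℕ) : Complex.sin (modeFreq κ L1 n * L2) ≠ 0 := by
  intro hs
  obtain ⟨k, hk⟩ := Complex.sin_eq_zero_iff.1 hs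
  have h1 := modeFreq_sq κ L1 hκ hL1 n
  have h2 : modeFreq κ L1 n = k * π / L2 := by
    have : (L2 : ℂ) ≠ 0 := by exact_mod_cast hL2.ne'
    field_simp; exact hk
  rw [h2] at h1
  have h3 : (k * π / L2) ^ 2 = κ ^ 2 - (n * π / L1) ^ 2 := by exact_mod_cast h1
  apply h n k.natAbs
  have h4 : ((k.natAbs : ℕ) : ℝ) ^ 2 = (k : ℝ) ^ 2 := by
    rw [← Int.cast_natCast, Int.natCast_natAbs, Int.cast_abs, sq_abs]
  rw [div_pow, mul_pow] at h3
  rw [div_pow (_ * _) L2, mul_pow (_ : ℝ) π 2, h4]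
  linarith

theorem modeD_zero (κ L1 L2 : ℝ) (n : ℕ) : modeD κ L1 L2 0 n 0 = 0 := by
  simp [modeD]

theorem modeD_right (κ L1 L2 : ℝ) (hκ : 0 < κ) (hL1 : 0 < L1) (hL2 : 0 < L2)
    (h : A0cond κ L1 L2) (n : ℕ) : modeD κ L1 L2 0 n L2 = 1 := by
  simp [modeD, sin_modeFreq_ne_zero κ L1 L2 hκ hL1 hL2 h n]

theorem norm_sq_complex_sin (x y : ℝ) :
    ‖Complex.sin (x + y * Complex.I)‖ ^ 2 = Real.sin x ^ 2 + Real.sinh y ^ 2 := by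
  rw [Complex.sin_add_mul_I, ← Complex.normSq_eq_norm_sq, ← Complex.ofReal_sin,
    ← Complex.ofReal_cos, ← Complex.ofReal_sinh, ← Complex.ofReal_cosh, ← Complex.ofReal_mul,
    ← Complex.ofReal_mul, Complex.normSq_add_mul_I]
  have := Real.cosh_sq y
  have := Real.sin_sq_add_cos_sq x
  rw [mul_pow, mul_pow, Real.cosh_sq, show Real.cos x ^ 2 = 1 - Real.sin x ^ 2 by linarith]
  ring

/-- The decay rate of the `n`-th edge mode. -/
def modeRate (κ L1 : ℝ) (n : ℕ) : ℝ := Real.sqrt ((n * π / L1) ^ 2 - κ ^ 2)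

theorem modeFreq_eq (κ L1 : ℝ) (hκ : 0 < κ) (hL1 : 0 < L1) (n : ℕ) (hn : κ ≤ n * π / L1) :
    ∃ s : ℝ, s ^ 2 = 1 ∧ modeFreq κ L1 n = s * modeRate κ L1 n * Complex.I := by
  have h := modeFreq_sq κ L1 hκ hL1 n
  have h0 : 0 ≤ (n * π / L1) ^ 2 - κ ^ 2 := by nlinarith
  have h1 : modeFreq κ L1 n ^ 2 = (modeRate κ L1 n * Complex.I) ^ 2 := by
    rw [h, mul_pow, Complex.I_sq, ← Complex.ofReal_pow, modeRate, Real.sq_sqrt h0]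
    push_cast; ring
  rcases sq_eq_sq_iff_eq_or_eq_neg.1 h1 with h2 | h2
  · exact ⟨1, by norm_num, by rw [h2]; push_cast; ring⟩
  · exact ⟨-1, by norm_num, by rw [h2]; push_cast; ring⟩

theorem norm_sq_modeD (κ L1 L2 : ℝ) (hκ : 0 < κ) (hL1 : 0 < L1) (j n : ℕ)
    (hn : κ ≤ n * π / L1) (t : ℝ) :
    ‖modeD κ L1 L2 j n t‖ ^ 2 = modeRate κ L1 n ^ (2 * j) *
      (Real.sin (j * (π / 2)) ^ 2 + Real.sinh (modeRate κ L1 n * t) ^ 2) /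
        Real.sinh (modeRate κ L1 n * L2) ^ 2 := by
  obtain ⟨s, hs, e⟩ := modeFreq_eq κ L1 hκ hL1 n hn
  set c := modeRate κ L1 n
  have hc : 0 ≤ c := Real.sqrt_nonneg _
  have hsinh : ∀ x, Real.sinh (s * x) ^ 2 = Real.sinh x ^ 2 := by
    intro x
    have : (s - 1) * (s + 1) = 0 := by linear_combination hs
    rcases mul_eq_zero.1 this with h | h
    · simp [show s = 1 by linarith]
    · simp [show s = -1 by linarith]
  have hθ : ‖modeFreq κ L1 n‖ ^ 2 = c ^ 2 := by
    rw [e, norm_mul, norm_mul, Complex.norm_I, Complex.norm_real, Complex.norm_real,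
      mul_one, mul_pow, Real.norm_eq_abs, Real.norm_eq_abs, sq_abs, sq_abs, hs, one_mul]
  unfold modeD
  rw [norm_div, norm_mul, div_pow, mul_pow, norm_pow, ← pow_mul, mul_comm j 2,
    pow_mul, hθ, ← pow_mul]
  have e1 : modeFreq κ L1 n * t + j * (π / 2) =
      ((j * (π / 2) : ℝ) : ℂ) + ((s * (c * t) : ℝ) : ℂ) * Complex.I := by
    rw [e]; push_cast; ring
  have e2 : modeFreq κ L1 n * L2 =
      ((0 : ℝ) : ℂ) + ((s * (c * L2) : ℝ) : ℂ) * Complex.I := by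
    rw [e]; push_cast; ring
  rw [e1, e2, norm_sq_complex_sin, norm_sq_complex_sin, hsinh, hsinh]
  simp

theorem integral_sinh_sq (c L : ℝ) (hc : 0 < c) :
    ∫ t in (0 : ℝ)..L, Real.sinh (c * t) ^ 2 =
      Real.sinh (c * L) * Real.cosh (c * L) / (2 * c) - L / 2 := by
  have : ∀ t ∈ uIcc 0 L, HasDerivAt
      (fun t => Real.sinh (c * t) * Real.cosh (c * t) / (2 * c) - t / 2)
      (Real.sinh (c * t) ^ 2) t := by
    intro t _
    have h0 : HasDerivAt (fun t => c * t) c t := by simpa using (hasDerivAt_id' t).const_mul c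
    have h1 := ((h0.sinh.mul h0.cosh).div_const (2 * c)).sub ((hasDerivAt_id' t).div_const 2)
    refine h1.congr_deriv ?_
    field_simp
    have := Real.cosh_sq (c * t)
    ring_nf at this ⊢
    rw [this]; ring
  rw [intervalIntegral.integral_eq_sub_of_hasDerivAt this]
  · simp
  · exact Continuous.intervalIntegrable (by fun_prop) _ _

theorem integral_norm_sq_modeD_le (κ L1 L2 : ℝ) (hκ : 0 < κ) (hL1 : 0 < L1) (hL2 : 0 < L2)
    (j n : ℕ) (hn : κ < n * π / L1) :
    ∫ t in (0 : ℝ)..L2, ‖modeD κ L1 L2 j n t‖ ^ 2 ≤ (if j = 0 then 1 / 2 else 1) *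
      modeRate κ L1 n ^ (2 * j) / (modeRate κ L1 n * Real.tanh (modeRate κ L1 n * L2)) := by
  have e := norm_sq_modeD κ L1 L2 hκ hL1 j n hn.le
  simp_rw [e]
  set c := modeRate κ L1 n with hcdef
  have hc : 0 < c := Real.sqrt_pos.2 (by nlinarith)
  have hcL : 0 < c * L2 := by positivity
  have hs : 0 < Real.sinh (c * L2) := Real.sinh_pos_iff.2 hcL
  have hch : 0 < Real.cosh (c * L2) := Real.cosh_pos _
  rw [intervalIntegral.integral_div, intervalIntegral.integral_const_mul,
    intervalIntegral.integral_add (by simp)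
      (Continuous.intervalIntegrable (by fun_prop) _ _), integral_sinh_sq c L2 hc,
    Real.tanh_eq_sinh_div_cosh]
  have hle : c * L2 ≤ Real.sinh (c * L2) := Real.self_le_sinh_iff.2 hcL.le
  have hle2 : c * L2 ≤ Real.sinh (c * L2) * Real.cosh (c * L2) := by
    nlinarith [Real.one_le_cosh (c * L2)]
  have key : (∫ x in (0:ℝ)..L2, Real.sin (j * (π / 2)) ^ 2) +
      (Real.sinh (c * L2) * Real.cosh (c * L2) / (2 * c) - L2 / 2)
      ≤ (if j = 0 then 1 / 2 else 1) * (Real.sinh (c * L2) * Real.cosh (c * L2) / c) := by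
    rw [intervalIntegral.integral_const]
    split_ifs with hj
    · subst hj
      simp
      rw [show Real.sinh (c * L2) * Real.cosh (c * L2) / (2 * c) =
        2⁻¹ * (Real.sinh (c * L2) * Real.cosh (c * L2) / c) by field_simp]
      linarith
    · have h1 := Real.sin_sq_le_one (j * (π / 2))
      have h2 : L2 ≤ Real.sinh (c * L2) * Real.cosh (c * L2) / c := by
        rw [le_div_iff₀ hc]; linarith
      rw [show Real.sinh (c * L2) * Real.cosh (c * L2) / (2 * c) =
        2⁻¹ * (Real.sinh (c * L2) * Real.cosh (c * L2) / c) by field_simp]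
      simp only [smul_eq_mul]
      nlinarith
  calc _ ≤ c ^ (2 * j) * ((if j = 0 then 1 / 2 else 1) *
      (Real.sinh (c * L2) * Real.cosh (c * L2) / c)) / Real.sinh (c * L2) ^ 2 := by gcongr
    _ = _ := by field_simp

theorem norm_modeD_le_exp (κ L1 L2 : ℝ) (hκ : 0 < κ) (hL1 : 0 < L1) (hL2 : 0 < L2) (j n : ℕ)
    (hn : 2 * κ ≤ n * π / L1) (hn2 : 2 ≤ n * π / L1 * L2) (t : ℝ) (ht : t ∈ Icc 0 L2) :
    ‖modeD κ L1 L2 j n t‖ ≤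
      4 * (n * π / L1) ^ j * Real.exp (-(n * π / L1 / 2 * (L2 - t))) := by
  have e := norm_sq_modeD κ L1 L2 hκ hL1 j n (by linarith) t
  have hl : 0 ≤ n * π / L1 := by positivity
  set l := n * π / L1 with hldef
  set c := modeRate κ L1 n with hcdef
  have hc1 : l / 2 ≤ c := Real.le_sqrt_of_sq_le (by rw [← hldef]; nlinarith)
  have hc2 : c ≤ l := by
    refine Real.sqrt_le_iff.2 ⟨hl, ?_⟩
    rw [← hldef]; nlinarith
  have hc : 0 ≤ c := Real.sqrt_nonneg _
  have hcL : 1 ≤ c * L2 := by nlinarith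
  have hs : Real.exp (c * L2) / 4 ≤ Real.sinh (c * L2) := by
    rw [Real.sinh_eq]
    have h1 : Real.exp (-(c * L2)) ≤ 1 := Real.exp_le_one_iff.2 (by linarith)
    have h2 : c * L2 + 1 ≤ Real.exp (c * L2) := Real.add_one_le_exp _
    linarith
  have hsq : Real.sin (j * (π / 2)) ^ 2 + Real.sinh (c * t) ^ 2 ≤ Real.exp (c * t) ^ 2 := by
    have h1 := Real.sin_sq_le_one (j * (π / 2))
    have h2 := Real.cosh_sq (c * t)
    have h3 : Real.cosh (c * t) ≤ Real.exp (c * t) := by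
      rw [Real.cosh_eq]
      have : Real.exp (-(c * t)) ≤ Real.exp (c * t) :=
        Real.exp_le_exp.2 (by nlinarith [mul_nonneg hc ht.1])
      linarith
    have h4 := Real.cosh_pos (c * t)
    nlinarith
  have hE := Real.exp_pos (c * L2)
  have h1 : ‖modeD κ L1 L2 j n t‖ ≤ 4 * c ^ j * Real.exp (-(c * (L2 - t))) := by
    refine le_of_sq_le_sq ?_ (by positivity)
    rw [e]
    calc _ ≤ c ^ (2 * j) * Real.exp (c * t) ^ 2 / (Real.exp (c * L2) / 4) ^ 2 := by gcongr
      _ = _ := by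
        rw [show -(c * (L2 - t)) = c * t - c * L2 by ring, Real.exp_sub]
        field_simp
        ring
  refine h1.trans ?_
  gcongr
  linarith [ht.2]

theorem exists_nat_freq_ge (L1 : ℝ) (hL1 : 0 < L1) (B : ℝ) :
    ∃ n₀ : ℕ, ∀ n : ℕ, n₀ ≤ n → B ≤ n * π / L1 := by
  obtain ⟨n₀, h⟩ := exists_nat_ge (B / (π / L1))
  refine ⟨n₀, fun n hn => ?_⟩
  have hp : 0 < π / L1 := by positivity
  have : B / (π / L1) ≤ n := h.trans (by exact_mod_cast hn)
  rw [div_le_iff₀ hp] at this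
  rw [mul_div_assoc]; exact this

theorem modeD_bounded (κ L1 L2 : ℝ) (j n : ℕ) :
    ∃ C, ∀ t ∈ Icc 0 L2, ‖modeD κ L1 L2 j n t‖ ≤ C :=
  isCompact_Icc.exists_bound_of_continuousOn (modeD_continuous κ L1 L2 j n).continuousOn

theorem modeD_uniformly_bounded (κ L1 L2 : ℝ) (hκ : 0 < κ) (hL1 : 0 < L1) (hL2 : 0 < L2) :
    ∃ K, ∀ n, ∀ t ∈ Icc 0 L2, ‖modeD κ L1 L2 0 n t‖ ≤ K := by
  obtain ⟨n₀, h₀⟩ := exists_nat_freq_ge L1 hL1 (max (2 * κ) (2 / L2))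
  choose C hC using modeD_bounded κ L1 L2 0
  refine ⟨max 4 (∑ n ∈ Finset.range n₀, |C n|), fun n t ht => ?_⟩
  by_cases hn : n₀ ≤ n
  · have hm := max_le_iff.1 (h₀ n hn)
    have h2 : 2 ≤ n * π / L1 * L2 := by rw [← div_le_iff₀ hL2]; exact hm.2
    refine (norm_modeD_le_exp κ L1 L2 hκ hL1 hL2 0 n hm.1 h2 t ht).trans (le_max_of_le_left ?_)
    have : Real.exp (-(n * π / L1 / 2 * (L2 - t))) ≤ 1 := Real.exp_le_one_iff.2 (by
      have : 0 ≤ n * π / L1 := by positivity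
      nlinarith [ht.2])
    simpa using this
  · refine ((hC n t ht).trans (le_abs_self _)).trans (le_max_of_le_right ?_)
    exact Finset.single_le_sum (f := fun n => |C n|) (fun _ _ => abs_nonneg _)
      (Finset.mem_range.2 (not_le.1 hn))

theorem modeD_summable_bound (κ L1 L2 : ℝ) (hκ : 0 < κ) (hL1 : 0 < L1) (hL2 : 0 < L2) (i j : ℕ)
    (δ : ℝ) (hδ : 0 < δ) :
    ∃ b : ℕ → ℝ, Summable b ∧ ∀ n t, t ∈ Icc 0 (L2 - δ) →
      (n * π / L1) ^ i * ‖modeD κ L1 L2 j n t‖ ≤ b n := by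
  obtain ⟨n₀, h₀⟩ := exists_nat_freq_ge L1 hL1 (max (2 * κ) (2 / L2))
  choose C hC using modeD_bounded κ L1 L2 j
  set g : ℕ → ℝ := fun n => 4 * (π / L1) ^ (i + j) *
    ((n : ℝ) ^ (i + j) * Real.exp (-(π / L1 / 2 * δ) * n)) with hg
  have hgs : Summable g :=
    (Real.summable_pow_mul_exp_neg_nat_mul (i + j) (by positivity)).mul_left _
  refine ⟨fun n => g n + if n < n₀ then (n * π / L1) ^ i * |C n| else 0, hgs.add ?_,
    fun n t ht => ?_⟩
  · exact summable_of_ne_finset_zero (s := Finset.range n₀) fun n hn => by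
      simp at hn; simp [not_lt.2 hn]
  · have ht' : t ∈ Icc 0 L2 := ⟨ht.1, by linarith [ht.2]⟩
    have hg0 : 0 ≤ g n := by positivity
    by_cases hn : n < n₀
    · simp only [hn, if_true]
      have := (hC n t ht').trans (le_abs_self _)
      have : (n * π / L1) ^ i * ‖modeD κ L1 L2 j n t‖ ≤ (n * π / L1) ^ i * |C n| := by gcongr
      linarith
    · simp only [hn, if_false, add_zero]
      have hm := max_le_iff.1 (h₀ n (not_lt.1 hn))
      have h2 : 2 ≤ n * π / L1 * L2 := by rw [← div_le_iff₀ hL2]; exact hm.2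
      have h3 := norm_modeD_le_exp κ L1 L2 hκ hL1 hL2 j n hm.1 h2 t ht'
      calc _ ≤ (n * π / L1) ^ i * (4 * (n * π / L1) ^ j * Real.exp (-(n * π / L1 / 2 * δ))) := by
            gcongr
            refine h3.trans ?_
            gcongr
            linarith [ht.2]
        _ = _ := by
          rw [hg]
          simp only []
          rw [show -(n * π / L1 / 2 * δ) = -(π / L1 / 2 * δ) * n by ring,
            show n * π / L1 = n * (π / L1) by ring, pow_add, pow_add, mul_pow, mul_pow]
          ring

/-- A doubly indexed family of functions which are the continuous partial derivatives of one
another on `U`. -/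
structure IsJet (U : Set (ℝ × ℝ)) (D : ℕ → ℕ → ℝ × ℝ → ℂ) : Prop where
  cont : ∀ i j, ContinuousOn (D i j) U
  d1 : ∀ i j, ∀ p ∈ U, HasDerivAt (fun t => D i j (t, p.2)) (D (i + 1) j p) p.1
  d2 : ∀ i j, ∀ p ∈ U, HasDerivAt (fun t => D i j (p.1, t)) (D i (j + 1) p) p.2

theorem IsJet.add {U : Set (ℝ × ℝ)} {D E : ℕ → ℕ → ℝ × ℝ → ℂ} (hD : IsJet U D) (hE : IsJet U E) :
    IsJet U fun i j p => D i j p + E i j p :=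
  ⟨fun i j => (hD.cont i j).add (hE.cont i j),
    fun i j p hp => (hD.d1 i j p hp).add (hE.d1 i j p hp),
    fun i j p hp => (hD.d2 i j p hp).add (hE.d2 i j p hp)⟩

theorem IsJet.swap {U : Set (ℝ × ℝ)} {D : ℕ → ℕ → ℝ × ℝ → ℂ} (hD : IsJet U D) :
    IsJet (Prod.swap ⁻¹' U) fun i j p => D j i p.swap :=
  ⟨fun i j => (hD.cont j i).comp continuous_swap.continuousOn (fun _ h => h),
    fun i j p hp => hD.d2 j i p.swap hp, fun i j p hp => hD.d1 j i p.swap hp⟩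

theorem pd1_eqOn {U : Set (ℝ × ℝ)} (hU : IsOpen U) {f g : ℝ × ℝ → ℂ} (h : EqOn f g U) :
    EqOn (pd1 f) (pd1 g) U := by
  intro p hp
  refine Filter.EventuallyEq.deriv_eq ?_
  have hc : Continuous fun t : ℝ => (t, p.2) := by fun_prop
  filter_upwards [(hU.preimage hc).mem_nhds hp] with t ht using h ht

theorem pd2_eqOn {U : Set (ℝ × ℝ)} (hU : IsOpen U) {f g : ℝ × ℝ → ℂ} (h : EqOn f g U) :
    EqOn (pd2 f) (pd2 g) U := by
  intro p hp
  refine Filter.EventuallyEq.deriv_eq ?_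
  have hc : Continuous fun t : ℝ => (p.1, t) := by fun_prop
  filter_upwards [(hU.preimage hc).mem_nhds hp] with t ht using h ht

theorem IsJet.pdM_eq {U : Set (ℝ × ℝ)} (hU : IsOpen U) {D : ℕ → ℕ → ℝ × ℝ → ℂ} (hD : IsJet U D)
    {f : ℝ × ℝ → ℂ} (hf : EqOn f (D 0 0) U) (i j : ℕ) : EqOn (pdM i j f) (D i j) U := by
  have h2 : EqOn (pd2^[j] f) (D 0 j) U := by
    induction j with
    | zero => exact hf
    | succ j ih =>
      rw [Function.iterate_succ_apply']
      exact (pd2_eqOn hU ih).trans fun p hp => (hD.d2 0 j p hp).deriv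
  unfold pdM
  induction i with
  | zero => exact h2
  | succ i ih =>
    rw [Function.iterate_succ_apply']
    exact (pd1_eqOn hU ih).trans fun p hp => (hD.d1 i j p hp).deriv

/-- The `j`-th derivative of the normal factor, based at height `e` with orientation `σ`. -/
def normalD (κ L1 L2 σ e : ℝ) (j n : ℕ) (y : ℝ) : ℂ := (σ : ℂ) ^ j * modeD κ L1 L2 j n (σ * (y - e))

/-- The `i`-th derivative of the `n`-th sine mode on `(a, b)`. -/
def sineD (a b : ℝ) (i n : ℕ) (x : ℝ) : ℂ := (((n * π / (b - a)) ^ i * trigOn a b i n x : ℝ) : ℂ)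

/-- Partial derivatives of a series of edge modes. -/
def edgeSer (κ a b L2 σ e : ℝ) (c : ℕ → ℂ) (i j : ℕ) (p : ℝ × ℝ) : ℂ :=
  ∑' n, c n * sineD a b i n p.1 * normalD κ (b - a) L2 σ e j n p.2

theorem normalD_hasDerivAt (κ L1 L2 σ e : ℝ) (j n : ℕ) (y : ℝ) :
    HasDerivAt (normalD κ L1 L2 σ e j n) (normalD κ L1 L2 σ e (j + 1) n y) y := by
  have h0 : HasDerivAt (fun y => σ * (y - e)) σ y := by
    simpa using ((hasDerivAt_id' y).sub_const e).const_mul σ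
  have h := ((modeD_hasDerivAt κ L1 L2 j n (σ * (y - e))).scomp y h0).const_mul ((σ : ℂ) ^ j)
  refine h.congr_deriv ?_
  unfold normalD
  rw [pow_succ, Complex.real_smul]; ring

theorem normalD_continuous (κ L1 L2 σ e : ℝ) (j n : ℕ) : Continuous (normalD κ L1 L2 σ e j n) :=
  continuous_iff_continuousAt.2 fun t => (normalD_hasDerivAt κ L1 L2 σ e j n t).continuousAt

theorem sineD_hasDerivAt (a b : ℝ) (i n : ℕ) (x : ℝ) :
    HasDerivAt (sineD a b i n) (sineD a b (i + 1) n x) x := by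
  have h := ((trigOn_hasDerivAt a b i n x).const_mul ((n * π / (b - a)) ^ i)).ofReal_comp
  refine h.congr_deriv ?_
  unfold sineD
  rw [pow_succ]; push_cast; ring

theorem sineD_continuous (a b : ℝ) (i n : ℕ) : Continuous (sineD a b i n) :=
  continuous_iff_continuousAt.2 fun t => (sineD_hasDerivAt a b i n t).continuousAt

theorem norm_sineD_le (a b : ℝ) (hab : a < b) (i n : ℕ) (x : ℝ) :
    ‖sineD a b i n x‖ ≤ (n * π / (b - a)) ^ i := by
  have h0 : 0 ≤ (n * π / (b - a)) ^ i := by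
    have : 0 < b - a := by linarith
    positivity
  unfold sineD
  rw [Complex.norm_real, norm_mul, Real.norm_of_nonneg h0, Real.norm_eq_abs]
  exact mul_le_of_le_one_right h0 (abs_trig_le _ _ _ _)

/-- `e` is the endpoint of `[a₂, b₂]` opposite to the edge, and `σ` the orientation. -/
def Oriented (a2 b2 σ e : ℝ) : Prop := (σ = 1 ∧ e = a2) ∨ (σ = -1 ∧ e = b2)

theorem Oriented.mem {a2 b2 σ e : ℝ} (h : Oriented a2 b2 σ e) {δ y : ℝ}
    (hy : y ∈ Icc (a2 + δ) (b2 - δ)) : σ * (y - e) ∈ Icc δ (b2 - a2 - δ) := by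
  rcases h with ⟨rfl, rfl⟩ | ⟨rfl, rfl⟩ <;> constructor <;> linarith [hy.1, hy.2]

theorem Oriented.norm_pow {a2 b2 σ e : ℝ} (h : Oriented a2 b2 σ e) (j : ℕ) :
    ‖(σ : ℂ) ^ j‖ = 1 := by
  rcases h with ⟨rfl, rfl⟩ | ⟨rfl, rfl⟩ <;> simp

theorem edgeTerm_summable_bound (κ a b a2 b2 σ e : ℝ) (hκ : 0 < κ) (hab : a < b) (hab2 : a2 < b2)
    (ho : Oriented a2 b2 σ e) (c : ℕ → ℂ) (hc : Summable fun n => ‖c n‖) (i j : ℕ)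
    (δ : ℝ) (hδ : 0 < δ) :
    ∃ β : ℕ → ℝ, Summable β ∧ ∀ n x y, y ∈ Icc (a2 + δ) (b2 - δ) →
      ‖c n * sineD a b i n x * normalD κ (b - a) (b2 - a2) σ e j n y‖ ≤ β n := by
  obtain ⟨β, hβ, hb⟩ := modeD_summable_bound κ (b - a) (b2 - a2) hκ (by linarith) (by linarith)
    i j δ hδ
  have hba : 0 < b - a := by linarith
  obtain ⟨C, hC⟩ : ∃ C, ∀ n, ‖c n‖ ≤ C := by
    refine ⟨∑' n, ‖c n‖, fun n => hc.le_tsum n fun _ _ => norm_nonneg _⟩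
  have hC0 : 0 ≤ C := (norm_nonneg _).trans (hC 0)
  refine ⟨fun n => C * β n, hβ.mul_left C, fun n x y hy => ?_⟩
  have hm := ho.mem hy
  have h1 := hb n (σ * (y - e)) ⟨hδ.le.trans hm.1, hm.2⟩
  rw [norm_mul, norm_mul, normalD, norm_mul, ho.norm_pow, one_mul, mul_assoc]
  refine mul_le_mul (hC n) (le_trans ?_ h1) (by positivity) hC0
  gcongr
  exact norm_sineD_le a b hab i n x

theorem exists_margin {a b y : ℝ} (hy : y ∈ Ioo a b) :
    ∃ δ, 0 < δ ∧ y ∈ Ioo (a + δ) (b - δ) := by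
  refine ⟨min (y - a) (b - y) / 2,
      by have := sub_pos.2 hy.1; have := sub_pos.2 hy.2; positivity, ?_⟩
  have h1 := min_le_left (y - a) (b - y)
  have h2 := min_le_right (y - a) (b - y)
  constructor <;> linarith [hy.1, hy.2]

theorem edgeTerm_summable (κ a b a2 b2 σ e : ℝ) (hκ : 0 < κ) (hab : a < b) (hab2 : a2 < b2)
    (ho : Oriented a2 b2 σ e) (c : ℕ → ℂ) (hc : Summable fun n => ‖c n‖) (i j : ℕ) (x y : ℝ)
    (hy : y ∈ Ioo a2 b2) :
    Summable fun n => c n * sineD a b i n x * normalD κ (b - a) (b2 - a2) σ e j n y := by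
  obtain ⟨δ, hδ, hm⟩ := exists_margin hy
  obtain ⟨β, hβ, hb⟩ := edgeTerm_summable_bound κ a b a2 b2 σ e hκ hab hab2 ho c hc i j δ hδ
  exact Summable.of_norm_bounded hβ fun n => hb n x y ⟨hm.1.le, hm.2.le⟩

theorem edgeSer_isJet (κ a b a2 b2 σ e : ℝ) (hκ : 0 < κ) (hab : a < b) (hab2 : a2 < b2)
    (ho : Oriented a2 b2 σ e) (c : ℕ → ℂ) (hc : Summable fun n => ‖c n‖) :
    IsJet (Ioo a b ×ˢ Ioo a2 b2) (edgeSer κ a b (b2 - a2) σ e c) := by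
  refine ⟨fun i j => ?_, fun i j p hp => ?_, fun i j p hp => ?_⟩
  · rw [(isOpen_Ioo.prod isOpen_Ioo).continuousOn_iff]
    intro p hp
    obtain ⟨δ, hδ, hm⟩ := exists_margin hp.2
    obtain ⟨β, hβ, hb⟩ := edgeTerm_summable_bound κ a b a2 b2 σ e hκ hab hab2 ho c hc i j δ hδ
    have : ContinuousOn (edgeSer κ a b (b2 - a2) σ e c i j) (univ ×ˢ Ioo (a2 + δ) (b2 - δ)) := by
      refine continuousOn_tsum (fun n => ?_) hβ fun n q hq => hb n q.1 q.2 ⟨hq.2.1.le, hq.2.2.le⟩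
      have h1 := sineD_continuous a b i n
      have h2 := normalD_continuous κ (b - a) (b2 - a2) σ e j n
      fun_prop
    exact this.continuousAt ((isOpen_univ.prod isOpen_Ioo).mem_nhds ⟨mem_univ _, hm⟩)
  · obtain ⟨δ, hδ, hm⟩ := exists_margin hp.2
    obtain ⟨β, hβ, hb⟩ := edgeTerm_summable_bound κ a b a2 b2 σ e hκ hab hab2 ho c hc (i + 1) j δ hδ
    exact hasDerivAt_tsum_of_isPreconnected hβ isOpen_univ isPreconnected_univ
      (g := fun n t => c n * sineD a b i n t * normalD κ (b - a) (b2 - a2) σ e j n p.2)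
      (g' := fun n t => c n * sineD a b (i + 1) n t * normalD κ (b - a) (b2 - a2) σ e j n p.2)
      (fun n t _ => ((sineD_hasDerivAt a b i n t).const_mul (c n)).mul_const _)
      (fun n t _ => hb n t p.2 ⟨hm.1.le, hm.2.le⟩) (mem_univ p.1)
      (edgeTerm_summable κ a b a2 b2 σ e hκ hab hab2 ho c hc i j p.1 p.2 hp.2) (mem_univ _)
  · obtain ⟨δ, hδ, hm⟩ := exists_margin hp.2
    obtain ⟨β, hβ, hb⟩ := edgeTerm_summable_bound κ a b a2 b2 σ e hκ hab hab2 ho c hc i (j + 1) δ hδ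
    exact hasDerivAt_tsum_of_isPreconnected hβ isOpen_Ioo isPreconnected_Ioo
      (g := fun n t => c n * sineD a b i n p.1 * normalD κ (b - a) (b2 - a2) σ e j n t)
      (g' := fun n t => c n * sineD a b i n p.1 * normalD κ (b - a) (b2 - a2) σ e (j + 1) n t)
      (fun n t _ => (normalD_hasDerivAt κ _ _ σ e j n t).const_mul _)
      (fun n t ht => hb n p.1 t ⟨ht.1.le, ht.2.le⟩) hm
      (edgeTerm_summable κ a b a2 b2 σ e hκ hab hab2 ho c hc i j p.1 p.2 hp.2) hm

theorem edgeSer_helmholtz (κ a b a2 b2 σ e : ℝ) (hκ : 0 < κ) (hab : a < b) (hab2 : a2 < b2)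
    (ho : Oriented a2 b2 σ e) (c : ℕ → ℂ) (hc : Summable fun n => ‖c n‖)
    (p : ℝ × ℝ) (hp : p ∈ Ioo a b ×ˢ Ioo a2 b2) :
    edgeSer κ a b (b2 - a2) σ e c 2 0 p + edgeSer κ a b (b2 - a2) σ e c 0 2 p
      + (κ : ℂ) ^ 2 * edgeSer κ a b (b2 - a2) σ e c 0 0 p = 0 := by
  have hs := fun i j => edgeTerm_summable κ a b a2 b2 σ e hκ hab hab2 ho c hc i j p.1 p.2 hp.2
  unfold edgeSer
  rw [← tsum_mul_left, ← (hs 2 0).tsum_add (hs 0 2), ← ((hs 2 0).add (hs 0 2)).tsum_add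
    ((hs 0 0).mul_left _)]
  convert tsum_zero with n
  have hσ : (σ : ℂ) ^ 2 = 1 := by
    rcases ho with ⟨rfl, rfl⟩ | ⟨rfl, rfl⟩ <;> norm_num
  have e1 : sineD a b 2 n p.1 = -(((n * π / (b - a)) ^ 2 : ℝ) : ℂ) * sineD a b 0 n p.1 := by
    unfold sineD trigOn
    rw [show (2 : ℕ) = 0 + 2 by rfl, trig_add_two]
    push_cast; ring
  have e2 : normalD κ (b - a) (b2 - a2) σ e 2 n p.2 = (((n * π / (b - a)) ^ 2 - κ ^ 2 : ℝ) : ℂ) *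
      normalD κ (b - a) (b2 - a2) σ e 0 n p.2 := by
    unfold normalD
    rw [hσ, show (2 : ℕ) = 0 + 2 by rfl, modeD_two κ (b - a) (b2 - a2) hκ (by linarith)]
    simp
  rw [e1, e2]
  push_cast
  ring

theorem edgeSer_continuousOn (κ a b a2 b2 σ e : ℝ) (hκ : 0 < κ) (hab : a < b) (hab2 : a2 < b2)
    (ho : Oriented a2 b2 σ e) (c : ℕ → ℂ) (hc : Summable fun n => ‖c n‖) :
    ContinuousOn (edgeSer κ a b (b2 - a2) σ e c 0 0) (univ ×ˢ Icc a2 b2) := by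
  obtain ⟨K, hK⟩ := modeD_uniformly_bounded κ (b - a) (b2 - a2) hκ (by linarith) (by linarith)
  refine continuousOn_tsum (fun n => ?_) (hc.mul_right K) fun n p hp => ?_
  · have h1 := sineD_continuous a b 0 n
    have h2 := normalD_continuous κ (b - a) (b2 - a2) σ e 0 n
    fun_prop
  · have hm : σ * (p.2 - e) ∈ Icc 0 (b2 - a2) := by
      simpa using ho.mem (δ := 0) (by simpa using hp.2)
    have h1 := norm_sineD_le a b hab 0 n p.1
    rw [norm_mul, norm_mul, normalD, norm_mul, ho.norm_pow, one_mul]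
    rw [pow_zero] at h1
    exact mul_le_mul (mul_le_of_le_one_right (norm_nonneg _) h1) (hK n _ hm) (norm_nonneg _)
      (norm_nonneg _)

theorem edgeSer_left (κ a b L2 σ e : ℝ) (c : ℕ → ℂ) (y : ℝ) :
    edgeSer κ a b L2 σ e c 0 0 (a, y) = 0 := by
  simp [edgeSer, sineD, trigOn, trig_even_zero]

theorem edgeSer_right (κ a b L2 σ e : ℝ) (hab : a < b) (c : ℕ → ℂ) (y : ℝ) :
    edgeSer κ a b L2 σ e c 0 0 (b, y) = 0 := by
  simp [edgeSer, sineD, trigOn, trig_even_right _ (sub_pos.2 hab).ne' 0]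

theorem edgeSer_base (κ a b L2 σ e : ℝ) (c : ℕ → ℂ) (x : ℝ) :
    edgeSer κ a b L2 σ e c 0 0 (x, e) = 0 := by
  simp [edgeSer, normalD, modeD_zero]

theorem edgeSer_active (κ a b L2 σ e : ℝ) (hκ : 0 < κ) (hab : a < b) (hL2 : 0 < L2)
    (h : A0cond κ (b - a) L2) (hσ : σ ^ 2 = 1) (c : ℕ → ℂ) (x : ℝ) :
    edgeSer κ a b L2 σ e c 0 0 (x, e + σ * L2) = ∑' n, c n * (trigOn a b 0 n x : ℂ) := by
  unfold edgeSer normalD sineD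
  congr 1; ext n
  simp only [add_sub_cancel_left]
  rw [← mul_assoc σ, ← sq, hσ, one_mul, modeD_right κ _ _ hκ (by linarith) hL2 h]
  simp

theorem IsCompact.subset_margin {K : Set ℝ} (hK : IsCompact K) {a b : ℝ} (h : K ⊆ Ioo a b) :
    ∃ δ > 0, K ⊆ Icc (a + δ) (b - δ) := by
  rcases K.eq_empty_or_nonempty with rfl | hne
  · exact ⟨1, one_pos, empty_subset _⟩
  · obtain ⟨m, hm, hm'⟩ := hK.exists_isLeast hne
    obtain ⟨M, hM, hM'⟩ := hK.exists_isGreatest hne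
    refine ⟨min (m - a) (b - M), lt_min (sub_pos.2 (h hm).1) (sub_pos.2 (h hM).2), fun x hx => ?_⟩
    have h1 := min_le_left (m - a) (b - M)
    have h2 := min_le_right (m - a) (b - M)
    have := hm' hx
    have := hM' hx
    constructor <;> linarith

theorem setIntegral_mul_deriv_eq (a b : ℝ) (f f' g g' : ℝ → ℂ)
    (hf : ∀ x ∈ Ioo a b, HasDerivAt f (f' x) x) (hf' : ContinuousOn f' (Ioo a b))
    (hg : ∀ x, HasDerivAt g (g' x) x) (hg' : Continuous g')
    (δ : ℝ) (hδ : 0 < δ) (hs : ∀ x, x ∉ Icc (a + δ) (b - δ) → g x = 0) :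
    ∫ x in Ioo a b, f x * g' x = - ∫ x in Ioo a b, f' x * g x := by
  have hs' : ∀ x, x ∉ Icc (a + δ) (b - δ) → g' x = 0 := by
    intro x hx
    have : g =ᶠ[nhds x] fun _ => 0 := by
      filter_upwards [isClosed_Icc.isOpen_compl.mem_nhds hx] with y hy using hs y hy
    exact (hg x).unique ((hasDerivAt_const x (0 : ℂ)).congr_of_eventuallyEq this)
  by_cases hab : a + δ / 2 ≤ b - δ / 2
  · have hsub : Icc (a + δ / 2) (b - δ / 2) ⊆ Ioo a b := fun x hx =>
      ⟨by linarith [hx.1], by linarith [hx.2]⟩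
    have key := intervalIntegral.integral_mul_deriv_eq_deriv_mul (a := a + δ / 2) (b := b - δ / 2)
      (u := f) (v := g) (u' := f') (v' := g')
      (fun x hx => hf x (hsub (by rwa [uIcc_of_le hab] at hx))) (fun x _ => hg x)
      (ContinuousOn.intervalIntegrable (by rw [uIcc_of_le hab]; exact hf'.mono hsub))
      (hg'.intervalIntegrable _ _)
    rw [hs _ (fun h => by linarith [h.2]), hs _ (fun h => by linarith [h.1])] at key
    have conv : ∀ F : ℝ → ℂ, (∀ x, x ∉ Icc (a + δ) (b - δ) → F x = 0) →
        ∫ x in Ioo a b, F x = ∫ x in (a + δ / 2)..(b - δ / 2), F x := by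
      intro F hF
      rw [intervalIntegral.integral_of_le hab]
      refine (setIntegral_eq_of_subset_of_forall_sdiff_eq_zero measurableSet_Ioo ?_ ?_)
      · exact Ioc_subset_Icc_self.trans hsub
      · exact fun x hx => hF x fun h => hx.2 ⟨by linarith [h.1], by linarith [h.2]⟩
    rw [conv _ (fun x hx => by rw [hs' x hx, mul_zero]),
      conv _ (fun x hx => by rw [hs x hx, mul_zero]), key]
    simp
  · have : ∀ x, x ∉ Icc (a + δ) (b - δ) := fun x h => hab (by linarith [h.1, h.2])
    simp [fun x => hs x (this x), fun x => hs' x (this x)]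

theorem pd1_eq_fderiv {φ : ℝ × ℝ → ℂ} (hφ : ContDiff ℝ (⊤ : ℕ∞) φ) (p : ℝ × ℝ) :
    HasDerivAt (fun t => φ (t, p.2)) (fderiv ℝ φ p (1, 0)) p.1 := by
  have h1 : HasDerivAt (fun t : ℝ => (t, p.2)) ((1 : ℝ), (0 : ℝ)) p.1 :=
    (hasDerivAt_id _).prodMk (hasDerivAt_const _ _)
  exact ((hφ.differentiable (by simp)) p).hasFDerivAt.comp_hasDerivAt p.1 h1

theorem pd2_eq_fderiv {φ : ℝ × ℝ → ℂ} (hφ : ContDiff ℝ (⊤ : ℕ∞) φ) (p : ℝ × ℝ) :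
    HasDerivAt (fun t => φ (p.1, t)) (fderiv ℝ φ p (0, 1)) p.2 := by
  have h1 : HasDerivAt (fun t : ℝ => (p.1, t)) ((0 : ℝ), (1 : ℝ)) p.2 :=
    (hasDerivAt_const _ _).prodMk (hasDerivAt_id _)
  exact ((hφ.differentiable (by simp)) p).hasFDerivAt.comp_hasDerivAt p.2 h1

theorem contDiff_pd1 {φ : ℝ × ℝ → ℂ} (hφ : ContDiff ℝ (⊤ : ℕ∞) φ) :
    ContDiff ℝ (⊤ : ℕ∞) (pd1 φ) := by
  have : pd1 φ = fun p => fderiv ℝ φ p (1, 0) := funext fun p => (pd1_eq_fderiv hφ p).deriv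
  rw [this]
  exact (hφ.fderiv_right (by simp)).clm_apply contDiff_const

theorem contDiff_pd2 {φ : ℝ × ℝ → ℂ} (hφ : ContDiff ℝ (⊤ : ℕ∞) φ) :
    ContDiff ℝ (⊤ : ℕ∞) (pd2 φ) := by
  have : pd2 φ = fun p => fderiv ℝ φ p (0, 1) := funext fun p => (pd2_eq_fderiv hφ p).deriv
  rw [this]
  exact (hφ.fderiv_right (by simp)).clm_apply contDiff_const

theorem pd1_eq_zero {φ : ℝ × ℝ → ℂ} {K : Set (ℝ × ℝ)} (hK : IsClosed K)
    (h : ∀ p ∉ K, φ p = 0) : ∀ p ∉ K, pd1 φ p = 0 := by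
  intro p hp
  have := pd1_eqOn hK.isOpen_compl (f := φ) (g := fun _ => 0) (fun p hp => h p hp) hp
  rw [this]; simp [pd1]

theorem pd2_eq_zero {φ : ℝ × ℝ → ℂ} {K : Set (ℝ × ℝ)} (hK : IsClosed K)
    (h : ∀ p ∉ K, φ p = 0) : ∀ p ∉ K, pd2 φ p = 0 := by
  intro p hp
  have := pd2_eqOn hK.isOpen_compl (f := φ) (g := fun _ => 0) (fun p hp => h p hp) hp
  rw [this]; simp [pd2]

theorem integrableOn_mul_of_support {U K : Set (ℝ × ℝ)} (hU : MeasurableSet U) (hK : IsCompact K)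
    (hKU : K ⊆ U) {f g : ℝ × ℝ → ℂ} (hf : ContinuousOn f U) (hg : Continuous g)
    (h : ∀ p ∉ K, g p = 0) : IntegrableOn (fun p => f p * g p) U := by
  have h1 : IntegrableOn (fun p => f p * g p) K :=
    ((hf.mono hKU).mul hg.continuousOn).integrableOn_compact hK
  exact h1.of_forall_sdiff_eq_zero hU fun p hp => by rw [h p hp.2, mul_zero]

theorem IsJet.integral_mul_pd2 {a1 b1 a2 b2 : ℝ} {D : ℕ → ℕ → ℝ × ℝ → ℂ}
    (hD : IsJet (Ioo a1 b1 ×ˢ Ioo a2 b2) D) {φ : ℝ × ℝ → ℂ} (hφ : ContDiff ℝ (⊤ : ℕ∞) φ)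
    {K : Set (ℝ × ℝ)} (hK : IsCompact K) (hKU : K ⊆ Ioo a1 b1 ×ˢ Ioo a2 b2)
    (h : ∀ p ∉ K, φ p = 0) (i j : ℕ) :
    ∫ p in Ioo a1 b1 ×ˢ Ioo a2 b2, D i j p * pd2 φ p =
      - ∫ p in Ioo a1 b1 ×ˢ Ioo a2 b2, D i (j + 1) p * φ p := by
  have hU : MeasurableSet (Ioo a1 b1 ×ˢ Ioo a2 b2) := measurableSet_Ioo.prod measurableSet_Ioo
  have i1 := integrableOn_mul_of_support hU hK hKU (hD.cont i j) (contDiff_pd2 hφ).continuous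
    (pd2_eq_zero hK.isClosed h)
  have i2 := integrableOn_mul_of_support hU hK hKU (hD.cont i (j + 1)) hφ.continuous h
  rw [Measure.volume_eq_prod] at i1 i2 ⊢
  rw [setIntegral_prod _ i1, setIntegral_prod _ i2, ← integral_neg]
  obtain ⟨δ, hδ, hm⟩ := (hK.image continuous_snd).subset_margin (a := a2) (b := b2)
    (by rintro _ ⟨p, hp, rfl⟩; exact (hKU hp).2)
  refine setIntegral_congr_fun measurableSet_Ioo fun x hx => ?_
  refine setIntegral_mul_deriv_eq a2 b2 (fun y => D i j (x, y)) (fun y => D i (j + 1) (x, y))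
    (fun y => φ (x, y)) (fun y => pd2 φ (x, y)) (fun y hy => hD.d2 i j (x, y) ⟨hx, hy⟩) ?_
    (fun y => ?_) ?_ δ hδ fun y hy => h _ fun hp => hy (hm ⟨_, hp, rfl⟩)
  · exact (hD.cont i (j + 1)).comp (by fun_prop) fun y hy => ⟨hx, hy⟩
  · have := pd2_eq_fderiv hφ (x, y)
    exact this.differentiableAt.hasDerivAt
  · exact (contDiff_pd2 hφ).continuous.comp (by fun_prop)

theorem setIntegral_swap {E : Type*} [NormedAddCommGroup E] [NormedSpace ℝ E] (s t : Set ℝ)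
    (f : ℝ × ℝ → E) :
    ∫ p in s ×ˢ t, f p.swap = ∫ p in t ×ˢ s, f p := by
  have h : MeasurePreserving (Prod.swap : ℝ × ℝ → ℝ × ℝ) volume volume :=
    Measure.measurePreserving_swap
  have := h.setIntegral_preimage_emb
      (MeasurableEquiv.prodComm (α := ℝ) (β := ℝ)).measurableEmbedding
    f (t ×ˢ s)
  rwa [preimage_swap_prod] at this

theorem pd1_swap (φ : ℝ × ℝ → ℂ) (p : ℝ × ℝ) : pd2 (fun q => φ q.swap) p = pd1 φ p.swap := rfl

theorem IsJet.integral_mul_pd1 {a1 b1 a2 b2 : ℝ} {D : ℕ → ℕ → ℝ × ℝ → ℂ}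
    (hD : IsJet (Ioo a1 b1 ×ˢ Ioo a2 b2) D) {φ : ℝ × ℝ → ℂ} (hφ : ContDiff ℝ (⊤ : ℕ∞) φ)
    {K : Set (ℝ × ℝ)} (hK : IsCompact K) (hKU : K ⊆ Ioo a1 b1 ×ˢ Ioo a2 b2)
    (h : ∀ p ∉ K, φ p = 0) (i j : ℕ) :
    ∫ p in Ioo a1 b1 ×ˢ Ioo a2 b2, D i j p * pd1 φ p =
      - ∫ p in Ioo a1 b1 ×ˢ Ioo a2 b2, D (i + 1) j p * φ p := by
  have hD' := hD.swap
  rw [preimage_swap_prod] at hD'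
  have := hD'.integral_mul_pd2 (φ := fun q => φ q.swap) (hφ.comp (contDiff_snd.prodMk contDiff_fst))
    (hK.image continuous_swap) (by rintro _ ⟨p, hp, rfl⟩; exact ⟨(hKU hp).2, (hKU hp).1⟩)
    (fun p hp => h _ fun hq => hp ⟨_, hq, by simp⟩) j i
  simp only [pd1_swap] at this
  rwa [setIntegral_swap _ _ (fun p => D i j p * pd1 φ p),
    setIntegral_swap _ _ (fun p => D (i + 1) j p * φ p)] at this

theorem IsJet.weakHelmholtz {a1 b1 a2 b2 κ : ℝ} {D : ℕ → ℕ → ℝ × ℝ → ℂ}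
    (hD : IsJet (Ioo a1 b1 ×ˢ Ioo a2 b2) D)
    (hH : ∀ p ∈ Ioo a1 b1 ×ˢ Ioo a2 b2, D 2 0 p + D 0 2 p + (κ : ℂ) ^ 2 * D 0 0 p = 0)
    {φ : ℝ × ℝ → ℂ} (hφ : ContDiff ℝ (⊤ : ℕ∞) φ)
    {K : Set (ℝ × ℝ)} (hK : IsCompact K) (hKU : K ⊆ Ioo a1 b1 ×ˢ Ioo a2 b2)
    (h : ∀ p ∉ K, φ p = 0) :
    ∫ p in Ioo a1 b1 ×ˢ Ioo a2 b2,
      D 0 0 p * (pdM 2 0 φ p + pdM 0 2 φ p + (κ : ℂ) ^ 2 * φ p) = 0 := by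
  have hU : MeasurableSet (Ioo a1 b1 ×ˢ Ioo a2 b2) := measurableSet_Ioo.prod measurableSet_Ioo
  have int := fun i j (g : ℝ × ℝ → ℂ) (hg : Continuous g) (h : ∀ p ∉ K, g p = 0) =>
    integrableOn_mul_of_support hU hK hKU (hD.cont i j) hg h
  have h1 := pd1_eq_zero hK.isClosed h
  have h2 := pd2_eq_zero hK.isClosed h
  have h11 := pd1_eq_zero hK.isClosed h1
  have h22 := pd2_eq_zero hK.isClosed h2
  have e1 : ∫ p in Ioo a1 b1 ×ˢ Ioo a2 b2, D 0 0 p * pd1 (pd1 φ) p =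
      ∫ p in Ioo a1 b1 ×ˢ Ioo a2 b2, D 2 0 p * φ p := by
    rw [hD.integral_mul_pd1 (contDiff_pd1 hφ) hK hKU h1, hD.integral_mul_pd1 hφ hK hKU h, neg_neg]
  have e2 : ∫ p in Ioo a1 b1 ×ˢ Ioo a2 b2, D 0 0 p * pd2 (pd2 φ) p =
      ∫ p in Ioo a1 b1 ×ˢ Ioo a2 b2, D 0 2 p * φ p := by
    rw [hD.integral_mul_pd2 (contDiff_pd2 hφ) hK hKU h2, hD.integral_mul_pd2 hφ hK hKU h, neg_neg]
  have i11 := int 0 0 _ (contDiff_pd1 (contDiff_pd1 hφ)).continuous h11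
  have i22 := int 0 0 _ (contDiff_pd2 (contDiff_pd2 hφ)).continuous h22
  have i0 := (int 0 0 _ hφ.continuous h).const_mul ((κ : ℂ) ^ 2)
  have j1 := int 2 0 _ hφ.continuous h
  have j2 := int 0 2 _ hφ.continuous h
  have i12 : IntegrableOn (fun p => D 0 0 p * pd1 (pd1 φ) p + D 0 0 p * pd2 (pd2 φ) p)
    (Ioo a1 b1 ×ˢ Ioo a2 b2) := i11.add i22
  have j12 : IntegrableOn (fun p => D 2 0 p * φ p + D 0 2 p * φ p)
    (Ioo a1 b1 ×ˢ Ioo a2 b2) := j1.add j2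
  calc _ = ∫ p in Ioo a1 b1 ×ˢ Ioo a2 b2, (D 0 0 p * pd1 (pd1 φ) p + D 0 0 p * pd2 (pd2 φ) p
        + (κ : ℂ) ^ 2 * (D 0 0 p * φ p)) := by
        congr 1; ext p
        simp only [pdM, Function.iterate_succ, Function.iterate_zero, Function.comp, id]
        ring
    _ = ∫ p in Ioo a1 b1 ×ˢ Ioo a2 b2, (D 2 0 p * φ p + D 0 2 p * φ p
        + (κ : ℂ) ^ 2 * (D 0 0 p * φ p)) := by
        rw [integral_add i12 i0, integral_add i11 i22, e1, e2,
          integral_add j12 i0, integral_add j1 j2]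
    _ = ∫ p in Ioo a1 b1 ×ˢ Ioo a2 b2, (0 : ℂ) := by
        refine setIntegral_congr_fun hU fun p hp => ?_
        linear_combination (φ p) * hH p hp
    _ = 0 := by simp

/-- A smooth step from `0` on `(-∞, 1]` to `1` on `[2, ∞)`. -/
def step (t : ℝ) : ℝ := Real.smoothTransition (t - 1)

theorem step_contDiff : ContDiff ℝ (⊤ : ℕ∞) step :=
  Real.smoothTransition.contDiff.comp (by fun_prop)

theorem step_zero {t : ℝ} (h : t ≤ 1) : step t = 0 :=
  Real.smoothTransition.zero_of_nonpos (by linarith)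

theorem step_one {t : ℝ} (h : 2 ≤ t) : step t = 1 :=
  Real.smoothTransition.one_of_one_le (by linarith)

theorem step_mem (t : ℝ) : step t ∈ Icc (0 : ℝ) 1 :=
  ⟨Real.smoothTransition.nonneg _, Real.smoothTransition.le_one _⟩

theorem step_deriv_zero {t : ℝ} (h : t ∉ Icc (1 : ℝ) 2) : deriv step t = 0 := by
  rcases not_and_or.1 h with h | h <;> rw [not_le] at h
  · have : step =ᶠ[nhds t] fun _ => 0 := by
      filter_upwards [gt_mem_nhds h] with s hs using step_zero hs.le
    rw [this.deriv_eq]; simp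
  · have : step =ᶠ[nhds t] fun _ => 1 := by
      filter_upwards [lt_mem_nhds h] with s hs using step_one hs.le
    rw [this.deriv_eq]; simp

theorem step_deriv2_zero {t : ℝ} (h : t ∉ Icc (1 : ℝ) 2) : deriv (deriv step) t = 0 := by
  have : deriv step =ᶠ[nhds t] fun _ => 0 := by
    filter_upwards [isClosed_Icc.isOpen_compl.mem_nhds h] with s hs using step_deriv_zero hs
  rw [this.deriv_eq]; simp

theorem step_deriv_contDiff : ContDiff ℝ (⊤ : ℕ∞) (deriv step) :=
  ((contDiff_infty_iff_deriv (𝕜 := ℝ)).1 step_contDiff).2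

theorem step_hasDerivAt (t : ℝ) : HasDerivAt step (deriv step t) t :=
  (step_contDiff.differentiable (by simp) t).hasDerivAt

theorem step_hasDerivAt2 (t : ℝ) : HasDerivAt (deriv step) (deriv (deriv step) t) t :=
  (step_deriv_contDiff.differentiable (by simp) t).hasDerivAt

theorem step_deriv_bounded : ∃ C, 0 ≤ C ∧ ∀ t, |deriv step t| ≤ C ∧ |deriv (deriv step) t| ≤ C := by
  obtain ⟨C1, h1⟩ := isCompact_Icc.exists_bound_of_continuousOn (s := Icc (1 : ℝ) 2)
    step_deriv_contDiff.continuous.continuousOn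
  obtain ⟨C2, h2⟩ := isCompact_Icc.exists_bound_of_continuousOn (s := Icc (1 : ℝ) 2)
    ((contDiff_infty_iff_deriv (𝕜 := ℝ)).1 step_deriv_contDiff).2.continuous.continuousOn
  refine ⟨max 0 (max C1 C2), le_max_left _ _, fun t => ?_⟩
  by_cases ht : t ∈ Icc (1 : ℝ) 2
  · exact ⟨(h1 t ht).trans (by simp), (h2 t ht).trans (by simp)⟩
  · rw [step_deriv_zero ht, step_deriv2_zero ht]; simp

/-- A smooth cutoff on `(a, b)` with transition layers of width `1 / k`. -/
def cut (a b : ℝ) (k : ℕ) (x : ℝ) : ℝ := step (k * (x - a)) + step (k * (b - x)) - 1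

theorem cut_contDiff (a b : ℝ) (k : ℕ) : ContDiff ℝ (⊤ : ℕ∞) (cut a b k) :=
  ((step_contDiff.comp (by fun_prop : ContDiff ℝ (⊤ : ℕ∞) fun x : ℝ => k * (x - a))).add
    (step_contDiff.comp (by fun_prop : ContDiff ℝ (⊤ : ℕ∞) fun x : ℝ => k * (b - x)))).sub
    contDiff_const

theorem cut_abs_le (a b : ℝ) (k : ℕ) (x : ℝ) : |cut a b k x| ≤ 1 := by
  have h1 := step_mem (k * (x - a))
  have h2 := step_mem (k * (b - x))
  unfold cut
  rw [abs_le]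
  constructor <;> linarith [h1.1, h1.2, h2.1, h2.2]

theorem cut_zero (a b : ℝ) (k : ℕ) (hk : 4 ≤ k * (b - a)) (x : ℝ)
    (hx : x ∉ Icc (a + 1 / k) (b - 1 / k)) : cut a b k x = 0 := by
  have hk0 : (0 : ℝ) < k := by
    rcases Nat.eq_zero_or_pos k with rfl | h
    · norm_num at hk
    · exact_mod_cast h
  unfold cut
  rcases not_and_or.1 hx with h | h <;> rw [not_le] at h
  · have h1 : k * (x - a) ≤ 1 := by
      rw [← sub_lt_iff_lt_add', lt_div_iff₀ hk0] at h; linarith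
    rw [step_zero h1, step_one (by linarith)]; ring
  · have h1 : k * (b - x) ≤ 1 := by
      have : b - x < 1 / k := by linarith
      rw [lt_div_iff₀ hk0] at this; linarith
    rw [step_zero h1, step_one (by linarith)]; ring

theorem cut_one (a b : ℝ) (k : ℕ) (x : ℝ) (h1 : 2 ≤ k * (x - a)) (h2 : 2 ≤ k * (b - x)) :
    cut a b k x = 1 := by
  unfold cut
  rw [step_one h1, step_one h2]; ring

/-- The commutator remainder in the second derivative of a truncated sine mode. -/
def cutRem (a b : ℝ) (k n : ℕ) (x : ℝ) : ℝ :=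
  trigOn a b 0 n x * (k ^ 2 * (deriv (deriv step) (k * (x - a)) + deriv (deriv step) (k * (b - x))))
    + 2 * (n * π / (b - a) * trigOn a b 1 n x) *
      (k * (deriv step (k * (x - a)) - deriv step (k * (b - x))))

theorem cut_mul_hasDerivAt2 (a b : ℝ) (k n : ℕ) :
    ∃ f' : ℝ → ℝ, (∀ x, HasDerivAt (fun x => cut a b k x * trigOn a b 0 n x) (f' x) x) ∧
      ∀ x, HasDerivAt f' (-(n * π / (b - a)) ^ 2 * (cut a b k x * trigOn a b 0 n x)
        + cutRem a b k n x) x := by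
  have ha : ∀ x : ℝ, HasDerivAt (fun x : ℝ => k * (x - a)) (k : ℝ) x := fun x => by
    simpa using ((hasDerivAt_id' x).sub_const a).const_mul (k : ℝ)
  have hb : ∀ x : ℝ, HasDerivAt (fun x : ℝ => k * (b - x)) (-k : ℝ) x := fun x => by
    simpa using ((hasDerivAt_id' x).const_sub b).const_mul (k : ℝ)
  have h1 : ∀ x, HasDerivAt (cut a b k)
      (deriv step (k * (x - a)) * k + deriv step (k * (b - x)) * (-k)) x := fun x =>
    (((step_hasDerivAt _).comp x (ha x)).add ((step_hasDerivAt _).comp x (hb x))).sub_const 1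
  refine ⟨_, fun x => (h1 x).mul (trigOn_hasDerivAt a b 0 n x), fun x => ?_⟩
  have h2 : HasDerivAt (fun x => deriv step (k * (x - a)) * k + deriv step (k * (b - x)) * (-k))
      _ x := ((((step_hasDerivAt2 _).comp x (ha x))).mul_const (k : ℝ)).add
      (((step_hasDerivAt2 _).comp x (hb x)).mul_const (-k : ℝ))
  refine ((h2.mul (trigOn_hasDerivAt a b 0 n x)).add
    ((h1 x).mul ((trigOn_hasDerivAt a b 1 n x).const_mul (n * π / (b - a))))).congr_deriv ?_
  have : trigOn a b (1 + 1) n x = - trigOn a b 0 n x := by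
    unfold trigOn
    exact trig_add_two _ 0 _ _
  rw [this]
  unfold cutRem
  simp only [zero_add]
  ring

theorem abs_trigOn_zero_le (a b : ℝ) (hab : a < b) (n : ℕ) (x : ℝ) :
    |trigOn a b 0 n x| ≤ n * π / (b - a) * |x - a| ∧
      |trigOn a b 0 n x| ≤ n * π / (b - a) * |b - x| := by
  have hba : 0 < b - a := sub_pos.2 hab
  have hl : 0 ≤ n * π / (b - a) := by positivity
  have h0 : trigOn a b 0 n a = 0 := by simp [trigOn, trig_even_zero]
  have h1 : trigOn a b 0 n b = 0 := by simp [trigOn, trig_even_right _ hba.ne' 0]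
  have key : ∀ y, |trigOn a b 0 n x - trigOn a b 0 n y| ≤ n * π / (b - a) * |x - y| := by
    intro y
    refine Convex.norm_image_sub_le_of_norm_hasDerivWithin_le (s := univ)
      (fun z _ => (trigOn_hasDerivAt a b 0 n z).hasDerivWithinAt) (fun z _ => ?_) convex_univ
      (mem_univ y) (mem_univ x)
    rw [norm_mul, Real.norm_of_nonneg hl]
    exact mul_le_of_le_one_right hl (abs_trig_le _ _ _ _)
  constructor
  · simpa [h0] using key a
  · rw [abs_sub_comm b x]; simpa [h1] using key b

theorem cutRem_zero (a b : ℝ) (k n : ℕ) (x : ℝ) (h1 : k * (x - a) ∉ Icc (1 : ℝ) 2)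
    (h2 : k * (b - x) ∉ Icc (1 : ℝ) 2) : cutRem a b k n x = 0 := by
  unfold cutRem
  rw [step_deriv_zero h1, step_deriv_zero h2, step_deriv2_zero h1, step_deriv2_zero h2]
  ring

theorem cutRem_bound (a b : ℝ) (hab : a < b) (n : ℕ) :
    ∃ C, 0 ≤ C ∧ ∀ (k : ℕ) (x : ℝ), |cutRem a b k n x| ≤ C * k := by
  obtain ⟨C, hC, h⟩ := step_deriv_bounded
  have hba : 0 < b - a := sub_pos.2 hab
  set l := n * π / (b - a) with hl
  have hl0 : 0 ≤ l := by positivity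
  refine ⟨8 * l * C, by positivity, fun k x => ?_⟩
  have hk : (0 : ℝ) ≤ k := Nat.cast_nonneg k
  have ht := abs_trigOn_zero_le a b hab n x
  have key : ∀ d, |trigOn a b 0 n x| ≤ l * |d| →
      |trigOn a b 0 n x * (k ^ 2 * deriv (deriv step) (k * d))| ≤ 2 * l * C * k := by
    intro d hd
    by_cases hm : k * d ∈ Icc (1 : ℝ) 2
    · rw [abs_mul, abs_mul, abs_of_nonneg (by positivity : (0:ℝ) ≤ k ^ 2)]
      have h3 : |(k : ℝ)| * |d| ≤ 2 := by
          rw [← abs_mul, abs_of_nonneg (by linarith [hm.1])]; exact hm.2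
      rw [abs_of_nonneg hk] at h3
      calc _ ≤ l * |d| * (k ^ 2 * C) := by gcongr; exact (h _).2
        _ = l * C * k * (k * |d|) := by ring
        _ ≤ l * C * k * 2 := by gcongr
        _ = _ := by ring
    · rw [step_deriv2_zero hm]; simp; positivity
  have k1 := key _ ht.1
  have k2 := key _ ht.2
  have k3 : |2 * (l * trigOn a b 1 n x) *
      (k * (deriv step (k * (x - a)) - deriv step (k * (b - x))))|
      ≤ 4 * l * C * k := by
    rw [abs_mul, abs_mul, abs_mul, abs_mul, abs_of_nonneg hl0, abs_of_nonneg hk, abs_two]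
    have h5 : |deriv step (k * (x - a)) - deriv step (k * (b - x))| ≤ 2 * C := by
      refine (abs_sub _ _).trans ?_
      linarith [(h (k * (x - a))).1, (h (k * (b - x))).1]
    have h6 : |trigOn a b 1 n x| ≤ 1 := abs_trig_le _ _ _ _
    calc _ ≤ 2 * (l * 1) * (k * (2 * C)) := by gcongr
      _ = _ := by ring
  unfold cutRem
  rw [← hl, mul_add, mul_add]
  refine (abs_add_le _ _).trans ?_
  have := abs_add_le (trigOn a b 0 n x * (k ^ 2 * deriv (deriv step) (k * (x - a))))
    (trigOn a b 0 n x * (k ^ 2 * deriv (deriv step) (k * (b - x))))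
  linarith

theorem cutRem_continuous (a b : ℝ) (k n : ℕ) : Continuous (cutRem a b k n) := by
  have h1 := step_deriv_contDiff.continuous
  have h2 := ((contDiff_infty_iff_deriv (𝕜 := ℝ)).1 step_deriv_contDiff).2.continuous
  have h3 := trigOn_continuous a b 0 n
  have h4 := trigOn_continuous a b 1 n
  unfold cutRem
  fun_prop

theorem tendsto_integral_cutRem (a1 b1 a2 b2 : ℝ) (h1 : a1 < b1) (h2 : a2 < b2) (w : ℝ × ℝ → ℂ)
    (hw : Continuous w) (hl : ∀ y ∈ Icc a2 b2, w (a1, y) = 0) (hr : ∀ y ∈ Icc a2 b2, w (b1, y) = 0)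
    (n : ℕ) (G : ℕ → ℝ → ℝ) (hG : ∀ k y, |G k y| ≤ 1) :
    Filter.Tendsto (fun k : ℕ => ∫ p in Ioo a1 b1 ×ˢ Ioo a2 b2,
      w p * ((cutRem a1 b1 k n p.1 * G k p.2 : ℝ) : ℂ)) Filter.atTop (nhds 0) := by
  obtain ⟨C, hC, hb⟩ := cutRem_bound a1 b1 h1 n
  have huc := (isCompact_Icc.prod isCompact_Icc).uniformContinuousOn_of_continuous
    (s := Icc a1 b1 ×ˢ Icc a2 b2) hw.continuousOn
  rw [Metric.uniformContinuousOn_iff] at huc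
  rw [Metric.tendsto_atTop]
  intro ε hε
  have hY : 0 < b2 - a2 := sub_pos.2 h2
  obtain ⟨η, hη, hηε⟩ : ∃ η > 0, η * (C * (2 * (b2 - a2))) < ε := by
    refine ⟨ε / (C * (2 * (b2 - a2)) + 1), by positivity, ?_⟩
    rw [div_mul_eq_mul_div, div_lt_iff₀ (by positivity)]
    nlinarith
  obtain ⟨δ, hδ, hd⟩ := huc η hη
  obtain ⟨k0, hk0⟩ := exists_nat_gt (max 1 (2 / δ))
  refine ⟨k0, fun k hk => ?_⟩
  have hk' : (k0 : ℝ) ≤ k := by exact_mod_cast hk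
  have hk1 : (1 : ℝ) < k := (le_max_left _ _).trans_lt (hk0.trans_le hk')
  have hk2 : 2 / δ < k := (le_max_right _ _).trans_lt (hk0.trans_le hk')
  have hkp : (0 : ℝ) < k := by linarith
  have hkd : 2 / k < δ := by rw [div_lt_iff₀ hδ] at hk2; rw [div_lt_iff₀ hkp]; linarith
  set U := Ioo a1 b1 ×ˢ Ioo a2 b2 with hU
  set A := (Icc (a1 + 1 / k) (a1 + 2 / k) ∪ Icc (b1 - 2 / k) (b1 - 1 / k)) ×ˢ Ioo a2 b2 with hA
  have hUm : MeasurableSet U := measurableSet_Ioo.prod measurableSet_Ioo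
  have hzero : ∀ p ∈ U, p ∉ A → cutRem a1 b1 k n p.1 = 0 := by
    intro p hp hpA
    refine cutRem_zero _ _ _ _ _ (fun h => hpA ⟨Or.inl ?_, hp.2⟩) (fun h => hpA ⟨Or.inr ?_, hp.2⟩)
    · have e1 : 1 / k ≤ p.1 - a1 := by rw [div_le_iff₀ hkp]; linarith [h.1]
      have e2 : p.1 - a1 ≤ 2 / k := by rw [le_div_iff₀ hkp]; linarith [h.2]
      constructor <;> linarith
    · have e1 : 1 / k ≤ b1 - p.1 := by rw [div_le_iff₀ hkp]; linarith [h.1]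
      have e2 : b1 - p.1 ≤ 2 / k := by rw [le_div_iff₀ hkp]; linarith [h.2]
      constructor <;> linarith
  have hkk : (0 : ℝ) < 1 / k := by positivity
  have hsmall : ∀ p ∈ U ∩ A, ‖w p‖ ≤ η := by
    rintro p ⟨hp, hpA⟩
    have hpm : p ∈ Icc a1 b1 ×ˢ Icc a2 b2 := ⟨Ioo_subset_Icc_self hp.1, Ioo_subset_Icc_self hp.2⟩
    rcases hpA.1 with h | h
    · have := hd p hpm (a1, p.2) ⟨left_mem_Icc.2 h1.le, hpm.2⟩ (by
        rw [Prod.dist_eq, max_lt_iff]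
        simp only [dist_self, Real.dist_eq]
        exact ⟨by rw [abs_lt]; constructor <;> linarith [h.1, h.2], hδ⟩)
      rw [hl _ hpm.2, dist_zero_right] at this
      exact this.le
    · have := hd p hpm (b1, p.2) ⟨right_mem_Icc.2 h1.le, hpm.2⟩ (by
        rw [Prod.dist_eq, max_lt_iff]
        simp only [dist_self, Real.dist_eq]
        exact ⟨by rw [abs_lt]; constructor <;> linarith [h.1, h.2], hδ⟩)
      rw [hr _ hpm.2, dist_zero_right] at this
      exact this.le
  have hAm : volume A ≤ ENNReal.ofReal (2 / k * (b2 - a2)) := by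
    rw [hA, Measure.volume_eq_prod, Measure.prod_prod, Real.volume_Ioo,
      ENNReal.ofReal_mul (by positivity)]
    gcongr
    refine (measure_union_le _ _).trans ?_
    rw [Real.volume_Icc, Real.volume_Icc,
      ← ENNReal.ofReal_add (by ring_nf; positivity) (by ring_nf; positivity)]
    refine ENNReal.ofReal_le_ofReal (le_of_eq ?_)
    ring
  have hInt : ∫ p in U, w p * ((cutRem a1 b1 k n p.1 * G k p.2 : ℝ) : ℂ) =
      ∫ p in U ∩ A, w p * ((cutRem a1 b1 k n p.1 * G k p.2 : ℝ) : ℂ) := by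
    refine setIntegral_eq_of_subset_of_forall_sdiff_eq_zero hUm inter_subset_left fun p hp => ?_
    rw [hzero p hp.1 fun h => hp.2 ⟨hp.1, h⟩]; simp
  have hvol : volume (U ∩ A) ≤ ENNReal.ofReal (2 / k * (b2 - a2)) :=
    (measure_mono inter_subset_right).trans hAm
  rw [dist_zero_right, hInt]
  have hbound : ∀ p ∈ U ∩ A, ‖w p * ((cutRem a1 b1 k n p.1 * G k p.2 : ℝ) : ℂ)‖ ≤ η * (C * k) := by
    intro p hp
    rw [norm_mul, Complex.norm_real, norm_mul, Real.norm_eq_abs, Real.norm_eq_abs]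
    refine mul_le_mul (hsmall p hp) ?_ (by positivity) hη.le
    exact (mul_le_of_le_one_right (abs_nonneg _) (hG _ _)).trans (hb _ _)
  refine (norm_setIntegral_le_of_norm_le_const (hvol.trans_lt ENNReal.ofReal_lt_top)
    hbound).trans_lt ?_
  have : volume.real (U ∩ A) ≤ 2 / k * (b2 - a2) :=
    ENNReal.toReal_le_of_le_ofReal (by positivity) hvol
  calc _ ≤ η * (C * k) * (2 / k * (b2 - a2)) := by gcongr
    _ = η * (C * (2 * (b2 - a2))) := by field_simp
    _ < ε := hηε

theorem cut_tendsto (a b : ℝ) (x : ℝ) (hx : x ∈ Ioo a b) :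
    ∀ᶠ k : ℕ in Filter.atTop, cut a b k x = 1 := by
  have h1 := sub_pos.2 hx.1
  have h2 := sub_pos.2 hx.2
  obtain ⟨k0, hk0⟩ := exists_nat_ge (max (2 / (x - a)) (2 / (b - x)))
  filter_upwards [Filter.eventually_ge_atTop k0] with k hk
  have hk' := hk0.trans (by exact_mod_cast hk : (k0 : ℝ) ≤ k)
  have e1 := (le_max_left _ _).trans hk'
  have e2 := (le_max_right _ _).trans hk'
  rw [div_le_iff₀ h1] at e1
  rw [div_le_iff₀ h2] at e2
  exact cut_one _ _ _ _ e1 e2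

theorem integral_mul_sine_eq_zero (κ a1 b1 a2 b2 : ℝ) (h1 : a1 < b1) (h2 : a2 < b2)
    (hA : A0cond κ (b1 - a1) (b2 - a2)) (w : ℝ × ℝ → ℂ)
    (hw : Continuous w) (hl : ∀ y ∈ Icc a2 b2, w (a1, y) = 0) (hr : ∀ y ∈ Icc a2 b2, w (b1, y) = 0)
    (hb : ∀ x ∈ Icc a1 b1, w (x, a2) = 0) (ht : ∀ x ∈ Icc a1 b1, w (x, b2) = 0)
    (hweak : ∀ φ : ℝ × ℝ → ℂ, ContDiff ℝ (⊤ : ℕ∞) φ → ∀ K, IsCompact K →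
      K ⊆ Ioo a1 b1 ×ˢ Ioo a2 b2 → (∀ p ∉ K, φ p = 0) →
      ∫ p in Ioo a1 b1 ×ˢ Ioo a2 b2, w p * (pdM 2 0 φ p + pdM 0 2 φ p + (κ : ℂ) ^ 2 * φ p) = 0)
    (n m : ℕ) :
    ∫ p in Ioo a1 b1 ×ˢ Ioo a2 b2, w p * ((trigOn a1 b1 0 n p.1 * trigOn a2 b2 0 m p.2 : ℝ) : ℂ)
      = 0 := by
  set U := Ioo a1 b1 ×ˢ Ioo a2 b2 with hU
  have hUm : MeasurableSet U := measurableSet_Ioo.prod measurableSet_Ioo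
  have hUI : U ⊆ Icc a1 b1 ×ˢ Icc a2 b2 := prod_mono Ioo_subset_Icc_self Ioo_subset_Icc_self
  have hInt : ∀ g : ℝ × ℝ → ℂ, Continuous g → IntegrableOn g U := fun g hg =>
    (hg.continuousOn.integrableOn_compact (isCompact_Icc.prod isCompact_Icc)).mono_set hUI
  set f : ℕ → ℝ → ℝ := fun k x => cut a1 b1 k x * trigOn a1 b1 0 n x with hf
  set g : ℕ → ℝ → ℝ := fun k y => cut a2 b2 k y * trigOn a2 b2 0 m y with hg
  have trigsm : ∀ a b n, ContDiff ℝ (⊤ : ℕ∞) (trigOn a b 0 n) := by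
    intro a b n; unfold trigOn trig; fun_prop
  have hfs : ∀ k, ContDiff ℝ (⊤ : ℕ∞) (f k) := fun k => (cut_contDiff _ _ k).mul (trigsm _ _ _)
  have hgs : ∀ k, ContDiff ℝ (⊤ : ℕ∞) (g k) := fun k => (cut_contDiff _ _ k).mul (trigsm _ _ _)
  have hf1 : ∀ k x, |f k x| ≤ 1 := fun k x => by
    rw [hf]; simp only [abs_mul]
    exact mul_le_one₀ (cut_abs_le _ _ _ _) (abs_nonneg _) (abs_trig_le _ _ _ _)
  have hg1 : ∀ k x, |g k x| ≤ 1 := fun k x => by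
    rw [hg]; simp only [abs_mul]
    exact mul_le_one₀ (cut_abs_le _ _ _ _) (abs_nonneg _) (abs_trig_le _ _ _ _)
  set l := n * π / (b1 - a1) with hldef
  set l' := m * π / (b2 - a2) with hldef'
  have lim1 := tendsto_integral_cutRem a1 b1 a2 b2 h1 h2 w hw hl hr n g hg1
  have lim2 := tendsto_integral_cutRem a2 b2 a1 b1 h2 h1 (fun p => w p.swap)
    (hw.comp continuous_swap) hb ht m f hf1
  have lim3 : Filter.Tendsto (fun k : ℕ => ∫ p in U, w p * ((f k p.1 * g k p.2 : ℝ) : ℂ))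
      Filter.atTop (nhds (∫ p in U,
        w p * ((trigOn a1 b1 0 n p.1 * trigOn a2 b2 0 m p.2 : ℝ) : ℂ))) := by
    refine tendsto_integral_of_dominated_convergence (fun p => ‖w p‖) (fun k => ?_)
      (hInt w hw).norm (fun k => ?_) ?_
    · have c1 := (hfs k).continuous
      have c2 := (hgs k).continuous
      exact (Continuous.aestronglyMeasurable (by fun_prop))
    · refine Filter.Eventually.of_forall fun p => ?_
      rw [norm_mul, Complex.norm_real, norm_mul]
      exact mul_le_of_le_one_right (norm_nonneg _) (mul_le_one₀ (hf1 _ _) (norm_nonneg _) (hg1 _ _))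
    · refine (ae_restrict_iff' hUm).2 (Filter.Eventually.of_forall fun p hp => ?_)
      refine tendsto_const_nhds.congr' ?_
      filter_upwards [cut_tendsto a1 b1 p.1 hp.1, cut_tendsto a2 b2 p.2 hp.2] with k e1 e2
      simp only [hf, hg, e1, e2, one_mul]
  have heq : ∀ᶠ k : ℕ in Filter.atTop,
      (((κ ^ 2 - l ^ 2 - l' ^ 2 : ℝ) : ℂ)) * ∫ p in U, w p * ((f k p.1 * g k p.2 : ℝ) : ℂ) =
      - ((∫ p in U, w p * ((cutRem a1 b1 k n p.1 * g k p.2 : ℝ) : ℂ)) +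
        ∫ p in Ioo a2 b2 ×ˢ Ioo a1 b1, w p.swap * ((cutRem a2 b2 k m p.1 * f k p.2 : ℝ) : ℂ)) := by
    obtain ⟨k0, hk0⟩ := exists_nat_ge (max (max (4 / (b1 - a1)) (4 / (b2 - a2))) 1)
    filter_upwards [Filter.eventually_ge_atTop k0] with k hk
    have hk' := hk0.trans (by exact_mod_cast hk : (k0 : ℝ) ≤ k)
    have e1 := ((le_max_left _ _).trans (le_max_left _ _)).trans hk'
    have e2 := ((le_max_right _ _).trans (le_max_left _ _)).trans hk'
    have e3 : (0 : ℝ) < k := one_pos.trans_le ((le_max_right _ _).trans hk')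
    rw [div_le_iff₀ (by linarith)] at e1 e2
    obtain ⟨f', hf', hf''⟩ := cut_mul_hasDerivAt2 a1 b1 k n
    obtain ⟨g', hg', hg''⟩ := cut_mul_hasDerivAt2 a2 b2 k m
    set φ : ℝ × ℝ → ℂ := fun p => ((f k p.1 * g k p.2 : ℝ) : ℂ) with hφ
    have hφs : ContDiff ℝ (⊤ : ℕ∞) φ := Complex.ofRealCLM.contDiff.comp
      (((hfs k).comp contDiff_fst).mul ((hgs k).comp contDiff_snd))
    have kp : (0 : ℝ) < 1 / k := by positivity
    have h0 := hweak φ hφs (Icc (a1 + 1 / k) (b1 - 1 / k) ×ˢ Icc (a2 + 1 / k) (b2 - 1 / k))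
      (isCompact_Icc.prod isCompact_Icc)
      (prod_mono (fun x hx => ⟨by linarith [hx.1], by linarith [hx.2]⟩)
        (fun x hx => ⟨by linarith [hx.1], by linarith [hx.2]⟩)) (fun p hp => by
          rcases not_and_or.1 hp with h | h
          · simp only [hφ, hf, cut_zero a1 b1 k e1 p.1 h]; simp
          · simp only [hφ, hg, cut_zero a2 b2 k e2 p.2 h]; simp)
    have d1 : ∀ p, pdM 2 0 φ p =
        (((-l ^ 2 * f k p.1 + cutRem a1 b1 k n p.1) * g k p.2 : ℝ) : ℂ) := by
      intro p
      have s1 : pd1 φ = fun p => ((f' p.1 * g k p.2 : ℝ) : ℂ) := by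
        ext q
        exact (((hf' q.1).mul_const (g k q.2)).ofReal_comp).deriv
      show pd1 (pd1 φ) p = _
      rw [s1]
      exact (((hf'' p.1).mul_const (g k p.2)).ofReal_comp).deriv
    have d2 : ∀ p, pdM 0 2 φ p =
        ((f k p.1 * (-l' ^ 2 * g k p.2 + cutRem a2 b2 k m p.2) : ℝ) : ℂ) := by
      intro p
      have s1 : pd2 φ = fun p => ((f k p.1 * g' p.2 : ℝ) : ℂ) := by
        ext q
        exact (((hg' q.2).const_mul (f k q.1)).ofReal_comp).deriv
      show pd2 (pd2 φ) p = _
      rw [s1]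
      exact (((hg'' p.2).const_mul (f k p.1)).ofReal_comp).deriv
    have c1 := (hfs k).continuous
    have c2 := (hgs k).continuous
    have c3 := cutRem_continuous a1 b1 k n
    have c4 := cutRem_continuous a2 b2 k m
    have sw := setIntegral_swap (Ioo a2 b2) (Ioo a1 b1)
      (fun p => w p * ((cutRem a2 b2 k m p.2 * f k p.1 : ℝ) : ℂ))
    simp only [Prod.fst_swap, Prod.snd_swap] at sw
    have i1 : IntegrableOn (fun p => w p * ((cutRem a1 b1 k n p.1 * g k p.2 : ℝ) : ℂ)) U :=
      hInt _ (by fun_prop)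
    have i2 : IntegrableOn (fun p => w p * ((cutRem a2 b2 k m p.2 * f k p.1 : ℝ) : ℂ)) U :=
      hInt _ (by fun_prop)
    have i3 : IntegrableOn (fun p => (((κ ^ 2 - l ^ 2 - l' ^ 2 : ℝ) : ℂ)) *
      (w p * ((f k p.1 * g k p.2 : ℝ) : ℂ))) U := hInt _ (by fun_prop)
    have i12 : IntegrableOn (fun p => w p * ((cutRem a1 b1 k n p.1 * g k p.2 : ℝ) : ℂ) +
      w p * ((cutRem a2 b2 k m p.2 * f k p.1 : ℝ) : ℂ)) U := i1.add i2
    rw [sw, ← integral_const_mul, ← integral_add i1 i2, eq_neg_iff_add_eq_zero,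
      ← integral_add i3 i12, ← h0]
    congr 1; ext p
    rw [d1, d2, hφ]
    push_cast; ring
  have lim := (lim3.const_mul (((κ ^ 2 - l ^ 2 - l' ^ 2 : ℝ) : ℂ))).congr' heq
  have lim0 := tendsto_nhds_unique lim ((lim1.add lim2).neg)
  rw [add_zero, neg_zero] at lim0
  refine (mul_eq_zero.1 lim0).resolve_left fun h => hA n m ?_
  have h' : κ ^ 2 - l ^ 2 - l' ^ 2 = 0 := by exact_mod_cast h
  linarith

theorem eq_zero_of_weak (κ a1 b1 a2 b2 : ℝ) (h1 : a1 < b1) (h2 : a2 < b2)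
    (hA : A0cond κ (b1 - a1) (b2 - a2)) (w : ℝ × ℝ → ℂ)
    (hw : ContinuousOn w (Icc a1 b1 ×ˢ Icc a2 b2))
    (hl : ∀ y ∈ Icc a2 b2, w (a1, y) = 0) (hr : ∀ y ∈ Icc a2 b2, w (b1, y) = 0)
    (hb : ∀ x ∈ Icc a1 b1, w (x, a2) = 0) (ht : ∀ x ∈ Icc a1 b1, w (x, b2) = 0)
    (hweak : ∀ φ : ℝ × ℝ → ℂ, ContDiff ℝ (⊤ : ℕ∞) φ → ∀ K, IsCompact K →
      K ⊆ Ioo a1 b1 ×ˢ Ioo a2 b2 → (∀ p ∉ K, φ p = 0) →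
      ∫ p in Ioo a1 b1 ×ˢ Ioo a2 b2, w p * (pdM 2 0 φ p + pdM 0 2 φ p + (κ : ℂ) ^ 2 * φ p) = 0) :
    ∀ p ∈ Icc a1 b1 ×ˢ Icc a2 b2, w p = 0 := by
  set W : ℝ × ℝ → ℂ := fun p => w (projIcc a1 b1 h1.le p.1, projIcc a2 b2 h2.le p.2) with hW
  have hWc : Continuous W := hw.comp_continuous (by fun_prop) fun p =>
      ⟨Subtype.coe_prop _, Subtype.coe_prop _⟩
  have hWw : ∀ p ∈ Icc a1 b1 ×ˢ Icc a2 b2, W p = w p := by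
    intro p hp
    simp only [hW, projIcc_of_mem h1.le hp.1, projIcc_of_mem h2.le hp.2]
  have hUm : MeasurableSet (Ioo a1 b1 ×ˢ Ioo a2 b2) := measurableSet_Ioo.prod measurableSet_Ioo
  have hUI : Ioo a1 b1 ×ˢ Ioo a2 b2 ⊆ Icc a1 b1 ×ˢ Icc a2 b2 :=
    prod_mono Ioo_subset_Icc_self Ioo_subset_Icc_self
  have la := left_mem_Icc.2 h1.le
  have lb := right_mem_Icc.2 h1.le
  have la' := left_mem_Icc.2 h2.le
  have lb' := right_mem_Icc.2 h2.le
  have hl' : ∀ y ∈ Icc a2 b2, W (a1, y) = 0 := fun y hy => by rw [hWw _ ⟨la, hy⟩, hl y hy]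
  have hr' : ∀ y ∈ Icc a2 b2, W (b1, y) = 0 := fun y hy => by rw [hWw _ ⟨lb, hy⟩, hr y hy]
  have hb' : ∀ x ∈ Icc a1 b1, W (x, a2) = 0 := fun x hx => by rw [hWw _ ⟨hx, la'⟩, hb x hx]
  have ht' : ∀ x ∈ Icc a1 b1, W (x, b2) = 0 := fun x hx => by rw [hWw _ ⟨hx, lb'⟩, ht x hx]
  have key := integral_mul_sine_eq_zero κ a1 b1 a2 b2 h1 h2 hA W hWc hl' hr' hb' ht' (by
    intro φ hφ K hK hKU h
    rw [← hweak φ hφ K hK hKU h]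
    exact setIntegral_congr_fun hUm fun p hp => by simp only [hWw p (hUI hp)])
  have tc := fun a b n => trigOn_continuous a b 0 n
  have step1 : ∀ m x, x ∈ Icc a1 b1 → ∫ y in a2..b2, W (x, y) * (trigOn a2 b2 0 m y : ℂ) = 0 := by
    intro m
    have hcont : Continuous fun x => ∫ y in a2..b2, W (x, y) * (trigOn a2 b2 0 m y : ℂ) := by
      refine intervalIntegral.continuous_parametric_intervalIntegral_of_continuous' ?_ _ _
      have := tc a2 b2 m
      fun_prop
    refine sine_unique a1 b1 h1 (fun x => ∫ y in a2..b2, W (x, y) * (trigOn a2 b2 0 m y : ℂ))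
      hcont.continuousOn ?_ ?_ fun n _ => ?_
    · refine (intervalIntegral.integral_congr (g := fun _ => 0) fun y hy => ?_).trans (by simp)
      rw [uIcc_of_le h2.le] at hy
      simp [hl' y hy]
    · refine (intervalIntegral.integral_congr (g := fun _ => 0) fun y hy => ?_).trans (by simp)
      rw [uIcc_of_le h2.le] at hy
      simp [hr' y hy]
    · have k := key n m
      rw [Measure.volume_eq_prod, setIntegral_prod] at k
      · rw [intervalIntegral.integral_of_le h1.le, integral_Ioc_eq_integral_Ioo, ← k]
        refine setIntegral_congr_fun measurableSet_Ioo fun x _ => ?_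
        simp only []
        rw [intervalIntegral.integral_of_le h2.le, integral_Ioc_eq_integral_Ioo, mul_comm,
          ← integral_const_mul]
        congr 1; ext y; push_cast; ring
      · have c1 := tc a1 b1 n
        have c2 := tc a2 b2 m
        have : Continuous fun z : ℝ × ℝ =>
          W z * ((trigOn a1 b1 0 n z.1 * trigOn a2 b2 0 m z.2 : ℝ) : ℂ) := by fun_prop
        exact (this.continuousOn.integrableOn_compact (isCompact_Icc.prod isCompact_Icc)
            ).mono_set hUI
  intro p hp
  rw [← hWw p hp]
  refine sine_unique a2 b2 h2 (fun y => W (p.1, y)) (hWc.comp (by fun_prop)).continuousOn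
    (hb' _ hp.1) (ht' _ hp.1) (fun m _ => step1 m p.1 hp.1) p.2 hp.2

theorem A0cond.symm {κ h1 h2 : ℝ} (h : A0cond κ h1 h2) : A0cond κ h2 h1 := fun n m => by
  rw [add_comm]; exact h m n

/-- Superposition of the four edge series of a rectangle (bottom, top, left, right). -/
def rectSer (κ a1 b1 a2 b2 : ℝ) (cB cT cL cR : ℕ → ℂ) (i j : ℕ) (p : ℝ × ℝ) : ℂ :=
  (edgeSer κ a1 b1 (b2 - a2) (-1) b2 cB i j p + edgeSer κ a1 b1 (b2 - a2) 1 a2 cT i j p) +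
    (edgeSer κ a2 b2 (b1 - a1) (-1) b1 cL j i p.swap + edgeSer κ a2 b2 (b1 - a1) 1 a1 cR j i p.swap)

theorem oriented_neg (a b : ℝ) : Oriented a b (-1) b := Or.inr ⟨rfl, rfl⟩

theorem oriented_one (a b : ℝ) : Oriented a b 1 a := Or.inl ⟨rfl, rfl⟩

section rect

variable {κ a1 b1 a2 b2 : ℝ} {cB cT cL cR : ℕ → ℂ}

theorem rectSer_isJet (hκ : 0 < κ) (h1 : a1 < b1) (h2 : a2 < b2)
    (hB : Summable fun n => ‖cB n‖) (hT : Summable fun n => ‖cT n‖)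
    (hL : Summable fun n => ‖cL n‖) (hR : Summable fun n => ‖cR n‖) :
    IsJet (Ioo a1 b1 ×ˢ Ioo a2 b2) (rectSer κ a1 b1 a2 b2 cB cT cL cR) := by
  have v := ((edgeSer_isJet κ a2 b2 a1 b1 (-1) b1 hκ h2 h1 (oriented_neg _ _) cL hL).add
    (edgeSer_isJet κ a2 b2 a1 b1 1 a1 hκ h2 h1 (oriented_one _ _) cR hR)).swap
  rw [preimage_swap_prod] at v
  exact ((edgeSer_isJet κ a1 b1 a2 b2 (-1) b2 hκ h1 h2 (oriented_neg _ _) cB hB).add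
    (edgeSer_isJet κ a1 b1 a2 b2 1 a2 hκ h1 h2 (oriented_one _ _) cT hT)).add v

theorem rectSer_helmholtz (hκ : 0 < κ) (h1 : a1 < b1) (h2 : a2 < b2)
    (hB : Summable fun n => ‖cB n‖) (hT : Summable fun n => ‖cT n‖)
    (hL : Summable fun n => ‖cL n‖) (hR : Summable fun n => ‖cR n‖)
    (p : ℝ × ℝ) (hp : p ∈ Ioo a1 b1 ×ˢ Ioo a2 b2) :
    rectSer κ a1 b1 a2 b2 cB cT cL cR 2 0 p + rectSer κ a1 b1 a2 b2 cB cT cL cR 0 2 p +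
      (κ : ℂ) ^ 2 * rectSer κ a1 b1 a2 b2 cB cT cL cR 0 0 p = 0 := by
  have e1 := edgeSer_helmholtz κ a1 b1 a2 b2 (-1) b2 hκ h1 h2 (oriented_neg _ _) cB hB p hp
  have e2 := edgeSer_helmholtz κ a1 b1 a2 b2 1 a2 hκ h1 h2 (oriented_one _ _) cT hT p hp
  have e3 := edgeSer_helmholtz κ a2 b2 a1 b1 (-1) b1 hκ h2 h1 (oriented_neg _ _) cL hL p.swap
    ⟨hp.2, hp.1⟩
  have e4 := edgeSer_helmholtz κ a2 b2 a1 b1 1 a1 hκ h2 h1 (oriented_one _ _) cR hR p.swap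
    ⟨hp.2, hp.1⟩
  unfold rectSer
  linear_combination e1 + e2 + e3 + e4

theorem rectSer_continuousOn (hκ : 0 < κ) (h1 : a1 < b1) (h2 : a2 < b2)
    (hB : Summable fun n => ‖cB n‖) (hT : Summable fun n => ‖cT n‖)
    (hL : Summable fun n => ‖cL n‖) (hR : Summable fun n => ‖cR n‖) :
    ContinuousOn (rectSer κ a1 b1 a2 b2 cB cT cL cR 0 0) (Icc a1 b1 ×ˢ Icc a2 b2) := by
  have m1 : Icc a1 b1 ×ˢ Icc a2 b2 ⊆ univ ×ˢ Icc a2 b2 := prod_mono (subset_univ _) subset_rfl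
  have m2 : MapsTo (Prod.swap : ℝ × ℝ → ℝ × ℝ) (Icc a1 b1 ×ˢ Icc a2 b2) (univ ×ˢ Icc a1 b1) :=
    fun p hp => ⟨trivial, hp.1⟩
  exact (((edgeSer_continuousOn κ a1 b1 a2 b2 (-1) b2 hκ
      h1 h2 (oriented_neg _ _) cB hB).mono m1).add
    ((edgeSer_continuousOn κ a1 b1 a2 b2 1 a2 hκ h1 h2 (oriented_one _ _) cT hT).mono m1)).add
    (((edgeSer_continuousOn κ a2 b2 a1 b1 (-1) b1 hκ h2 h1 (oriented_neg _ _) cL hL).comp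
      continuous_swap.continuousOn m2).add
    ((edgeSer_continuousOn κ a2 b2 a1 b1 1 a1 hκ h2 h1 (oriented_one _ _) cR hR).comp
      continuous_swap.continuousOn m2))

theorem rectSer_bottom (hκ : 0 < κ) (h1 : a1 < b1) (h2 : a2 < b2)
    (hA : A0cond κ (b1 - a1) (b2 - a2)) (x : ℝ) :
    rectSer κ a1 b1 a2 b2 cB cT cL cR 0 0 (x, a2) = ∑' n, cB n * (trigOn a1 b1 0 n x : ℂ) := by
  have := edgeSer_active κ a1 b1 (b2 - a2) (-1) b2 hκ h1 (by linarith) hA (by norm_num) cB x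
  rw [show b2 + -1 * (b2 - a2) = a2 by ring] at this
  simp [rectSer, this, edgeSer_base, edgeSer_left]

theorem rectSer_top (hκ : 0 < κ) (h1 : a1 < b1) (h2 : a2 < b2)
    (hA : A0cond κ (b1 - a1) (b2 - a2)) (x : ℝ) :
    rectSer κ a1 b1 a2 b2 cB cT cL cR 0 0 (x, b2) = ∑' n, cT n * (trigOn a1 b1 0 n x : ℂ) := by
  have := edgeSer_active κ a1 b1 (b2 - a2) 1 a2 hκ h1 (by linarith) hA (by norm_num) cT x
  rw [show a2 + 1 * (b2 - a2) = b2 by ring] at this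
  simp [rectSer, this, edgeSer_base, edgeSer_right _ _ _ _ _ _ h2]

theorem rectSer_left (hκ : 0 < κ) (h1 : a1 < b1) (h2 : a2 < b2)
    (hA : A0cond κ (b1 - a1) (b2 - a2)) (y : ℝ) :
    rectSer κ a1 b1 a2 b2 cB cT cL cR 0 0 (a1, y) = ∑' n, cL n * (trigOn a2 b2 0 n y : ℂ) := by
  have := edgeSer_active κ a2 b2 (b1 - a1) (-1) b1 hκ h2 (by linarith) hA.symm (by norm_num) cL y
  rw [show b1 + -1 * (b1 - a1) = a1 by ring] at this
  simp [rectSer, this, edgeSer_base, edgeSer_left]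

theorem rectSer_right (hκ : 0 < κ) (h1 : a1 < b1) (h2 : a2 < b2)
    (hA : A0cond κ (b1 - a1) (b2 - a2)) (y : ℝ) :
    rectSer κ a1 b1 a2 b2 cB cT cL cR 0 0 (b1, y) = ∑' n, cR n * (trigOn a2 b2 0 n y : ℂ) := by
  have := edgeSer_active κ a2 b2 (b1 - a1) 1 a1 hκ h2 (by linarith) hA.symm (by norm_num) cR y
  rw [show a1 + 1 * (b1 - a1) = b1 by ring] at this
  simp [rectSer, this, edgeSer_base, edgeSer_right _ _ _ _ _ _ h1]

/-- A continuous weak Helmholtz solution on a rectangle is the superposition of the series of its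
four traces. -/
theorem eq_rectSer (hκ : 0 < κ) (h1 : a1 < b1) (h2 : a2 < b2)
    (hA : A0cond κ (b1 - a1) (b2 - a2))
    (hB : Summable fun n => ‖cB n‖) (hT : Summable fun n => ‖cT n‖)
    (hL : Summable fun n => ‖cL n‖) (hR : Summable fun n => ‖cR n‖)
    (u : ℝ × ℝ → ℂ) (hu : ContinuousOn u (Icc a1 b1 ×ˢ Icc a2 b2))
    (hw : WeakHelmholtz κ (Ioo a1 b1 ×ˢ Ioo a2 b2) u)
    (uB : ∀ x ∈ Icc a1 b1, ∑' n, cB n * (trigOn a1 b1 0 n x : ℂ) = u (x, a2))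
    (uT : ∀ x ∈ Icc a1 b1, ∑' n, cT n * (trigOn a1 b1 0 n x : ℂ) = u (x, b2))
    (uL : ∀ y ∈ Icc a2 b2, ∑' n, cL n * (trigOn a2 b2 0 n y : ℂ) = u (a1, y))
    (uR : ∀ y ∈ Icc a2 b2, ∑' n, cR n * (trigOn a2 b2 0 n y : ℂ) = u (b1, y)) :
    EqOn u (rectSer κ a1 b1 a2 b2 cB cT cL cR 0 0) (Icc a1 b1 ×ˢ Icc a2 b2) := by
  have hc := rectSer_continuousOn hκ h1 h2 hB hT hL hR
  have hUI : Ioo a1 b1 ×ˢ Ioo a2 b2 ⊆ Icc a1 b1 ×ˢ Icc a2 b2 :=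
    prod_mono Ioo_subset_Icc_self Ioo_subset_Icc_self
  have hU : MeasurableSet (Ioo a1 b1 ×ˢ Ioo a2 b2) := measurableSet_Ioo.prod measurableSet_Ioo
  intro p hp
  refine sub_eq_zero.1 (eq_zero_of_weak κ a1 b1 a2 b2 h1 h2 hA
    (fun p => u p - rectSer κ a1 b1 a2 b2 cB cT cL cR 0 0 p) (hu.sub hc) ?_ ?_ ?_ ?_ ?_ p hp)
  · intro y hy; rw [rectSer_left hκ h1 h2 hA, uL y hy, sub_self]
  · intro y hy; rw [rectSer_right hκ h1 h2 hA, uR y hy, sub_self]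
  · intro x hx; rw [rectSer_bottom hκ h1 h2 hA, uB x hx, sub_self]
  · intro x hx; rw [rectSer_top hκ h1 h2 hA, uT x hx, sub_self]
  · intro φ hφ K hK hKU h
    have hts : tsupport φ ⊆ K := closure_minimal (fun q hq => by
      by_contra hn; exact hq (h q hn)) hK.isClosed
    have e1 := hw.2 φ hφ (hK.of_isClosed_subset (isClosed_tsupport φ) hts) (hts.trans hKU)
    have e2 := (rectSer_isJet hκ h1 h2 hB hT hL hR).weakHelmholtz (κ := κ)
      (rectSer_helmholtz hκ h1 h2 hB hT hL hR) hφ hK hKU h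
    have z1 := pd1_eq_zero hK.isClosed (pd1_eq_zero hK.isClosed h)
    have z2 := pd2_eq_zero hK.isClosed (pd2_eq_zero hK.isClosed h)
    have hg : Continuous fun p => pdM 2 0 φ p + pdM 0 2 φ p + (κ : ℂ) ^ 2 * φ p :=
      ((contDiff_pd1 (contDiff_pd1 hφ)).continuous.add
        (contDiff_pd2 (contDiff_pd2 hφ)).continuous).add (continuous_const.mul hφ.continuous)
    have hz : ∀ p ∉ K, pdM 2 0 φ p + pdM 0 2 φ p + (κ : ℂ) ^ 2 * φ p = 0 := by
      intro q hq
      have t1 : pdM 2 0 φ q = 0 := z1 q hq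
      have t2 : pdM 0 2 φ q = 0 := z2 q hq
      rw [t1, t2, h q hq]; simp
    have i1 := integrableOn_mul_of_support hU hK hKU (hu.mono hUI) hg hz
    have i2 := integrableOn_mul_of_support hU hK hKU (hc.mono hUI) hg hz
    simp_rw [sub_mul]
    rw [integral_sub i1 i2, e1, e2, sub_zero]

end rect

theorem sineD_zero_mode (a b : ℝ) (i : ℕ) (x : ℝ) : sineD a b i 0 x = 0 := by
  unfold sineD trigOn trig
  rcases i with _ | i <;> simp

/-- Fatou: bounds for the squared `L²` norms of continuous approximants pass to the pointwise
limit. -/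
theorem integral_norm_sq_le_of_tendsto {X : Type*} [MeasurableSpace X] {m : Measure X}
    {f : X → ℂ} {S : ℕ → X → ℂ} (hf : AEStronglyMeasurable f m)
    (hS : ∀ N, Integrable (fun x => ‖S N x‖ ^ 2) m)
    (hlim : ∀ᵐ x ∂m, Filter.Tendsto (fun N => S N x) Filter.atTop (nhds (f x)))
    {R : ℝ} (hR : ∀ N, ∫ x, ‖S N x‖ ^ 2 ∂m ≤ R) :
    Integrable (fun x => ‖f x‖ ^ 2) m ∧ ∫ x, ‖f x‖ ^ 2 ∂m ≤ R := by
  have hR0 : 0 ≤ R := (integral_nonneg fun _ => by positivity).trans (hR 0)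
  have key : ∫⁻ x, ENNReal.ofReal (‖f x‖ ^ 2) ∂m ≤ ENNReal.ofReal R := by
    calc ∫⁻ x, ENNReal.ofReal (‖f x‖ ^ 2) ∂m
        = ∫⁻ x, Filter.liminf (fun N => ENNReal.ofReal (‖S N x‖ ^ 2)) Filter.atTop ∂m := by
          refine lintegral_congr_ae ?_
          filter_upwards [hlim] with x hx
          exact (((ENNReal.continuous_ofReal.tendsto _).comp (hx.norm.pow 2)).liminf_eq).symm
      _ ≤ Filter.liminf (fun N => ∫⁻ x, ENNReal.ofReal (‖S N x‖ ^ 2) ∂m) Filter.atTop :=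
          lintegral_liminf_le' fun N => (hS N).aestronglyMeasurable.aemeasurable.ennreal_ofReal
      _ ≤ ENNReal.ofReal R := by
          refine Filter.liminf_le_of_le (by isBoundedDefault) fun y hy => ?_
          obtain ⟨N, hN⟩ := hy.exists
          refine hN.trans ?_
          rw [← ofReal_integral_eq_lintegral_ofReal (hS N)
            (Filter.Eventually.of_forall fun x => by positivity)]
          exact ENNReal.ofReal_le_ofReal (hR N)
  have hm : AEStronglyMeasurable (fun x => ‖f x‖ ^ 2) m := (hf.norm.pow 2)
  have nn : 0 ≤ᵐ[m] fun x => ‖f x‖ ^ 2 := Filter.Eventually.of_forall fun x => by positivity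
  refine ⟨(lintegral_ofReal_ne_top_iff_integrable hm nn).1
    (key.trans_lt ENNReal.ofReal_lt_top).ne, ?_⟩
  rw [integral_eq_lintegral_of_nonneg_ae nn hm]
  exact ENNReal.toReal_le_of_le_ofReal hR0 key

theorem integrableOn_rect_of_continuous {f : ℝ × ℝ → ℝ} (hf : Continuous f) (a1 b1 a2 b2 : ℝ) :
    IntegrableOn f (Ioo a1 b1 ×ˢ Ioo a2 b2) :=
  (hf.continuousOn.integrableOn_compact (isCompact_Icc.prod isCompact_Icc)).mono_set
    (prod_mono Ioo_subset_Icc_self Ioo_subset_Icc_self)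

theorem setIntegral_rect_eq {f : ℝ × ℝ → ℝ} (hf : Continuous f) {a1 b1 a2 b2 : ℝ} (h1 : a1 ≤ b1)
    (h2 : a2 ≤ b2) :
    ∫ p in Ioo a1 b1 ×ˢ Ioo a2 b2, f p = ∫ y in a2..b2, ∫ x in a1..b1, f (x, y) := by
  have i := integrableOn_rect_of_continuous (f := fun p => f p.swap) (hf.comp continuous_swap)
    a2 b2 a1 b1
  rw [← setIntegral_swap]
  rw [Measure.volume_eq_prod] at i ⊢
  rw [setIntegral_prod _ i, intervalIntegral.integral_of_le h2, integral_Ioc_eq_integral_Ioo]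
  refine integral_congr_ae (Filter.Eventually.of_forall fun y => ?_)
  simp only [Prod.swap_prod_mk]
  rw [intervalIntegral.integral_of_le h1, integral_Ioc_eq_integral_Ioo]

theorem integral_norm_sq_edgeSum (κ a b a2 b2 L2 σ e : ℝ) (hab : a < b) (hab2 : a2 < b2) (c : ℕ → ℂ)
    (i j : ℕ) (F : Finset ℕ) (hF : ∀ n ∈ F, 1 ≤ n) :
    ∫ p in Ioo a b ×ˢ Ioo a2 b2, ‖∑ n ∈ F, c n * sineD a b i n p.1 *
        normalD κ (b - a) L2 σ e j n p.2‖ ^ 2 =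
      ∑ n ∈ F, (b - a) / 2 * ‖c n‖ ^ 2 * (n * π / (b - a)) ^ (2 * i) *
        ∫ y in a2..b2, ‖normalD κ (b - a) L2 σ e j n y‖ ^ 2 := by
  have h1 := fun n => sineD_continuous a b i n
  have h2 := fun n => normalD_continuous κ (b - a) L2 σ e j n
  rw [setIntegral_rect_eq (f := fun p => ‖∑ n ∈ F, c n * sineD a b i n p.1 *
    normalD κ (b - a) L2 σ e j n p.2‖ ^ 2) (by fun_prop) hab.le hab2.le]
  simp_rw [← intervalIntegral.integral_const_mul]
  rw [← intervalIntegral.integral_finsetSum fun n _ =>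
    (Continuous.intervalIntegrable (by fun_prop) _ _)]
  refine intervalIntegral.integral_congr fun y _ => ?_
  have := integral_norm_sq_sum_trigOn a b hab i F hF
    fun n => c n * (((n * π / (b - a)) ^ i : ℝ) : ℂ) * normalD κ (b - a) L2 σ e j n y
  rw [Finset.mul_sum] at this
  convert this using 1
  · congr 1; ext x; congr 2
    refine Finset.sum_congr rfl fun n _ => ?_
    unfold sineD; push_cast; ring
  · refine Finset.sum_congr rfl fun n _ => ?_
    rw [norm_mul, norm_mul, Complex.norm_real, mul_pow, mul_pow, Real.norm_eq_abs, sq_abs,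
      ← pow_mul,
      mul_comm i 2]
    ring

theorem edgeSer_l2 (κ a b a2 b2 σ e : ℝ) (hκ : 0 < κ) (hab : a < b) (hab2 : a2 < b2)
    (ho : Oriented a2 b2 σ e) (c : ℕ → ℂ) (hc : Summable fun n => ‖c n‖) (i j : ℕ) (R : ℝ)
    (hR : ∀ F : Finset ℕ, (∀ n ∈ F, 1 ≤ n) →
      ∑ n ∈ F, (b - a) / 2 * ‖c n‖ ^ 2 * (n * π / (b - a)) ^ (2 * i) *
        ∫ y in a2..b2, ‖normalD κ (b - a) (b2 - a2) σ e j n y‖ ^ 2 ≤ R) :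
    IntegrableOn (fun p => ‖edgeSer κ a b (b2 - a2) σ e c i j p‖ ^ 2) (Ioo a b ×ˢ Ioo a2 b2) ∧
      ∫ p in Ioo a b ×ˢ Ioo a2 b2, ‖edgeSer κ a b (b2 - a2) σ e c i j p‖ ^ 2 ≤ R := by
  have hU : MeasurableSet (Ioo a b ×ˢ Ioo a2 b2) := measurableSet_Ioo.prod measurableSet_Ioo
  have h1 := fun n => sineD_continuous a b i n
  have h2 := fun n => normalD_continuous κ (b - a) (b2 - a2) σ e j n
  refine integral_norm_sq_le_of_tendsto (S := fun N p => ∑ n ∈ Finset.range N,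
    c n * sineD a b i n p.1 * normalD κ (b - a) (b2 - a2) σ e j n p.2)
    (((edgeSer_isJet κ a b a2 b2 σ e hκ hab hab2 ho c hc).cont i j).aestronglyMeasurable hU)
    (fun N => integrableOn_rect_of_continuous (by fun_prop) _ _ _ _) ?_ fun N => ?_
  · filter_upwards [ae_restrict_mem hU] with p hp
    exact (edgeTerm_summable κ a b a2 b2 σ e hκ hab hab2 ho c hc i j p.1 p.2
      hp.2).hasSum.tendsto_sum_nat
  · refine le_trans (le_of_eq ?_) (hR ((Finset.range N).filter fun n => 1 ≤ n)
      fun n hn => (Finset.mem_filter.1 hn).2)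
    rw [← integral_norm_sq_edgeSum κ a b a2 b2 _ σ e hab hab2 c i j _
      fun n hn => (Finset.mem_filter.1 hn).2]
    congr 1; ext p; congr 2
    refine (Finset.sum_filter_of_ne fun n _ hn => ?_).symm
    by_contra h0
    obtain rfl : n = 0 := by omega
    exact hn (by rw [sineD_zero_mode]; simp)

theorem integral_norm_sq_normalD (κ L1 a2 b2 σ e : ℝ) (ho : Oriented a2 b2 σ e) (j n : ℕ) :
    ∫ y in a2..b2, ‖normalD κ L1 (b2 - a2) σ e j n y‖ ^ 2 =
      ∫ t in (0 : ℝ)..(b2 - a2), ‖modeD κ L1 (b2 - a2) j n t‖ ^ 2 := by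
  unfold normalD
  simp_rw [norm_mul, ho.norm_pow, one_mul]
  rcases ho with ⟨rfl, rfl⟩ | ⟨rfl, rfl⟩
  · simp_rw [one_mul]
    rw [intervalIntegral.integral_comp_sub_right fun t => ‖modeD κ L1 (b2 - e) j n t‖ ^ 2]
    simp
  · simp_rw [show ∀ y, -1 * (y - e) = e - y by intro y; ring]
    rw [intervalIntegral.integral_comp_sub_left fun t => ‖modeD κ L1 (e - a2) j n t‖ ^ 2]
    simp

theorem tanh_pos_of_pos {x : ℝ} (hx : 0 < x) : 0 < Real.tanh x := by
  rw [Real.tanh_eq_sinh_div_cosh]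
  exact div_pos (Real.sinh_pos_iff.2 hx) (Real.cosh_pos x)

theorem tanh_le_tanh_of_le {x y : ℝ} (h : x ≤ y) : Real.tanh x ≤ Real.tanh y := by
  rw [Real.tanh_eq_sinh_div_cosh, Real.tanh_eq_sinh_div_cosh,
    div_le_div_iff₀ (Real.cosh_pos x) (Real.cosh_pos y)]
  have := Real.sinh_nonneg_iff.2 (sub_nonneg.2 h)
  rw [Real.sinh_sub] at this
  linarith

/-- The coefficients of order greater than `N`. -/
def tailCoef (N : ℕ) (c : ℕ → ℂ) (n : ℕ) : ℂ := if N < n then c n else 0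

theorem norm_tailCoef_le (N : ℕ) (c : ℕ → ℂ) (n : ℕ) : ‖tailCoef N c n‖ ≤ ‖c n‖ := by
  unfold tailCoef; split_ifs <;> simp

theorem summable_tailCoef (N : ℕ) {c : ℕ → ℂ} (hc : Summable fun n => ‖c n‖) :
    Summable fun n => ‖tailCoef N c n‖ :=
  Summable.of_nonneg_of_le (fun _ => norm_nonneg _) (norm_tailCoef_le N c) hc

/-- The factor governing the decay of the high modes. -/
def decay (κ m ν : ℝ) (r μ : ℕ) : ℝ := Real.sqrt 2 / (κ * Real.tanh (κ * m) * ν ^ (2 * (μ - r) + 1))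

theorem mode_bound (κ L1 L2 m ν : ℝ) (hκ : 0 < κ) (hL1 : 0 < L1) (hm : 0 < m) (hmL : m ≤ L2)
    (hν : Real.sqrt 2 ≤ ν) (r μ i j n : ℕ) (hrμ : r ≤ μ) (hij : i + j ≤ r)
    (hn : ν ≤ n * π / L1 / κ) :
    (n * π / L1) ^ (2 * i) * ∫ t in (0 : ℝ)..L2, ‖modeD κ L1 L2 j n t‖ ^ 2 ≤
      κ ^ (2 * (i + j)) * (if j = 0 then 1 / 2 else 1) * decay κ m ν r μ * (κ ^ (2 * μ))⁻¹ *
        (n * π / L1) ^ (2 * μ) := by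
  set lam := n * π / L1 with hlam
  set x := lam / κ with hx
  have hlx : lam = κ * x := by rw [hx]; field_simp
  have s2 : 0 < Real.sqrt 2 := by positivity
  have s22 : Real.sqrt 2 ^ 2 = 2 := Real.sq_sqrt (by norm_num)
  have hν0 : 0 < ν := s2.trans_le hν
  have hx0 : 0 < x := hν0.trans_le hn
  have hx2 : 2 ≤ x ^ 2 := by rw [← s22]; exact pow_le_pow_left₀ s2.le (hν.trans hn) 2
  have hν1 : 1 ≤ ν := le_trans (Real.one_le_sqrt.2 (by norm_num)) hν
  have hx1 : 1 ≤ x := hν1.trans hn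
  have hlam0 : 0 < lam := by rw [hlx]; positivity
  have hkl : κ < lam := by
    rw [hlx]; nlinarith
  have h := integral_norm_sq_modeD_le κ L1 L2 hκ hL1 (hm.trans_le hmL) j n hkl
  set q := modeRate κ L1 n with hq
  have hq2 : q ^ 2 = lam ^ 2 - κ ^ 2 := by
    rw [hq, modeRate, ← hlam]; exact Real.sq_sqrt (by nlinarith)
  have hq0 : 0 ≤ q := Real.sqrt_nonneg _
  have hlx2 : lam ^ 2 = κ ^ 2 * x ^ 2 := by rw [hlx]; ring
  have hqk : κ ≤ q := by
    refine le_of_sq_le_sq ?_ hq0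
    nlinarith [sq_nonneg κ]
  have hqpos : 0 < q := hκ.trans_le hqk
  have hql : q ≤ lam := by
    refine le_of_sq_le_sq ?_ hlam0.le
    nlinarith [sq_nonneg κ]
  have hlq : lam ≤ Real.sqrt 2 * q := by
    refine le_of_sq_le_sq ?_ (by positivity)
    rw [mul_pow, s22]; nlinarith [sq_nonneg κ]
  have ht0 : 0 < Real.tanh (κ * m) := tanh_pos_of_pos (by positivity)
  have ht : Real.tanh (κ * m) ≤ Real.tanh (q * L2) :=
    tanh_le_tanh_of_le (mul_le_mul hqk hmL hm.le hq0)
  have htq : 0 < Real.tanh (q * L2) := ht0.trans_le ht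
  set w : ℝ := if j = 0 then 1 / 2 else 1 with hw
  have hw0 : 0 ≤ w := by rw [hw]; split_ifs <;> norm_num
  have step1 : w * q ^ (2 * j) / (q * Real.tanh (q * L2)) ≤
      w * lam ^ (2 * j) * Real.sqrt 2 / (lam * Real.tanh (κ * m)) := by
    rw [div_le_div_iff₀ (by positivity) (by positivity)]
    have e1 : q ^ (2 * j) ≤ lam ^ (2 * j) := pow_le_pow_left₀ hq0 hql _
    calc w * q ^ (2 * j) * (lam * Real.tanh (κ * m)) 
        ≤ w * lam ^ (2 * j) * ((Real.sqrt 2 * q) * Real.tanh (q * L2)) := by gcongr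
      _ = _ := by ring
  have step2 : lam ^ (2 * i) * (w * lam ^ (2 * j) * Real.sqrt 2 / (lam * Real.tanh (κ * m))) =
      κ ^ (2 * (i + j)) * w * (Real.sqrt 2 / (κ * Real.tanh (κ * m))) *
          (x ^ (2 * (i + j)) / x) := by
    rw [hlx, mul_add, pow_add, pow_add, mul_pow, mul_pow]
    field_simp
  have step3 : x ^ (2 * (i + j)) / x ≤ x ^ (2 * μ) / ν ^ (2 * (μ - r) + 1) := by
    rw [div_le_div_iff₀ hx0 (by positivity)]
    calc x ^ (2 * (i + j)) * ν ^ (2 * (μ - r) + 1) ≤ x ^ (2 * r) * x ^ (2 * (μ - r) + 1) := by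
          gcongr
      _ = x ^ (2 * μ) * x := by
          rw [← pow_add, ← pow_succ]; congr 1; omega
  calc lam ^ (2 * i) * ∫ t in (0 : ℝ)..L2, ‖modeD κ L1 L2 j n t‖ ^ 2
      ≤ lam ^ (2 * i) * (w * lam ^ (2 * j) * Real.sqrt 2 / (lam * Real.tanh (κ * m))) :=
        mul_le_mul_of_nonneg_left (h.trans step1) (by positivity)
    _ ≤ κ ^ (2 * (i + j)) * w * (Real.sqrt 2 / (κ * Real.tanh (κ * m))) *
        (x ^ (2 * μ) / ν ^ (2 * (μ - r) + 1)) := by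
        rw [step2]; gcongr
    _ = _ := by
        rw [hlx, decay, mul_pow]; field_simp

theorem edge_tail_l2 (κ a b a2 b2 σ e m ν : ℝ) (hκ : 0 < κ) (hab : a < b) (hab2 : a2 < b2)
    (ho : Oriented a2 b2 σ e) (hm : 0 < m) (hmL : m ≤ b2 - a2) (hν : Real.sqrt 2 ≤ ν)
    (r μ i j N : ℕ) (hrμ : r ≤ μ) (hij : i + j ≤ r) (hN : ν ≤ N * π / (b - a) / κ)
    (c : ℕ → ℂ) (hc : Summable fun n => ‖c n‖) (T : ℝ)
    (hT : ∀ F : Finset ℕ, (∀ n ∈ F, 1 ≤ n) →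
      ∑ n ∈ F, (b - a) / 2 * ‖c n‖ ^ 2 * (n * π / (b - a)) ^ (2 * μ) ≤ T) :
    IntegrableOn (fun p => ‖edgeSer κ a b (b2 - a2) σ e (tailCoef N c) i j p‖ ^ 2)
        (Ioo a b ×ˢ Ioo a2 b2) ∧
      ∫ p in Ioo a b ×ˢ Ioo a2 b2, ‖edgeSer κ a b (b2 - a2) σ e (tailCoef N c) i j p‖ ^ 2 ≤
        κ ^ (2 * (i + j)) * (if j = 0 then 1 / 2 else 1) * decay κ m ν r μ *
          ((κ ^ (2 * μ))⁻¹ * T) := by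
  have hba : 0 < b - a := by linarith
  refine edgeSer_l2 κ a b a2 b2 σ e hκ hab hab2 ho _ (summable_tailCoef N hc) i j _ fun F hF => ?_
  have hd : 0 ≤ decay κ m ν r μ := by
    have : 0 < Real.tanh (κ * m) := tanh_pos_of_pos (by positivity)
    have : 0 ≤ ν := (Real.sqrt_nonneg 2).trans hν
    unfold decay; positivity
  refine le_trans (Finset.sum_le_sum fun n hn => ?_) (le_trans (le_of_eq (Finset.mul_sum F
    (fun n => (b - a) / 2 * ‖c n‖ ^ 2 * (n * π / (b - a)) ^ (2 * μ))
    (κ ^ (2 * (i + j)) * (if j = 0 then 1 / 2 else 1) *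
        decay κ m ν r μ * (κ ^ (2 * μ))⁻¹)).symm) ?_)
  · rw [integral_norm_sq_normalD κ (b - a) a2 b2 σ e ho]
    set w : ℝ := if j = 0 then 1 / 2 else 1 with hw
    have hw0 : 0 ≤ w := by rw [hw]; split_ifs <;> norm_num
    by_cases hNn : N < n
    · have hmode := mode_bound κ (b - a) (b2 - a2) m ν hκ hba hm hmL hν r μ i j n hrμ hij
        (hN.trans (by gcongr))
      rw [tailCoef, if_pos hNn]
      calc _ = (b - a) / 2 * ‖c n‖ ^ 2 * ((n * π / (b - a)) ^ (2 * i) *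
            ∫ t in (0 : ℝ)..(b2 - a2), ‖modeD κ (b - a) (b2 - a2) j n t‖ ^ 2) := by ring
        _ ≤ _ := mul_le_mul_of_nonneg_left hmode (by positivity)
        _ = _ := by rw [← hw]; ring
    · rw [tailCoef, if_neg hNn]
      simp only [norm_zero, ne_eq, OfNat.ofNat_ne_zero, not_false_eq_true, zero_pow, mul_zero,
        zero_mul]
      positivity
  · rw [← mul_assoc]
    have hF' := hT F hF
    gcongr

theorem idxLe_succ (r : ℕ) : idxLe (r + 1) =
    idxLe r ∪ Finset.HasAntidiagonal.antidiagonal (r + 1) := by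
  ext p
  simp only [idxLe, Finset.mem_filter, Finset.mem_product, Finset.mem_range, Finset.mem_union,
    Finset.HasAntidiagonal.mem_antidiagonal]
  omega

theorem sum_idxLe_succ (r : ℕ) (f : ℕ × ℕ → ℝ) :
    ∑ p ∈ idxLe (r + 1), f p = ∑ p ∈ idxLe r, f p +
        ∑ p ∈ Finset.HasAntidiagonal.antidiagonal (r + 1), f p := by
  rw [idxLe_succ, Finset.sum_union]
  rw [Finset.disjoint_left]
  intro p hp hq
  simp only [idxLe, Finset.mem_filter] at hp
  rw [Finset.HasAntidiagonal.mem_antidiagonal] at hq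
  omega

theorem idxLe_zero : idxLe 0 = {(0, 0)} := by
  ext p
  simp only [idxLe, Finset.mem_filter, Finset.mem_product, Finset.mem_range, Finset.mem_singleton,
    Prod.ext_iff]
  omega

theorem sum_weight_snd (r : ℕ) :
    ∑ p ∈ idxLe r, (if p.2 = 0 then (1 / 2 : ℝ) else 1) = ((r : ℝ) + 1) ^ 2 / 2 := by
  induction r with
  | zero => simp [idxLe_zero]
  | succ r ih =>
    rw [sum_idxLe_succ, ih, Finset.Nat.sum_antidiagonal_succ']
    simp
    ring

theorem sum_weight_fst (r : ℕ) :
    ∑ p ∈ idxLe r, (if p.1 = 0 then (1 / 2 : ℝ) else 1) = ((r : ℝ) + 1) ^ 2 / 2 := by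
  induction r with
  | zero => simp [idxLe_zero]
  | succ r ih =>
    rw [sum_idxLe_succ, ih, Finset.Nat.sum_antidiagonal_succ]
    simp
    ring

theorem norm_add_four_sq_le (a b c d : ℂ) :
    ‖(a + b) + (c + d)‖ ^ 2 ≤ 4 * (‖a‖ ^ 2 + ‖b‖ ^ 2 + ‖c‖ ^ 2 + ‖d‖ ^ 2) := by
  have h : ‖(a + b) + (c + d)‖ ≤ ‖a‖ + ‖b‖ + (‖c‖ + ‖d‖) :=
    (norm_add_le _ _).trans (add_le_add (norm_add_le _ _) (norm_add_le _ _))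
  refine (pow_le_pow_left₀ (norm_nonneg _) h 2).trans ?_
  nlinarith [sq_nonneg (‖a‖ - ‖b‖), sq_nonneg (‖a‖ - ‖c‖), sq_nonneg (‖a‖ - ‖d‖),
    sq_nonneg (‖b‖ - ‖c‖), sq_nonneg (‖b‖ - ‖d‖), sq_nonneg (‖c‖ - ‖d‖)]

theorem integrableOn_swap {s t : Set ℝ} {f : ℝ × ℝ → ℝ} (h : IntegrableOn f (t ×ˢ s)) :
    IntegrableOn (fun p => f p.swap) (s ×ˢ t) := by
  have hm : MeasurePreserving (Prod.swap : ℝ × ℝ → ℝ × ℝ) volume volume :=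
    Measure.measurePreserving_swap
  have := (hm.integrableOn_comp_preimage
    (MeasurableEquiv.prodComm (α := ℝ) (β := ℝ)).measurableEmbedding (s := t ×ˢ s) (f := f)).2 h
  rwa [preimage_swap_prod] at this

theorem sobNormSq_rectSer_tail_le {κ a1 b1 a2 b2 m ν : ℝ} (hκ : 0 < κ) (h1 : a1 < b1) (h2 : a2 < b2)
    (hm : 0 < m) (hm1 : m ≤ b1 - a1) (hm2 : m ≤ b2 - a2) (hν : Real.sqrt 2 ≤ ν) {r μ N : ℕ}
    (hrμ : r ≤ μ) (hN1 : ν ≤ N * π / (b1 - a1) / κ) (hN2 : ν ≤ N * π / (b2 - a2) / κ)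
    {cB cT cL cR : ℕ → ℂ} {TB TT TL TR : ℝ}
    (hB : Summable fun n => ‖cB n‖) (hT : Summable fun n => ‖cT n‖)
    (hL : Summable fun n => ‖cL n‖) (hR : Summable fun n => ‖cR n‖)
    (bB : ∀ F : Finset ℕ, (∀ n ∈ F, 1 ≤ n) →
      ∑ n ∈ F, (b1 - a1) / 2 * ‖cB n‖ ^ 2 * (n * π / (b1 - a1)) ^ (2 * μ) ≤ TB)
    (bT : ∀ F : Finset ℕ, (∀ n ∈ F, 1 ≤ n) →
      ∑ n ∈ F, (b1 - a1) / 2 * ‖cT n‖ ^ 2 * (n * π / (b1 - a1)) ^ (2 * μ) ≤ TT)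
    (bL : ∀ F : Finset ℕ, (∀ n ∈ F, 1 ≤ n) →
      ∑ n ∈ F, (b2 - a2) / 2 * ‖cL n‖ ^ 2 * (n * π / (b2 - a2)) ^ (2 * μ) ≤ TL)
    (bR : ∀ F : Finset ℕ, (∀ n ∈ F, 1 ≤ n) →
      ∑ n ∈ F, (b2 - a2) / 2 * ‖cR n‖ ^ 2 * (n * π / (b2 - a2)) ^ (2 * μ) ≤ TR)
    {f : ℝ × ℝ → ℂ} (hf : EqOn f (rectSer κ a1 b1 a2 b2 (tailCoef N cB) (tailCoef N cT)
      (tailCoef N cL) (tailCoef N cR) 0 0) (Ioo a1 b1 ×ˢ Ioo a2 b2)) :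
    sobNormSq κ r (Ioo a1 b1 ×ˢ Ioo a2 b2) f ≤
      2 * ((r : ℝ) + 1) ^ 2 * decay κ m ν r μ * ((κ ^ (2 * μ))⁻¹ * (TB + TT + TL + TR)) := by
  have hUm : MeasurableSet (Ioo a1 b1 ×ˢ Ioo a2 b2) := measurableSet_Ioo.prod measurableSet_Ioo
  have hjet := rectSer_isJet hκ h1 h2 (summable_tailCoef N hB) (summable_tailCoef N hT)
    (summable_tailCoef N hL) (summable_tailCoef N hR)
  set Y := decay κ m ν r μ
  set k := (κ ^ (2 * μ))⁻¹
  have key : ∀ p ∈ idxLe r, (κ ^ (2 * (p.1 + p.2)))⁻¹ *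
      ∫ x in Ioo a1 b1 ×ˢ Ioo a2 b2, ‖pdM p.1 p.2 f x‖ ^ 2 ≤
      4 * Y * k * ((if p.2 = 0 then 1 / 2 else 1) * (TB + TT) +
        (if p.1 = 0 then 1 / 2 else 1) * (TL + TR)) := by
    rintro ⟨i, j⟩ hp
    have hij : i + j ≤ r := (Finset.mem_filter.1 hp).2
    simp only
    obtain ⟨iB, eB⟩ := edge_tail_l2 κ a1 b1 a2 b2 (-1) b2 m ν hκ h1 h2 (oriented_neg _ _) hm hm2 hν
      r μ i j N hrμ hij hN1 cB hB TB bB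
    obtain ⟨iT, eT⟩ := edge_tail_l2 κ a1 b1 a2 b2 1 a2 m ν hκ h1 h2 (oriented_one _ _) hm hm2 hν
      r μ i j N hrμ hij hN1 cT hT TT bT
    obtain ⟨iL, eL⟩ := edge_tail_l2 κ a2 b2 a1 b1 (-1) b1 m ν hκ h2 h1 (oriented_neg _ _) hm hm1 hν
      r μ j i N hrμ (by omega) hN2 cL hL TL bL
    obtain ⟨iR, eR⟩ := edge_tail_l2 κ a2 b2 a1 b1 1 a1 m ν hκ h2 h1 (oriented_one _ _) hm hm1 hν
      r μ j i N hrμ (by omega) hN2 cR hR TR bR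
    rw [← setIntegral_swap] at eL eR
    replace iL := integrableOn_swap iL
    replace iR := integrableOn_swap iR
    rw [setIntegral_congr_fun hUm fun x hx =>
      by rw [hjet.pdM_eq (isOpen_Ioo.prod isOpen_Ioo) hf i j hx]]
    have iBT := iB.add iT
    have iBTL := iBT.add iL
    have iall := iBTL.add iR
    have hle : ∫ x in Ioo a1 b1 ×ˢ Ioo a2 b2, ‖rectSer κ a1 b1 a2 b2 (tailCoef N cB) (tailCoef N cT)
        (tailCoef N cL) (tailCoef N cR) i j x‖ ^ 2 ≤ _ :=
      integral_mono_of_nonneg (Filter.Eventually.of_forall fun x => by positivity)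
        (iall.const_mul 4) (Filter.Eventually.of_forall fun x => norm_add_four_sq_le _ _ _ _)
    rw [integral_const_mul] at hle
    have hsum := integral_add iBTL iR
    have hsum2 := integral_add iBT iL
    have hsum3 := integral_add iB iT
    simp only [Pi.add_apply] at hle hsum hsum2 hsum3
    rw [hsum, hsum2, hsum3] at hle
    rw [inv_mul_le_iff₀ (by positivity)]
    rw [add_comm j i] at eL eR
    refine hle.trans ?_
    linarith [eB, eT, eL, eR]
  unfold sobNormSq
  refine (Finset.sum_le_sum key).trans (le_of_eq ?_)
  rw [← Finset.mul_sum, Finset.sum_add_distrib, ← Finset.sum_mul, ← Finset.sum_mul, sum_weight_snd,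
    sum_weight_fst]
  ring

/-- Sine coefficients of the trace on a horizontal edge. -/
def hCoef (h1 h2 : ℝ) (u : ℝ × ℝ → ℂ) (e : ℤ × ℤ) (n : ℕ) : ℂ :=
  trigCoef ((e.1 : ℝ) * h1) (((e.1 : ℝ) + 1) * h1) 0 (fun t => u (t, (e.2 : ℝ) * h2)) n

/-- Sine coefficients of the trace on a vertical edge. -/
def vCoef (h1 h2 : ℝ) (u : ℝ × ℝ → ℂ) (e : ℤ × ℤ) (n : ℕ) : ℂ :=
  trigCoef ((e.2 : ℝ) * h2) (((e.2 : ℝ) + 1) * h2) 0 (fun t => u ((e.1 : ℝ) * h1, t)) n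

/-- Squared `L²` norm of the `μ`-th derivative of the trace on a horizontal edge. -/
def hSemi (h1 h2 : ℝ) (μ : ℕ) (u : ℝ × ℝ → ℂ) (e : ℤ × ℤ) : ℝ :=
  ∫ t in ((e.1 : ℝ) * h1)..(((e.1 : ℝ) + 1) * h1),
    ‖iteratedDerivWithin μ (fun t => u (t, (e.2 : ℝ) * h2))
      (Icc ((e.1 : ℝ) * h1) (((e.1 : ℝ) + 1) * h1)) t‖ ^ 2

/-- Squared `L²` norm of the `μ`-th derivative of the trace on a vertical edge. -/
def vSemi (h1 h2 : ℝ) (μ : ℕ) (u : ℝ × ℝ → ℂ) (e : ℤ × ℤ) : ℝ :=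
  ∫ t in ((e.2 : ℝ) * h2)..(((e.2 : ℝ) + 1) * h2),
    ‖iteratedDerivWithin μ (fun t => u ((e.1 : ℝ) * h1, t))
      (Icc ((e.2 : ℝ) * h2) (((e.2 : ℝ) + 1) * h2)) t‖ ^ 2

/-- The edge-based approximation obtained by truncating the sine expansions of all traces. -/
def edgeApprox (κ h1 h2 : ℝ) (cells : Finset (ℤ × ℤ)) (Ne : ℕ) (u : ℝ × ℝ → ℂ) : ℝ × ℝ → ℂ :=
  (∑ e ∈ hEdges cells, ∑ n ∈ Finset.Icc 1 Ne, hCoef h1 h2 u e n • phiEdgeH κ h1 h2 cells e n) +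
    ∑ e ∈ vEdges cells, ∑ n ∈ Finset.Icc 1 Ne, vCoef h1 h2 u e n • phiEdgeV κ h1 h2 cells e n

theorem edgeApprox_mem (κ h1 h2 : ℝ) (cells : Finset (ℤ × ℤ)) (Ne : ℕ) (u : ℝ × ℝ → ℂ) :
    edgeApprox κ h1 h2 cells Ne u ∈ edgeSpace κ h1 h2 cells Ne := by
  refine Submodule.add_mem _ (Submodule.sum_mem _ fun e he => Submodule.sum_mem _ fun n hn =>
    Submodule.smul_mem _ _ (Submodule.subset_span (Or.inl ⟨e, he, n, ?_, ?_, rfl⟩)))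
    (Submodule.sum_mem _ fun e he => Submodule.sum_mem _ fun n hn =>
    Submodule.smul_mem _ _ (Submodule.subset_span (Or.inr ⟨e, he, n, ?_, ?_, rfl⟩)))
  all_goals first | exact (Finset.mem_Icc.1 hn).1 | exact (Finset.mem_Icc.1 hn).2

theorem phiHat_eq {κ a b a2 b2 σ e s : ℝ} (hκ : 0 < κ) (x y : ℝ) (n : ℕ) (hs : s = σ * (y - e)) :
    phiHat κ (b - a) (b2 - a2) n (x - a, s) =
      sineD a b 0 n x * normalD κ (b - a) (b2 - a2) σ e 0 n y := by
  subst hs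
  have h1 : κ * nuHat κ (b - a) n = n * π / (b - a) := by
    unfold nuHat
    rw [← mul_div_assoc, mul_div_mul_left _ _ hκ.ne']
  simp only [phiHat, sineD, normalD, modeD, modeFreq, trigOn, trig, h1, pow_zero, one_mul,
    CharP.cast_eq_zero, zero_mul, add_zero]
  push_cast
  rw [mul_div_assoc]
  congr 3 <;> ring

theorem edgeSer_sub_head {κ a b a2 b2 σ e : ℝ} (hκ : 0 < κ) (hab : a < b) (hab2 : a2 < b2)
    (ho : Oriented a2 b2 σ e) (c : ℕ → ℂ) (hc : Summable fun n => ‖c n‖) (N : ℕ) (p : ℝ × ℝ)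
    (hp : p.2 ∈ Ioo a2 b2) :
    edgeSer κ a b (b2 - a2) σ e c 0 0 p - ∑ n ∈ Finset.Icc 1 N,
        c n * (sineD a b 0 n p.1 * normalD κ (b - a) (b2 - a2) σ e 0 n p.2) =
      edgeSer κ a b (b2 - a2) σ e (tailCoef N c) 0 0 p := by
  have s1 := edgeTerm_summable κ a b a2 b2 σ e hκ hab hab2 ho c hc 0 0 p.1 p.2 hp
  have s2 := edgeTerm_summable κ a b a2 b2 σ e hκ hab hab2 ho _ (summable_tailCoef N hc) 0 0 p.1 p.2
    hp
  rw [sub_eq_iff_eq_add', ← sub_eq_iff_eq_add]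
  unfold edgeSer
  rw [← s1.tsum_sub s2, tsum_eq_sum (s := Finset.Icc 1 N)]
  · refine Finset.sum_congr rfl fun n hn => ?_
    rw [tailCoef, if_neg (by rw [Finset.mem_Icc] at hn; omega)]
    ring
  · intro n hn
    by_cases h0 : n = 0
    · subst h0; simp [sineD_zero_mode]
    · rw [tailCoef, if_pos (by rw [Finset.mem_Icc] at hn; omega), sub_self]

theorem int_eq_of_mem {h x : ℝ} (hh : 0 < h) {m n : ℤ}
    (h1 : x ∈ Ioo ((m : ℝ) * h) (((m : ℝ) + 1) * h))
    (h2 : x ∈ Icc ((n : ℝ) * h) (((n : ℝ) + 1) * h)) : n = m := by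
  have e1 : (n : ℝ) < m + 1 := lt_of_mul_lt_mul_right (h2.1.trans_lt h1.2) hh.le
  have e2 : (m : ℝ) < n + 1 := lt_of_mul_lt_mul_right (h1.1.trans_le h2.2) hh.le
  have e1' : n < m + 1 := by exact_mod_cast e1
  have e2' : m < n + 1 := by exact_mod_cast e2
  omega

theorem cell_eq_of_mem {h1 h2 : ℝ} (hh1 : 0 < h1) (hh2 : 0 < h2) {c d : ℤ × ℤ} {x : ℝ × ℝ}
    (hc : x ∈ cellO h1 h2 c) (hd : x ∈ cellC h1 h2 d) : d = c :=
  Prod.ext (int_eq_of_mem hh1 hc.1 hd.1) (int_eq_of_mem hh2 hc.2 hd.2)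

theorem cellO_subset (h1 h2 : ℝ) (c : ℤ × ℤ) : cellO h1 h2 c ⊆ cellC h1 h2 c :=
  prod_mono Ioo_subset_Icc_self Ioo_subset_Icc_self

section cell

variable {κ h1 h2 : ℝ} {cells : Finset (ℤ × ℤ)} {c : ℤ × ℤ} {x : ℝ × ℝ}

theorem phiEdgeH_of_mem (hh1 : 0 < h1) (hh2 : 0 < h2) (hc : c ∈ cells) (hx : x ∈ cellO h1 h2 c)
    (e : ℤ × ℤ) (n : ℕ) : phiEdgeH κ h1 h2 cells e n x =
      if e = c then phiHat κ h1 h2 n (x.1 - (c.1 : ℝ) * h1, -1 * (x.2 - ((c.2 : ℝ) + 1) * h2))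
      else if e = (c.1, c.2 + 1) then
        phiHat κ h1 h2 n (x.1 - (c.1 : ℝ) * h1, 1 * (x.2 - (c.2 : ℝ) * h2)) else 0 := by
  have hxC := cellO_subset h1 h2 c hx
  unfold phiEdgeH
  by_cases h : e = c
  · subst h
    rw [if_pos ⟨hc, hxC⟩, if_pos rfl]
    congr 2; ring
  · rw [if_neg (fun hh => h (cell_eq_of_mem hh1 hh2 hx hh.2)), if_neg h]
    by_cases h' : e = (c.1, c.2 + 1)
    · subst h'
      have : (((c.1, c.2 + 1) : ℤ × ℤ).1, ((c.1, c.2 + 1) : ℤ × ℤ).2 - 1) = c := by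
        ext <;> simp
      rw [this, if_pos ⟨hc, hxC⟩, if_pos rfl]
      congr 2; push_cast; ring
    · rw [if_neg, if_neg h']
      rintro ⟨-, hd⟩
      have := cell_eq_of_mem hh1 hh2 hx hd
      exact h' (by rw [← this]; ext <;> simp)

theorem phiEdgeV_of_mem (hh1 : 0 < h1) (hh2 : 0 < h2) (hc : c ∈ cells) (hx : x ∈ cellO h1 h2 c)
    (e : ℤ × ℤ) (n : ℕ) : phiEdgeV κ h1 h2 cells e n x =
      if e = c then phiHat κ h2 h1 n (x.2 - (c.2 : ℝ) * h2, -1 * (x.1 - ((c.1 : ℝ) + 1) * h1))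
      else if e = (c.1 + 1, c.2) then
        phiHat κ h2 h1 n (x.2 - (c.2 : ℝ) * h2, 1 * (x.1 - (c.1 : ℝ) * h1)) else 0 := by
  have hxC := cellO_subset h1 h2 c hx
  unfold phiEdgeV
  by_cases h : e = c
  · subst h
    rw [if_pos ⟨hc, hxC⟩, if_pos rfl]
    congr 2; ring
  · rw [if_neg (fun hh => h (cell_eq_of_mem hh1 hh2 hx hh.2)), if_neg h]
    by_cases h' : e = (c.1 + 1, c.2)
    · subst h'
      have : (((c.1 + 1, c.2) : ℤ × ℤ).1 - 1, ((c.1 + 1, c.2) : ℤ × ℤ).2) = c := by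
        ext <;> simp
      rw [this, if_pos ⟨hc, hxC⟩, if_pos rfl]
      congr 2; push_cast; ring
    · rw [if_neg, if_neg h']
      rintro ⟨-, hd⟩
      have := cell_eq_of_mem hh1 hh2 hx hd
      exact h' (by rw [← this]; ext <;> simp)

theorem mem_hEdges_bottom (hc : c ∈ cells) : c ∈ hEdges cells := Finset.mem_union_left _ hc

theorem mem_hEdges_top (hc : c ∈ cells) : (c.1, c.2 + 1) ∈ hEdges cells :=
  Finset.mem_union_right _ (Finset.mem_image_of_mem _ hc)

theorem mem_vEdges_left (hc : c ∈ cells) : c ∈ vEdges cells := Finset.mem_union_left _ hc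

theorem mem_vEdges_right (hc : c ∈ cells) : (c.1 + 1, c.2) ∈ vEdges cells :=
  Finset.mem_union_right _ (Finset.mem_image_of_mem _ hc)

end cell

/-- The superposition of the four trace series of a mesh cell. -/
def cellSer (κ h1 h2 : ℝ) (u : ℝ × ℝ → ℂ) (c : ℤ × ℤ) (g : (ℕ → ℂ) → ℕ → ℂ) :
    ℕ → ℕ → ℝ × ℝ → ℂ :=
  rectSer κ ((c.1 : ℝ) * h1) (((c.1 : ℝ) + 1) * h1) ((c.2 : ℝ) * h2) (((c.2 : ℝ) + 1) * h2)
    (g (hCoef h1 h2 u c)) (g (hCoef h1 h2 u (c.1, c.2 + 1)))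
    (g (vCoef h1 h2 u c)) (g (vCoef h1 h2 u (c.1 + 1, c.2)))

section cell

variable {κ h1 h2 : ℝ} {cells : Finset (ℤ × ℤ)} {Ω : Set (ℝ × ℝ)} {N M : ℕ} {u : ℝ × ℝ → ℂ}

theorem mul_lt_succ_mul {h : ℝ} (hh : 0 < h) (m : ℝ) : m * h < (m + 1) * h := by nlinarith

theorem succ_mul_sub (h m : ℝ) : (m + 1) * h - m * h = h := by ring

theorem SGlob.summable_hCoef (hu : SGlob κ h1 h2 cells Ω N M u) (hh1 : 0 < h1) (hN : 1 ≤ N)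
    (hM : 1 ≤ M) {e : ℤ × ℤ} (he : e ∈ hEdges cells) : Summable fun n => ‖hCoef h1 h2 u e n‖ :=
  summable_trigCoef _ _ (mul_lt_succ_mul hh1 _) N M hN hM _ (hu.htraceReg e he) (hu.hend e he)

theorem SGlob.summable_vCoef (hu : SGlob κ h1 h2 cells Ω N M u) (hh2 : 0 < h2) (hN : 1 ≤ N)
    (hM : 1 ≤ M) {e : ℤ × ℤ} (he : e ∈ vEdges cells) : Summable fun n => ‖vCoef h1 h2 u e n‖ :=
  summable_trigCoef _ _ (mul_lt_succ_mul hh2 _) N M hN hM _ (hu.vtraceReg e he) (hu.vend e he)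

theorem SGlob.tsum_hCoef (hu : SGlob κ h1 h2 cells Ω N M u) (hh1 : 0 < h1) (hN : 1 ≤ N)
    (hM : 1 ≤ M) {e : ℤ × ℤ} (he : e ∈ hEdges cells) :
    ∀ x ∈ Icc ((e.1 : ℝ) * h1) (((e.1 : ℝ) + 1) * h1), ∑' n, hCoef h1 h2 u e n *
      (trigOn ((e.1 : ℝ) * h1) (((e.1 : ℝ) + 1) * h1) 0 n x : ℂ) = u (x, (e.2 : ℝ) * h2) := by
  have := hu.hend e he 0 (by omega)
  simp only [mul_zero, iteratedDerivWithin_zero] at this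
  exact hasSum_sine _ _ (mul_lt_succ_mul hh1 _) _ (hu.htraceReg e he).continuousOn this.1 this.2
    (hu.summable_hCoef hh1 hN hM he)

theorem SGlob.tsum_vCoef (hu : SGlob κ h1 h2 cells Ω N M u) (hh2 : 0 < h2) (hN : 1 ≤ N)
    (hM : 1 ≤ M) {e : ℤ × ℤ} (he : e ∈ vEdges cells) :
    ∀ x ∈ Icc ((e.2 : ℝ) * h2) (((e.2 : ℝ) + 1) * h2), ∑' n, vCoef h1 h2 u e n *
      (trigOn ((e.2 : ℝ) * h2) (((e.2 : ℝ) + 1) * h2) 0 n x : ℂ) = u ((e.1 : ℝ) * h1, x) := by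
  have := hu.vend e he 0 (by omega)
  simp only [mul_zero, iteratedDerivWithin_zero] at this
  exact hasSum_sine _ _ (mul_lt_succ_mul hh2 _) _ (hu.vtraceReg e he).continuousOn this.1 this.2
    (hu.summable_vCoef hh2 hN hM he)

theorem SGlob.eqOn_cellSer (hu : SGlob κ h1 h2 cells Ω N M u) (hT : IsTessellation h1 h2 cells Ω)
    (hκ : 0 < κ) (hh1 : 0 < h1) (hh2 : 0 < h2) (hA : A0cond κ h1 h2) (hN : 1 ≤ N) (hM : 1 ≤ M)
    {c : ℤ × ℤ} (hc : c ∈ cells) :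
    EqOn u (cellSer κ h1 h2 u c id 0 0) (cellC h1 h2 c) := by
  have hcont : ContinuousOn u (cellC h1 h2 c) := hu.cont.mono (by
    rw [hT.2.2]; exact subset_biUnion_of_mem (u := fun c => cellC h1 h2 c) hc)
  refine eq_rectSer hκ (mul_lt_succ_mul hh1 _) (mul_lt_succ_mul hh2 _)
    (by rw [succ_mul_sub, succ_mul_sub]; exact hA)
    (hu.summable_hCoef hh1 hN hM (mem_hEdges_bottom hc))
    (hu.summable_hCoef hh1 hN hM (mem_hEdges_top hc))
    (hu.summable_vCoef hh2 hN hM (mem_vEdges_left hc))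
    (hu.summable_vCoef hh2 hN hM (mem_vEdges_right hc))
    u hcont (hu.helm c hc) ?_ ?_ ?_ ?_
  · exact hu.tsum_hCoef hh1 hN hM (mem_hEdges_bottom hc)
  · have := hu.tsum_hCoef hh1 hN hM (mem_hEdges_top hc)
    push_cast at this
    exact this
  · exact hu.tsum_vCoef hh2 hN hM (mem_vEdges_left hc)
  · have := hu.tsum_vCoef hh2 hN hM (mem_vEdges_right hc)
    push_cast at this
    exact this

theorem SGlob.cellSer_isJet (hu : SGlob κ h1 h2 cells Ω N M u) (hκ : 0 < κ) (hh1 : 0 < h1)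
    (hh2 : 0 < h2) (hN : 1 ≤ N) (hM : 1 ≤ M) {c : ℤ × ℤ} (hc : c ∈ cells) :
    IsJet (cellO h1 h2 c) (cellSer κ h1 h2 u c id) :=
  rectSer_isJet hκ (mul_lt_succ_mul hh1 _) (mul_lt_succ_mul hh2 _)
    (hu.summable_hCoef hh1 hN hM (mem_hEdges_bottom hc))
    (hu.summable_hCoef hh1 hN hM (mem_hEdges_top hc))
    (hu.summable_vCoef hh2 hN hM (mem_vEdges_left hc))
    (hu.summable_vCoef hh2 hN hM (mem_vEdges_right hc))

theorem phiEdgeH_bottom (hκ : 0 < κ) (hh1 : 0 < h1) (hh2 : 0 < h2) {c : ℤ × ℤ} (hc : c ∈ cells)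
    {x : ℝ × ℝ} (hx : x ∈ cellO h1 h2 c) (n : ℕ) : phiEdgeH κ h1 h2 cells c n x =
      sineD ((c.1 : ℝ) * h1) (((c.1 : ℝ) + 1) * h1) 0 n x.1 *
        normalD κ (((c.1 : ℝ) + 1) * h1 - (c.1 : ℝ) * h1) (((c.2 : ℝ) + 1) * h2 - (c.2 : ℝ) * h2)
          (-1) (((c.2 : ℝ) + 1) * h2) 0 n x.2 := by
  rw [phiEdgeH_of_mem hh1 hh2 hc hx, if_pos rfl, ← phiHat_eq hκ x.1 x.2 n rfl, succ_mul_sub,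
    succ_mul_sub]

theorem phiEdgeH_top (hκ : 0 < κ) (hh1 : 0 < h1) (hh2 : 0 < h2) {c : ℤ × ℤ} (hc : c ∈ cells)
    {x : ℝ × ℝ} (hx : x ∈ cellO h1 h2 c) (n : ℕ) : phiEdgeH κ h1 h2 cells (c.1, c.2 + 1) n x =
      sineD ((c.1 : ℝ) * h1) (((c.1 : ℝ) + 1) * h1) 0 n x.1 *
        normalD κ (((c.1 : ℝ) + 1) * h1 - (c.1 : ℝ) * h1) (((c.2 : ℝ) + 1) * h2 - (c.2 : ℝ) * h2)
          1 ((c.2 : ℝ) * h2) 0 n x.2 := by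
  rw [phiEdgeH_of_mem hh1 hh2 hc hx, if_neg (by intro h; have := congrArg Prod.snd h; simp at this),
    if_pos rfl, ← phiHat_eq hκ x.1 x.2 n rfl, succ_mul_sub, succ_mul_sub]

theorem phiEdgeV_left (hκ : 0 < κ) (hh1 : 0 < h1) (hh2 : 0 < h2) {c : ℤ × ℤ} (hc : c ∈ cells)
    {x : ℝ × ℝ} (hx : x ∈ cellO h1 h2 c) (n : ℕ) : phiEdgeV κ h1 h2 cells c n x =
      sineD ((c.2 : ℝ) * h2) (((c.2 : ℝ) + 1) * h2) 0 n x.2 *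
        normalD κ (((c.2 : ℝ) + 1) * h2 - (c.2 : ℝ) * h2) (((c.1 : ℝ) + 1) * h1 - (c.1 : ℝ) * h1)
          (-1) (((c.1 : ℝ) + 1) * h1) 0 n x.1 := by
  rw [phiEdgeV_of_mem hh1 hh2 hc hx, if_pos rfl, ← phiHat_eq hκ x.2 x.1 n rfl, succ_mul_sub,
    succ_mul_sub]

theorem phiEdgeV_right (hκ : 0 < κ) (hh1 : 0 < h1) (hh2 : 0 < h2) {c : ℤ × ℤ} (hc : c ∈ cells)
    {x : ℝ × ℝ} (hx : x ∈ cellO h1 h2 c) (n : ℕ) : phiEdgeV κ h1 h2 cells (c.1 + 1, c.2) n x =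
      sineD ((c.2 : ℝ) * h2) (((c.2 : ℝ) + 1) * h2) 0 n x.2 *
        normalD κ (((c.2 : ℝ) + 1) * h2 - (c.2 : ℝ) * h2) (((c.1 : ℝ) + 1) * h1 - (c.1 : ℝ) * h1)
          1 ((c.1 : ℝ) * h1) 0 n x.1 := by
  rw [phiEdgeV_of_mem hh1 hh2 hc hx, if_neg (by intro h; have := congrArg Prod.fst h; simp at this),
    if_pos rfl, ← phiHat_eq hκ x.2 x.1 n rfl, succ_mul_sub, succ_mul_sub]

theorem edgeApprox_apply (hh1 : 0 < h1) (hh2 : 0 < h2) {c : ℤ × ℤ} (hc : c ∈ cells)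
    {x : ℝ × ℝ} (hx : x ∈ cellO h1 h2 c) (Ne : ℕ) :
    edgeApprox κ h1 h2 cells Ne u x =
      (∑ n ∈ Finset.Icc 1 Ne, hCoef h1 h2 u c n * phiEdgeH κ h1 h2 cells c n x +
        ∑ n ∈ Finset.Icc 1 Ne, hCoef h1 h2 u (c.1, c.2 + 1) n *
          phiEdgeH κ h1 h2 cells (c.1, c.2 + 1) n x) +
      (∑ n ∈ Finset.Icc 1 Ne, vCoef h1 h2 u c n * phiEdgeV κ h1 h2 cells c n x +
        ∑ n ∈ Finset.Icc 1 Ne, vCoef h1 h2 u (c.1 + 1, c.2) n *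
          phiEdgeV κ h1 h2 cells (c.1 + 1, c.2) n x) := by
  simp only [edgeApprox, Pi.add_apply, Finset.sum_apply, Pi.smul_apply, smul_eq_mul]
  congr 1
  · refine Finset.sum_eq_add c (c.1, c.2 + 1)
      (by intro h; have := congrArg Prod.snd h; simp at this) (fun e _ he => ?_)
      (fun h => absurd (mem_hEdges_bottom hc) h) (fun h => absurd (mem_hEdges_top hc) h)
    refine Finset.sum_eq_zero fun n _ => ?_
    rw [phiEdgeH_of_mem hh1 hh2 hc hx, if_neg he.1, if_neg he.2, mul_zero]
  · refine Finset.sum_eq_add c (c.1 + 1, c.2)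
      (by intro h; have := congrArg Prod.fst h; simp at this) (fun e _ he => ?_)
      (fun h => absurd (mem_vEdges_left hc) h) (fun h => absurd (mem_vEdges_right hc) h)
    refine Finset.sum_eq_zero fun n _ => ?_
    rw [phiEdgeV_of_mem hh1 hh2 hc hx, if_neg he.1, if_neg he.2, mul_zero]

theorem SGlob.sub_edgeApprox_eqOn (hu : SGlob κ h1 h2 cells Ω N M u)
    (hT : IsTessellation h1 h2 cells Ω)
    (hκ : 0 < κ) (hh1 : 0 < h1) (hh2 : 0 < h2) (hA : A0cond κ h1 h2) (hN : 1 ≤ N) (hM : 1 ≤ M)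
    {c : ℤ × ℤ} (hc : c ∈ cells) (Ne : ℕ) :
    EqOn (u - edgeApprox κ h1 h2 cells Ne u) (cellSer κ h1 h2 u c (tailCoef Ne) 0 0)
      (cellO h1 h2 c) := by
  intro x hx
  rw [Pi.sub_apply, hu.eqOn_cellSer hT hκ hh1 hh2 hA hN hM hc (cellO_subset _ _ _ hx),
    edgeApprox_apply hh1 hh2 hc hx]
  simp_rw [phiEdgeH_bottom hκ hh1 hh2 hc hx, phiEdgeH_top hκ hh1 hh2 hc hx,
    phiEdgeV_left hκ hh1 hh2 hc hx, phiEdgeV_right hκ hh1 hh2 hc hx]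
  have l1 := mul_lt_succ_mul hh1 (c.1 : ℝ)
  have l2 := mul_lt_succ_mul hh2 (c.2 : ℝ)
  have e1 := edgeSer_sub_head hκ l1 l2 (oriented_neg _ _) _
    (hu.summable_hCoef hh1 hN hM (mem_hEdges_bottom hc)) Ne x hx.2
  have e2 := edgeSer_sub_head hκ l1 l2 (oriented_one _ _) _
    (hu.summable_hCoef hh1 hN hM (mem_hEdges_top hc)) Ne x hx.2
  have e3 := edgeSer_sub_head hκ l2 l1 (oriented_neg _ _) _
    (hu.summable_vCoef hh2 hN hM (mem_vEdges_left hc)) Ne x.swap hx.1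
  have e4 := edgeSer_sub_head hκ l2 l1 (oriented_one _ _) _
    (hu.summable_vCoef hh2 hN hM (mem_vEdges_right hc)) Ne x.swap hx.1
  simp only [cellSer, rectSer, id]
  rw [← e1, ← e2, ← e3, ← e4]
  simp only [Prod.fst_swap, Prod.snd_swap]
  ring

/-- The error of the edge-based approximation on one cell, in terms of the traces. -/
theorem SGlob.cell_error (hu : SGlob κ h1 h2 cells Ω N M u)
    (hT : IsTessellation h1 h2 cells Ω)
    (hκ : 0 < κ) (hh1 : 0 < h1) (hh2 : 0 < h2) (hA : A0cond κ h1 h2) (hN : 1 ≤ N) (hM : 1 ≤ M)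
    {r μ Ne : ℕ} (hrμ : r ≤ μ) (hμ : μ ≤ min (2 * N) M)
    (hnu : Real.sqrt 2 ≤ (Ne : ℝ) * π / (κ * max h1 h2)) {c : ℤ × ℤ} (hc : c ∈ cells) :
    sobNormSq κ r (cellO h1 h2 c) (u - edgeApprox κ h1 h2 cells Ne u) ≤
      2 * ((r : ℝ) + 1) ^ 2 * decay κ (min h1 h2) ((Ne : ℝ) * π / (κ * max h1 h2)) r μ *
        ((κ ^ (2 * μ))⁻¹ * (hSemi h1 h2 μ u c + hSemi h1 h2 μ u (c.1, c.2 + 1) +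
          vSemi h1 h2 μ u c + vSemi h1 h2 μ u (c.1 + 1, c.2))) := by
  have l1 := mul_lt_succ_mul hh1 (c.1 : ℝ)
  have l2 := mul_lt_succ_mul hh2 (c.2 : ℝ)
  have hν : ∀ {h}, 0 < h → h ≤ max h1 h2 → (Ne : ℝ) * π / (κ * max h1 h2) ≤ Ne * π / h / κ := by
    intro h h0 hle
    rw [div_div, mul_comm h κ]
    gcongr
  have hμ1 := hμ.trans (min_le_left _ _)
  have hμ2 := hμ.trans (min_le_right _ _)
  have bh := fun {e} (he : e ∈ hEdges cells) =>
      trigCoef_sum_le _ _ (mul_lt_succ_mul hh1 (e.1 : ℝ)) N M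
    _ (hu.htraceReg e he) (hu.hend e he) μ hμ1 hμ2
  have bv := fun {e} (he : e ∈ vEdges cells) =>
      trigCoef_sum_le _ _ (mul_lt_succ_mul hh2 (e.2 : ℝ)) N M
    _ (hu.vtraceReg e he) (hu.vend e he) μ hμ1 hμ2
  refine sobNormSq_rectSer_tail_le hκ l1 l2 (lt_min hh1 hh2)
    (by rw [succ_mul_sub]; exact min_le_left _ _) (by rw [succ_mul_sub]; exact min_le_right _ _)
    hnu hrμ (by rw [succ_mul_sub]; exact hν hh1 (le_max_left _ _))
    (by rw [succ_mul_sub]; exact hν hh2 (le_max_right _ _))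
    (hu.summable_hCoef hh1 hN hM (mem_hEdges_bottom hc))
    (hu.summable_hCoef hh1 hN hM (mem_hEdges_top hc))
    (hu.summable_vCoef hh2 hN hM (mem_vEdges_left hc))
    (hu.summable_vCoef hh2 hN hM (mem_vEdges_right hc))
    (bh (mem_hEdges_bottom hc)) (bh (mem_hEdges_top hc))
    (bv (mem_vEdges_left hc)) (bv (mem_vEdges_right hc))
    (hu.sub_edgeApprox_eqOn hT hκ hh1 hh2 hA hN hM hc Ne)

end cell

theorem rpow_sub_add_half_sq {ν : ℝ} (hν : 0 < ν) {r μ : ℕ} (h : r ≤ μ) :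
    (ν ^ ((r : ℝ) - ((μ : ℝ) + 1 / 2))) ^ 2 = (ν ^ (2 * (μ - r) + 1))⁻¹ := by
  rw [← Real.rpow_natCast, ← Real.rpow_mul hν.le, ← Real.rpow_natCast, ← Real.rpow_neg hν.le]
  congr 1
  push_cast [Nat.cast_sub h]
  ring

theorem decay_eq {κ m ν : ℝ} (hν : 0 < ν) {r μ : ℕ} (h : r ≤ μ) :
    decay κ m ν r μ =
      Real.sqrt 2 / (κ * Real.tanh (κ * m)) * (ν ^ ((r : ℝ) - ((μ : ℝ) + 1 / 2))) ^ 2 := by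
  rw [rpow_sub_add_half_sq hν h, decay, div_mul_eq_div_div, div_eq_mul_inv _ (ν ^ _)]

theorem decay_nonneg {κ m ν : ℝ} (hκ : 0 < κ) (hm : 0 < m) (hν : 0 < ν) (r μ : ℕ) :
    0 ≤ decay κ m ν r μ := by
  have := tanh_pos_of_pos (mul_pos hκ hm)
  unfold decay; positivity

theorem hSemi_nonneg {h1 : ℝ} (hh1 : 0 < h1) (h2 : ℝ) (μ : ℕ) (u : ℝ × ℝ → ℂ) (e : ℤ × ℤ) :
    0 ≤ hSemi h1 h2 μ u e :=
  intervalIntegral.integral_nonneg (mul_lt_succ_mul hh1 _).le fun _ _ => by positivity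

theorem vSemi_nonneg (h1 : ℝ) {h2 : ℝ} (hh2 : 0 < h2) (μ : ℕ) (u : ℝ × ℝ → ℂ) (e : ℤ × ℤ) :
    0 ≤ vSemi h1 h2 μ u e :=
  intervalIntegral.integral_nonneg (mul_lt_succ_mul hh2 _).le fun _ _ => by positivity

theorem sum_add_shift_le {f : ℤ × ℤ → ℝ} (hf : ∀ e, 0 ≤ f e) (cells : Finset (ℤ × ℤ))
    {g : ℤ × ℤ → ℤ × ℤ} (hg : Function.Injective g) :
    ∑ c ∈ cells, (f c + f (g c)) ≤ 2 * ∑ e ∈ cells ∪ cells.image g, f e := by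
  have e1 : ∑ c ∈ cells, f c ≤ ∑ e ∈ cells ∪ cells.image g, f e :=
    Finset.sum_le_sum_of_subset_of_nonneg Finset.subset_union_left fun _ _ _ => hf _
  have e2 : ∑ c ∈ cells, f (g c) ≤ ∑ e ∈ cells ∪ cells.image g, f e := by
    rw [← Finset.sum_image fun x _ y _ h => hg h]
    exact Finset.sum_le_sum_of_subset_of_nonneg Finset.subset_union_right fun _ _ _ => hf _
  rw [Finset.sum_add_distrib]
  linarith

/-- Every edge belongs to at most two cells. -/
theorem sum_cells_le_skelSemiSq {κ h1 h2 : ℝ} (hh1 : 0 < h1) (hh2 : 0 < h2)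
    (cells : Finset (ℤ × ℤ)) (μ : ℕ) (u : ℝ × ℝ → ℂ) (hκ : 0 < κ) :
    ∑ c ∈ cells, (κ ^ (2 * μ))⁻¹ * (hSemi h1 h2 μ u c + hSemi h1 h2 μ u (c.1, c.2 + 1) +
      vSemi h1 h2 μ u c + vSemi h1 h2 μ u (c.1 + 1, c.2)) ≤ 2 * skelSemiSq κ h1 h2 cells μ u := by
  have e1 := sum_add_shift_le (hSemi_nonneg hh1 h2 μ u) cells (g := fun c => (c.1, c.2 + 1))
    (fun a b h => by simpa [Prod.ext_iff] using h)
  have e2 := sum_add_shift_le (vSemi_nonneg h1 hh2 μ u) cells (g := fun c => (c.1 + 1, c.2))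
    (fun a b h => by simpa [Prod.ext_iff] using h)
  have e3 : skelSemiSq κ h1 h2 cells μ u = (κ ^ (2 * μ))⁻¹ *
      (∑ e ∈ hEdges cells, hSemi h1 h2 μ u e + ∑ e ∈ vEdges cells, vSemi h1 h2 μ u e) := by
    rw [mul_add, Finset.mul_sum, Finset.mul_sum]; rfl
  rw [e3, ← Finset.mul_sum, mul_left_comm]
  refine mul_le_mul_of_nonneg_left ?_ (by positivity)
  simp only [add_assoc, Finset.sum_add_distrib] at e1 e2 ⊢
  rw [hEdges, vEdges]
  linarith

theorem sInf_error_le {κ h1 h2 : ℝ} {cells : Finset (ℤ × ℤ)} {r Ne : ℕ} {u v : ℝ × ℝ → ℂ}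
    (hv : v ∈ edgeSpace κ h1 h2 cells Ne) {A Y : ℝ} (hA : 0 ≤ A)
    (h : brokenNormSq κ r h1 h2 cells (u - v) ≤ A ^ 2 * Y) :
    sInf {E : ℝ | ∃ v ∈ edgeSpace κ h1 h2 cells Ne,
      E = Real.sqrt (brokenNormSq κ r h1 h2 cells (u - v))} ≤ A * Real.sqrt Y := by
  have hb : BddBelow {E : ℝ | ∃ v ∈ edgeSpace κ h1 h2 cells Ne,
      E = Real.sqrt (brokenNormSq κ r h1 h2 cells (u - v))} := by
    refine ⟨0, ?_⟩
    rintro _ ⟨w, _, rfl⟩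
    exact Real.sqrt_nonneg _
  · refine (csInf_le hb ⟨v, hv, rfl⟩).trans ((Real.sqrt_le_sqrt h).trans_eq ?_)
    rw [Real.sqrt_mul (sq_nonneg A), Real.sqrt_sq hA]

theorem min_eq_max_div {h1 h2 : ℝ} (hh1 : 0 < h1) :
    max h1 h2 / (max h1 h2 / min h1 h2) = min h1 h2 :=
  div_div_cancel₀ (lt_max_of_lt_left hh1).ne'

theorem sqrt_two_pos_le {ν : ℝ} (h : Real.sqrt 2 ≤ ν) : 0 < ν :=
  (Real.sqrt_pos.2 (by norm_num)).trans_le h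

section bounds

variable {κ h1 h2 : ℝ} {cells : Finset (ℤ × ℤ)} {Ω : Set (ℝ × ℝ)} {N M : ℕ} {u : ℝ × ℝ → ℂ}

theorem SGlob.brokenNormSq_le (hu : SGlob κ h1 h2 cells Ω N M u)
    (hT : IsTessellation h1 h2 cells Ω)
    (hκ : 0 < κ) (hh1 : 0 < h1) (hh2 : 0 < h2) (hA : A0cond κ h1 h2) (hN : 1 ≤ N) (hM : 1 ≤ M)
    {r μ Ne : ℕ} (hrμ : r ≤ μ) (hμ : μ ≤ min (2 * N) M)
    (hnu : Real.sqrt 2 ≤ (Ne : ℝ) * π / (κ * max h1 h2)) {Y : ℝ}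
    (hY : ∑ c ∈ cells, (κ ^ (2 * μ))⁻¹ * (hSemi h1 h2 μ u c + hSemi h1 h2 μ u (c.1, c.2 + 1) +
      vSemi h1 h2 μ u c + vSemi h1 h2 μ u (c.1 + 1, c.2)) ≤ Y) :
    brokenNormSq κ r h1 h2 cells (u - edgeApprox κ h1 h2 cells Ne u) ≤
      2 * ((r : ℝ) + 1) ^ 2 * (Real.sqrt 2 / (κ * Real.tanh (κ * min h1 h2)) *
        (((Ne : ℝ) * π / (κ * max h1 h2)) ^ ((r : ℝ) - ((μ : ℝ) + 1 / 2))) ^ 2) * Y := by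
  have hν := sqrt_two_pos_le hnu
  refine (Finset.sum_le_sum fun c hc =>
    hu.cell_error hT hκ hh1 hh2 hA hN hM hrμ hμ hnu hc).trans ?_
  rw [← Finset.mul_sum, ← decay_eq hν hrμ]
  have := decay_nonneg hκ (lt_min hh1 hh2) hν r μ
  exact mul_le_mul_of_nonneg_left hY (by positivity)

theorem skelSemiSq_nonneg (hκ : 0 < κ) (hh1 : 0 < h1) (hh2 : 0 < h2) (μ : ℕ) :
    0 ≤ skelSemiSq κ h1 h2 cells μ u :=
  add_nonneg
    (Finset.sum_nonneg fun e _ => mul_nonneg (by positivity) (hSemi_nonneg hh1 h2 μ u e))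
    (Finset.sum_nonneg fun e _ => mul_nonneg (by positivity) (vSemi_nonneg h1 hh2 μ u e))

theorem SGlob.sInf_le_skelSemiSq (hu : SGlob κ h1 h2 cells Ω N M u)
    (hT : IsTessellation h1 h2 cells Ω)
    (hκ : 0 < κ) (hh1 : 0 < h1) (hh2 : 0 < h2) (hA : A0cond κ h1 h2) (hN : 1 ≤ N) (hM : 1 ≤ M)
    {r μ Ne : ℕ} (hrμ : r ≤ μ) (hμ : μ ≤ min (2 * N) M)
    (hnu : Real.sqrt 2 ≤ (Ne : ℝ) * π / (κ * max h1 h2)) :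
    sInf {E : ℝ | ∃ v ∈ edgeSpace κ h1 h2 cells Ne,
          E = Real.sqrt (brokenNormSq κ r h1 h2 cells (u - v))} ≤
        (2 * Real.sqrt 2 * (r + 1) /
            Real.sqrt (κ * Real.tanh (κ * max h1 h2 / (max h1 h2 / min h1 h2)))) *
          ((Ne : ℝ) * π / (κ * max h1 h2)) ^ ((r : ℝ) - ((μ : ℝ) + 1 / 2)) *
          Real.sqrt (skelSemiSq κ h1 h2 cells μ u) := by
  have hν := sqrt_two_pos_le hnu
  have ht := tanh_pos_of_pos (mul_pos hκ (lt_min hh1 hh2))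
  rw [mul_div_assoc κ, min_eq_max_div hh1]
  refine sInf_error_le (edgeApprox_mem κ h1 h2 cells Ne u) (by positivity) ?_
  refine (hu.brokenNormSq_le hT hκ hh1 hh2 hA hN hM hrμ hμ hnu
    (sum_cells_le_skelSemiSq hh1 hh2 cells μ u hκ)).trans ?_
  have hS : 0 ≤ skelSemiSq κ h1 h2 cells μ u := skelSemiSq_nonneg hκ hh1 hh2 μ
  set T := κ * Real.tanh (κ * min h1 h2)
  have hT0 : 0 < T := by positivity
  have s2 : Real.sqrt 2 ≤ 2 := by
    rw [Real.sqrt_le_left (by norm_num)]; norm_num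
  have s22 : Real.sqrt 2 ^ 2 = 2 := Real.sq_sqrt (by norm_num)
  rw [mul_pow, div_pow, Real.sq_sqrt hT0.le, mul_pow, mul_pow, s22]
  calc _ = Real.sqrt 2 * (4 * (((r : ℝ) + 1) ^ 2 * (T⁻¹ *
      (((Ne : ℝ) * π / (κ * max h1 h2)) ^ ((r : ℝ) - ((μ : ℝ) + 1 / 2))) ^ 2 *
        skelSemiSq κ h1 h2 cells μ u))) := by ring
    _ ≤ 2 * (4 * (((r : ℝ) + 1) ^ 2 * (T⁻¹ *
      (((Ne : ℝ) * π / (κ * max h1 h2)) ^ ((r : ℝ) - ((μ : ℝ) + 1 / 2))) ^ 2 *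
        skelSemiSq κ h1 h2 cells μ u))) := by gcongr
    _ = _ := by ring

/-- Conclusion from a trace inequality on every cell. -/
theorem SGlob.sInf_le_of_trace (hu : SGlob κ h1 h2 cells Ω N M u)
    (hT : IsTessellation h1 h2 cells Ω)
    (hκ : 0 < κ) (hh1 : 0 < h1) (hh2 : 0 < h2) (hA : A0cond κ h1 h2) (hN : 1 ≤ N) (hM : 1 ≤ M)
    {r μ Ne : ℕ} (hrμ : r ≤ μ) (hμ : μ ≤ min (2 * N) M)
    (hnu : Real.sqrt 2 ≤ (Ne : ℝ) * π / (κ * max h1 h2))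
    (htr : ∀ c ∈ cells, (κ ^ (2 * μ))⁻¹ * (hSemi h1 h2 μ u c + hSemi h1 h2 μ u (c.1, c.2 + 1) +
      vSemi h1 h2 μ u c + vSemi h1 h2 μ u (c.1 + 1, c.2)) ≤
        5 * (max h1 h2 / min h1 h2 * max 1 (κ * max h1 h2) ^ 2 / max h1 h2) *
          sobNormSq κ (μ + 1) (cellO h1 h2 c) u) :
    sInf {E : ℝ | ∃ v ∈ edgeSpace κ h1 h2 cells Ne,
          E = Real.sqrt (brokenNormSq κ r h1 h2 cells (u - v))} ≤
        (8 * Real.sqrt (max h1 h2 / min h1 h2) * max 1 (κ * max h1 h2) /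
            Real.sqrt (κ * max h1 h2 *
              Real.tanh (κ * max h1 h2 / (max h1 h2 / min h1 h2)))) *
          (((r : ℝ) + 1) / 2) *
          ((Ne : ℝ) * π / (κ * max h1 h2)) ^ ((r : ℝ) - ((μ : ℝ) + 1 / 2)) *
          Real.sqrt (∑ c ∈ cells, sobNormSq κ (μ + 1) (cellO h1 h2 c) u) := by
  have hν := sqrt_two_pos_le hnu
  have hm := lt_min hh1 hh2
  have hH : 0 < max h1 h2 := lt_max_of_lt_left hh1
  have ht := tanh_pos_of_pos (mul_pos hκ hm)
  rw [mul_div_assoc κ, min_eq_max_div hh1]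
  refine sInf_error_le (edgeApprox_mem κ h1 h2 cells Ne u) (by positivity) ?_
  refine (hu.brokenNormSq_le hT hκ hh1 hh2 hA hN hM hrμ hμ hnu
    ((Finset.sum_le_sum htr).trans_eq (Finset.mul_sum ..).symm)).trans ?_
  have hS : 0 ≤ ∑ c ∈ cells, sobNormSq κ (μ + 1) (cellO h1 h2 c) u :=
    Finset.sum_nonneg fun c _ => Finset.sum_nonneg fun p _ =>
      mul_nonneg (by positivity) (integral_nonneg fun _ => by positivity)
  set T := Real.tanh (κ * min h1 h2)
  set S := ∑ c ∈ cells, sobNormSq κ (μ + 1) (cellO h1 h2 c) u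
  set P := ((Ne : ℝ) * π / (κ * max h1 h2)) ^ ((r : ℝ) - ((μ : ℝ) + 1 / 2))
  set m := min h1 h2
  set H := max h1 h2
  set X := max 1 (κ * H)
  have s2 : Real.sqrt 2 ≤ 8 / 5 := by
    rw [Real.sqrt_le_left (by norm_num)]; norm_num
  rw [mul_pow, mul_pow, div_pow, Real.sq_sqrt (by positivity), mul_pow, mul_pow,
    Real.sq_sqrt (by positivity)]
  calc _ = Real.sqrt 2 * (10 * (((r : ℝ) + 1) ^ 2 * (κ * T)⁻¹ * P ^ 2 *
        (H / m * X ^ 2 / H) * S)) := by ring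
    _ ≤ 8 / 5 * (10 * (((r : ℝ) + 1) ^ 2 * (κ * T)⁻¹ * P ^ 2 *
        (H / m * X ^ 2 / H) * S)) := by gcongr
    _ = _ := by field_simp; ring

end bounds

theorem deriv_eq_zero_of_notMem {ψ : ℝ → ℂ} {a b : ℝ} (hs : ∀ x, x ∉ Icc a b → ψ x = 0) :
    ∀ x, x ∉ Icc a b → deriv ψ x = 0 := by
  intro x hx
  have : ψ =ᶠ[nhds x] fun _ => 0 := by
    filter_upwards [isClosed_Icc.isOpen_compl.mem_nhds hx] with y hy using hs y hy
  rw [this.deriv_eq, deriv_const]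

theorem setIntegral_mul_iteratedDeriv {a b δ : ℝ} (hδ : 0 < δ) (F : ℕ → ℝ → ℂ) (μ : ℕ)
    (hF : ∀ i < μ, ∀ x ∈ Ioo a b, HasDerivAt (F i) (F (i + 1) x) x)
    (hc : ∀ i ≤ μ, ContinuousOn (F i) (Ioo a b)) {ψ : ℝ → ℂ} (hψ : ContDiff ℝ (⊤ : ℕ∞) ψ)
    (hs : ∀ x, x ∉ Icc (a + δ) (b - δ) → ψ x = 0) :
    ∫ x in Ioo a b, F μ x * ψ x = (-1) ^ μ * ∫ x in Ioo a b, F 0 x * iteratedDeriv μ ψ x := by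
  induction μ generalizing ψ with
  | zero => simp
  | succ μ ih =>
    have hd : ContDiff ℝ (⊤ : ℕ∞) (deriv ψ) := (contDiff_infty_iff_deriv.1 hψ).2
    have h1 := setIntegral_mul_deriv_eq a b (F μ) (F (μ + 1)) ψ (deriv ψ) (hF μ (by omega))
      (hc _ le_rfl) (fun x => ((contDiff_infty_iff_deriv.1 hψ).1 x).hasDerivAt)
          hd.continuous δ hδ hs
    have h2 := ih (fun i hi => hF i (by omega)) (fun i hi => hc i (by omega)) hd
      (deriv_eq_zero_of_notMem hs)
    rw [h1, ← iteratedDeriv_succ'] at h2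
    rw [pow_succ, mul_assoc, neg_one_mul, mul_neg, ← h2, neg_neg]

/-- A quadratic functional whose supremum over test functions is the squared `L²` norm. -/
def dualPair (a b : ℝ) (F ψ : ℝ → ℂ) : ℝ :=
  2 * (∫ x in Ioo a b, F x * ψ x).re - ∫ x in Ioo a b, ‖ψ x‖ ^ 2

theorem dualPair_le {a b δ : ℝ} (hδ : 0 < δ) {g ψ : ℝ → ℂ} (hg : ContinuousOn g (Ioo a b))
    (hψ : Continuous ψ) (hs : ∀ x, x ∉ Icc (a + δ) (b - δ) → ψ x = 0) :
    dualPair a b g ψ ≤ ∫ x in Icc (a + δ) (b - δ), ‖g x‖ ^ 2 := by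
  have hsub : Icc (a + δ) (b - δ) ⊆ Ioo a b := fun x hx => ⟨by linarith [hx.1], by linarith [hx.2]⟩
  have e1 : ∫ x in Ioo a b, g x * ψ x = ∫ x in Icc (a + δ) (b - δ), g x * ψ x :=
    setIntegral_eq_of_subset_of_forall_sdiff_eq_zero measurableSet_Ioo hsub
      fun x hx => by rw [hs x hx.2, mul_zero]
  have e2 : ∫ x in Ioo a b, ‖ψ x‖ ^ 2 = ∫ x in Icc (a + δ) (b - δ), ‖ψ x‖ ^ 2 :=
    setIntegral_eq_of_subset_of_forall_sdiff_eq_zero measurableSet_Ioo hsub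
      fun x hx => by rw [hs x hx.2]; simp
  have hg' := hg.mono hsub
  have i1 : IntegrableOn (fun x => g x * ψ x) (Icc (a + δ) (b - δ)) :=
    (hg'.mul hψ.continuousOn).integrableOn_compact isCompact_Icc
  have i2 : IntegrableOn (fun x => ‖ψ x‖ ^ 2) (Icc (a + δ) (b - δ)) :=
    (by fun_prop : Continuous fun x => ‖ψ x‖ ^ 2).continuousOn.integrableOn_compact isCompact_Icc
  have i3 : IntegrableOn (fun x => ‖g x‖ ^ 2) (Icc (a + δ) (b - δ)) :=
    (hg'.norm.pow 2).integrableOn_compact isCompact_Icc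
  have i1r : IntegrableOn (fun x => 2 * (g x * ψ x).re) (Icc (a + δ) (b - δ)) :=
    i1.re.const_mul 2
  have e3 : (∫ x in Icc (a + δ) (b - δ), g x * ψ x).re =
      ∫ x in Icc (a + δ) (b - δ), (g x * ψ x).re := (integral_re i1).symm
  rw [dualPair, e1, e2, e3, ← integral_const_mul, ← integral_sub i1r i2]
  refine integral_mono (i1r.sub i2) i3 fun x => ?_
  have h1 := (Complex.re_le_norm (g x * ψ x)).trans_eq (norm_mul _ _)
  simp only
  nlinarith [sq_nonneg (‖g x‖ - ‖ψ x‖)]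

theorem exists_contDiff_near {a b : ℝ} (hab : a ≤ b) {F : ℝ → ℂ} (hF : ContinuousOn F (Icc a b))
    {ε : ℝ} (hε : 0 < ε) :
    ∃ g : ℝ → ℂ, ContDiff ℝ (⊤ : ℕ∞) g ∧ ∀ x ∈ Icc a b, dist (g x) (F x) < ε := by
  have hu : UniformContinuous (IccExtend hab ((Icc a b).domRestrict F)) :=
    (CompactSpace.uniformContinuous_of_continuous hF.domRestrict).comp
      (LipschitzWith.projIcc hab).uniformContinuous
  obtain ⟨g, hg, h⟩ := hu.exists_contDiff_dist_le hε
  refine ⟨g, hg, fun x hx => ?_⟩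
  have := h x
  rwa [IccExtend_of_mem _ _ hx] at this

/-- Test functions which recover the squared `L²` norm of `F`. -/
theorem exists_dualPair_tendsto {a b : ℝ} (hab : a < b) {F : ℝ → ℂ}
    (hF : ContinuousOn F (Icc a b)) :
    ∃ ψ : ℕ → ℝ → ℂ, (∀ k, ContDiff ℝ (⊤ : ℕ∞) (ψ k)) ∧
      (∀ᶠ k : ℕ in Filter.atTop, ∃ δ > 0, ∀ x, x ∉ Icc (a + δ) (b - δ) → ψ k x = 0) ∧
      Filter.Tendsto (fun k => dualPair a b F (ψ k)) Filter.atTop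
        (nhds (∫ x in Ioo a b, ‖F x‖ ^ 2)) := by
  have hn : ∀ k : ℕ, (0 : ℝ) < 1 / ((k : ℝ) + 1) := fun k => by positivity
  have hF' : ContinuousOn (fun x => (starRingEnd ℂ) (F x)) (Icc a b) :=
    Complex.continuous_conj.comp_continuousOn hF
  choose g hg hgd using fun k => exists_contDiff_near hab.le hF' (hn k)
  obtain ⟨C, hC⟩ := isCompact_Icc.exists_bound_of_continuousOn hF
  have hbd : ∀ k, ∀ x ∈ Ioo a b, ‖(cut a b k x : ℂ) * g k x‖ ≤ C + 1 := by
    intro k x hx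
    have h1 := hgd k x (Ioo_subset_Icc_self hx)
    have h2 : 1 / ((k : ℝ) + 1) ≤ 1 := by
      rw [div_le_one (by positivity)]; linarith [(Nat.cast_nonneg k : (0 : ℝ) ≤ k)]
    have h3 := hC x (Ioo_subset_Icc_self hx)
    have h4 : ‖g k x‖ ≤ C + 1 := by
      have := norm_le_norm_add_norm_sub' (g k x) ((starRingEnd ℂ) (F x))
      rw [dist_eq_norm] at h1
      rw [RCLike.norm_conj] at this
      linarith
    rw [norm_mul, Complex.norm_real]
    calc _ ≤ 1 * ‖g k x‖ := by
          gcongr; exact cut_abs_le a b k x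
      _ ≤ _ := by rwa [one_mul]
  have hlim : ∀ x ∈ Ioo a b, Filter.Tendsto (fun k => (cut a b k x : ℂ) * g k x) Filter.atTop
      (nhds ((starRingEnd ℂ) (F x))) := by
    intro x hx
    have : Filter.Tendsto (fun k => g k x) Filter.atTop (nhds ((starRingEnd ℂ) (F x))) := by
      rw [tendsto_iff_dist_tendsto_zero]
      exact squeeze_zero (fun _ => dist_nonneg) (fun k => (hgd k x (Ioo_subset_Icc_self hx)).le)
        tendsto_one_div_add_atTop_nhds_zero_nat
    refine this.congr' ?_
    filter_upwards [cut_tendsto a b x hx] with k hk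
    rw [hk, Complex.ofReal_one, one_mul]
  have hsm : ∀ k, ContDiff ℝ (⊤ : ℕ∞) fun x => (cut a b k x : ℂ) * g k x := fun k =>
    (Complex.ofRealCLM.contDiff.comp (cut_contDiff a b k)).mul (hg k)
  have hfin : volume (Ioo a b) ≠ ⊤ := by simp
  have hFm : AEStronglyMeasurable F (volume.restrict (Ioo a b)) :=
    (hF.mono Ioo_subset_Icc_self).aestronglyMeasurable measurableSet_Ioo
  have t1 : Filter.Tendsto (fun k : ℕ => ∫ x in Ioo a b, F x * ((cut a b k x : ℂ) * g k x))
      Filter.atTop (nhds (∫ x in Ioo a b, F x * (starRingEnd ℂ) (F x))) := by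
    refine tendsto_integral_of_dominated_convergence (fun _ => C * (C + 1))
      (fun k => hFm.mul (hsm k).continuous.aestronglyMeasurable) (integrableOn_const hfin)
      (fun k => (ae_restrict_iff' measurableSet_Ioo).2 (Filter.Eventually.of_forall fun x hx => ?_))
      ((ae_restrict_iff' measurableSet_Ioo).2 (Filter.Eventually.of_forall fun x hx =>
        (hlim x hx).const_mul _))
    rw [norm_mul]
    have h3 := hC x (Ioo_subset_Icc_self hx)
    exact mul_le_mul h3 (hbd k x hx) (norm_nonneg _) ((norm_nonneg _).trans h3)
  have t2 : Filter.Tendsto (fun k : ℕ => ∫ x in Ioo a b, ‖(cut a b k x : ℂ) * g k x‖ ^ 2)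
      Filter.atTop (nhds (∫ x in Ioo a b, ‖(starRingEnd ℂ) (F x)‖ ^ 2)) := by
    refine tendsto_integral_of_dominated_convergence (fun _ => (C + 1) ^ 2)
      (fun k => ((hsm k).continuous.norm.pow 2).aestronglyMeasurable) (integrableOn_const hfin)
      (fun k => (ae_restrict_iff' measurableSet_Ioo).2 (Filter.Eventually.of_forall fun x hx => ?_))
      ((ae_restrict_iff' measurableSet_Ioo).2 (Filter.Eventually.of_forall fun x hx =>
        (hlim x hx).norm.pow 2))
    rw [norm_pow, norm_norm]
    exact pow_le_pow_left₀ (norm_nonneg _) (hbd k x hx) 2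
  refine ⟨fun k x => (cut a b k x : ℂ) * g k x, hsm, ?_, ?_⟩
  · obtain ⟨k0, hk0⟩ := exists_nat_ge (4 / (b - a))
    have hba := sub_pos.2 hab
    filter_upwards [Filter.eventually_ge_atTop (max k0 1)] with k hk
    have hk1 : (1 : ℝ) ≤ k := by exact_mod_cast (le_max_right _ _).trans hk
    have hk2 : (k0 : ℝ) ≤ k := by exact_mod_cast (le_max_left _ _).trans hk
    refine ⟨1 / k, by positivity, fun x hx => ?_⟩
    rw [cut_zero a b k ((div_le_iff₀ hba).1 (hk0.trans hk2)) x hx]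
    simp
  · have := (((Complex.continuous_re.tendsto _).comp t1).const_mul 2).sub t2
    have e : ∫ x in Ioo a b, F x * (starRingEnd ℂ) (F x) =
        ((∫ x in Ioo a b, ‖F x‖ ^ 2 : ℝ) : ℂ) := by
      rw [← integral_complex_ofReal]
      congr 1
      ext x
      rw [Complex.mul_conj, Complex.normSq_eq_norm_sq]
    rw [e, Complex.ofReal_re] at this
    simp only [RCLike.norm_conj] at this
    rw [two_mul, add_sub_cancel_right] at this
    exact this

/-- One-dimensional trace inequality. -/
theorem norm_sq_add_norm_sq_le {κ α β : ℝ} (hκ : 0 < κ) (hαβ : α < β) {g g' : ℝ → ℂ}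
    (hg : ∀ y ∈ Icc α β, HasDerivAt g (g' y) y) (hg' : ContinuousOn g' (Icc α β)) :
    ‖g α‖ ^ 2 + ‖g β‖ ^ 2 ≤
      ∫ y in α..β, ((2 / (β - α) + κ / 2) * ‖g y‖ ^ 2 + 2 / κ * ‖g' y‖ ^ 2) := by
  have hd := sub_pos.2 hαβ
  have hgc : ContinuousOn g (Icc α β) := fun y hy => (hg y hy).continuousAt.continuousWithinAt
  set w : ℝ → ℝ := fun y => (2 * y - α - β) / (β - α) with hw
  have hwd : ∀ y, HasDerivAt w (2 / (β - α)) y := by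
    intro y
    have := ((((hasDerivAt_id y).const_mul 2).sub_const α).sub_const β).div_const (β - α)
    simpa using this
  have hF := fun y hy => (hwd y).mul (hg y hy).norm_sq
  have hc : ContinuousOn (fun y => 2 / (β - α) * ‖g y‖ ^ 2 + w y * (2 * inner ℝ (g y) (g' y)))
      (uIcc α β) := by
    rw [uIcc_of_le hαβ.le]
    have : ContinuousOn w (Icc α β) := by fun_prop
    have := ContinuousOn.inner (𝕜 := ℝ) hgc hg'
    fun_prop
  have ftc := intervalIntegral.integral_eq_sub_of_hasDerivAt (a := α) (b := β)
    (fun y hy => hF y (by rwa [uIcc_of_le hαβ.le] at hy)) hc.intervalIntegrable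
  have e1 : w β = 1 := by rw [hw]; field_simp; ring
  have e2 : w α = -1 := by rw [hw]; field_simp; ring
  have e3 : ‖g α‖ ^ 2 + ‖g β‖ ^ 2 = ∫ y in α..β,
      (2 / (β - α) * ‖g y‖ ^ 2 + w y * (2 * inner ℝ (g y) (g' y))) := by
    rw [ftc]
    simp only [Pi.mul_apply]
    rw [e1, e2]; ring
  rw [e3]
  refine intervalIntegral.integral_mono_on hαβ.le hc.intervalIntegrable ?_ fun y hy => ?_
  · refine ContinuousOn.intervalIntegrable ?_
    rw [uIcc_of_le hαβ.le]
    fun_prop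
  · have hw1 : |w y| ≤ 1 := by
      rw [hw, abs_le]
      constructor
      · rw [le_div_iff₀ hd]; linarith [hy.1]
      · rw [div_le_one hd]; linarith [hy.2]
    have h1 : w y * (2 * inner ℝ (g y) (g' y)) ≤ 2 * (‖g y‖ * ‖g' y‖) := by
      refine (le_abs_self _).trans ?_
      rw [abs_mul, abs_mul, abs_two]
      calc _ ≤ 1 * (2 * (‖g y‖ * ‖g' y‖)) := by
            gcongr; exact abs_real_inner_le_norm _ _
        _ = _ := one_mul _
    have h2 : 2 * (‖g y‖ * ‖g' y‖) ≤ κ / 2 * ‖g y‖ ^ 2 + 2 / κ * ‖g' y‖ ^ 2 := by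
      have e : κ / 2 * ‖g y‖ ^ 2 + 2 / κ * ‖g' y‖ ^ 2 - 2 * (‖g y‖ * ‖g' y‖) =
          (κ * ‖g y‖ - 2 * ‖g' y‖) ^ 2 / (2 * κ) := by field_simp; ring
      have : 0 ≤ (κ * ‖g y‖ - 2 * ‖g' y‖) ^ 2 / (2 * κ) := by positivity
      linarith
    linarith

theorem IsJet.trace_inner_le {a1 b1 a2 b2 κ : ℝ} {D : ℕ → ℕ → ℝ × ℝ → ℂ}
    (hD : IsJet (Ioo a1 b1 ×ˢ Ioo a2 b2) D) (hκ : 0 < κ) (i : ℕ)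
    (hA : IntegrableOn (fun p => ‖D i 0 p‖ ^ 2) (Ioo a1 b1 ×ˢ Ioo a2 b2))
    (hB : IntegrableOn (fun p => ‖D i 1 p‖ ^ 2) (Ioo a1 b1 ×ˢ Ioo a2 b2))
    {α β a b : ℝ} (hα : a2 < α) (hβ : β < b2) (hαβ : α < β) (ha : a1 < a) (hb : b < b1) :
    (∫ x in Icc a b, ‖D i 0 (x, α)‖ ^ 2) + ∫ x in Icc a b, ‖D i 0 (x, β)‖ ^ 2 ≤
      (2 / (β - α) + κ / 2) * (∫ p in Ioo a1 b1 ×ˢ Ioo a2 b2, ‖D i 0 p‖ ^ 2) +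
        2 / κ * ∫ p in Ioo a1 b1 ×ˢ Ioo a2 b2, ‖D i 1 p‖ ^ 2 := by
  have hx : Icc a b ⊆ Ioo a1 b1 := fun x hx => ⟨ha.trans_le hx.1, hx.2.trans_lt hb⟩
  have hy : Icc α β ⊆ Ioo a2 b2 := fun x hx => ⟨hα.trans_le hx.1, hx.2.trans_lt hβ⟩
  have hsub := prod_mono hx hy
  have hd := sub_pos.2 hαβ
  have hline : ∀ j, ∀ y ∈ Icc α β, ContinuousOn (fun x => D i j (x, y)) (Icc a b) := fun j y hyy =>
    (hD.cont i j).comp (by fun_prop) fun x hxx => ⟨hx hxx, hy hyy⟩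
  have hline2 : ∀ j, ∀ x ∈ Icc a b, ContinuousOn (fun y => D i j (x, y)) (Icc α β) := fun j x hxx =>
    (hD.cont i j).comp (by fun_prop) fun y hyy => ⟨hx hxx, hy hyy⟩
  have hInt : ∀ y ∈ Icc α β, IntegrableOn (fun x => ‖D i 0 (x, y)‖ ^ 2) (Icc a b) := fun y hyy =>
    ((hline 0 y hyy).norm.pow 2).integrableOn_compact isCompact_Icc
  have hl := left_mem_Icc.2 hαβ.le
  have hr := right_mem_Icc.2 hαβ.le
  set f : ℝ × ℝ → ℝ := fun p =>
      (2 / (β - α) + κ / 2) * ‖D i 0 p‖ ^ 2 + 2 / κ * ‖D i 1 p‖ ^ 2 with hf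
  have hfi : IntegrableOn f (Ioo a1 b1 ×ˢ Ioo a2 b2) := (hA.const_mul _).add (hB.const_mul _)
  have hfs : IntegrableOn f (Icc a b ×ˢ Icc α β) := hfi.mono_set hsub
  have hfp : Integrable f ((volume.restrict (Icc a b)).prod (volume.restrict (Icc α β))) := by
    rwa [Measure.prod_restrict]
  have e : ∫ p in Icc a b ×ˢ Icc α β, f p = ∫ x in Icc a b, ∫ y in α..β, f (x, y) := by
    rw [Measure.volume_eq_prod] at hfs ⊢
    rw [setIntegral_prod _ hfs]
    refine integral_congr_ae (Filter.Eventually.of_forall fun x => ?_)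
    simp only
    rw [intervalIntegral.integral_of_le hαβ.le, integral_Icc_eq_integral_Ioc]
  have hfx : IntegrableOn (fun x => ∫ y in α..β, f (x, y)) (Icc a b) := by
    refine hfp.integral_prod_left.congr (Filter.Eventually.of_forall fun x => ?_)
    simp only
    rw [intervalIntegral.integral_of_le hαβ.le, integral_Icc_eq_integral_Ioc]
  have h1 : (∫ x in Icc a b, ‖D i 0 (x, α)‖ ^ 2) + ∫ x in Icc a b, ‖D i 0 (x, β)‖ ^ 2 ≤
      ∫ x in Icc a b, ∫ y in α..β, f (x, y) := by
    rw [← integral_add (hInt α hl) (hInt β hr)]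
    refine setIntegral_mono_on ((hInt α hl).add (hInt β hr)) hfx measurableSet_Icc fun x hxx => ?_
    exact norm_sq_add_norm_sq_le (g := fun y => D i 0 (x, y)) (g' := fun y => D i 1 (x, y)) hκ hαβ
      (fun y hyy => hD.d2 i 0 (x, y) ⟨hx hxx, hy hyy⟩)
      (hline2 1 x hxx)
  have h2 : ∫ p in Icc a b ×ˢ Icc α β, f p ≤ ∫ p in Ioo a1 b1 ×ˢ Ioo a2 b2, f p :=
    setIntegral_mono_set hfi (Filter.Eventually.of_forall fun p => by
      simp only [hf, Pi.zero_apply]; positivity) hsub.eventuallyLE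
  have h3 : ∫ p in Ioo a1 b1 ×ˢ Ioo a2 b2, f p =
      (2 / (β - α) + κ / 2) * (∫ p in Ioo a1 b1 ×ˢ Ioo a2 b2, ‖D i 0 p‖ ^ 2) +
        2 / κ * ∫ p in Ioo a1 b1 ×ˢ Ioo a2 b2, ‖D i 1 p‖ ^ 2 := by
    rw [integral_add (hA.const_mul _) (hB.const_mul _), integral_const_mul, integral_const_mul]
  linarith

/-- Weak convergence of the tangential derivatives along lines approaching an edge. -/
theorem IsJet.tendsto_dualPair {a1 b1 a2 b2 : ℝ} {D : ℕ → ℕ → ℝ × ℝ → ℂ}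
    (hD : IsJet (Ioo a1 b1 ×ˢ Ioo a2 b2) D) {u : ℝ × ℝ → ℂ}
    (hu : ContinuousOn u (Icc a1 b1 ×ˢ Icc a2 b2)) (he : EqOn u (D 0 0) (Ioo a1 b1 ×ˢ Ioo a2 b2))
    {F : ℕ → ℝ → ℂ} {μ : ℕ} {e : ℝ} (hemem : e ∈ Icc a2 b2)
    (hF0 : ∀ x ∈ Ioo a1 b1, F 0 x = u (x, e))
    (hF : ∀ i < μ, ∀ x ∈ Ioo a1 b1, HasDerivAt (F i) (F (i + 1) x) x)
    (hFc : ∀ i ≤ μ, ContinuousOn (F i) (Ioo a1 b1)) {ψ : ℝ → ℂ} (hψ : ContDiff ℝ (⊤ : ℕ∞) ψ)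
    {δ : ℝ} (hδ : 0 < δ) (hs : ∀ x, x ∉ Icc (a1 + δ) (b1 - δ) → ψ x = 0)
    {y : ℕ → ℝ} (hy : ∀ k, y k ∈ Ioo a2 b2) (hlim : Filter.Tendsto y Filter.atTop (nhds e)) :
    Filter.Tendsto (fun k => dualPair a1 b1 (fun x => D μ 0 (x, y k)) ψ) Filter.atTop
      (nhds (dualPair a1 b1 (F μ) ψ)) := by
  have hψμ : Continuous (iteratedDeriv μ ψ) :=
      hψ.continuous_iteratedDeriv μ (by exact_mod_cast le_top)
  have hline : ∀ k i, ContinuousOn (fun x => D i 0 (x, y k)) (Ioo a1 b1) := fun k i =>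
    (hD.cont i 0).comp (by fun_prop) fun x hx => ⟨hx, hy k⟩
  have e1 : ∀ k, ∫ x in Ioo a1 b1, D μ 0 (x, y k) * ψ x =
      (-1) ^ μ * ∫ x in Ioo a1 b1, u (x, y k) * iteratedDeriv μ ψ x := by
    intro k
    rw [setIntegral_mul_iteratedDeriv hδ (fun i x => D i 0 (x, y k)) μ
      (fun i _ x hx => hD.d1 i 0 (x, y k) ⟨hx, hy k⟩) (fun i _ => hline k i) hψ hs]
    congr 1
    exact setIntegral_congr_fun measurableSet_Ioo fun x hx => by
      rw [he ⟨hx, hy k⟩]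
  have e2 : ∫ x in Ioo a1 b1, F μ x * ψ x =
      (-1) ^ μ * ∫ x in Ioo a1 b1, u (x, e) * iteratedDeriv μ ψ x := by
    rw [setIntegral_mul_iteratedDeriv hδ F μ hF hFc hψ hs]
    congr 1
    exact setIntegral_congr_fun measurableSet_Ioo fun x hx => by
      rw [hF0 x hx]
  obtain ⟨C, hC⟩ := (isCompact_Icc.prod isCompact_Icc).exists_bound_of_continuousOn hu
  have hyI : ∀ k, y k ∈ Icc a2 b2 := fun k => Ioo_subset_Icc_self (hy k)
  have t : Filter.Tendsto (fun k => ∫ x in Ioo a1 b1, u (x, y k) * iteratedDeriv μ ψ x)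
      Filter.atTop (nhds (∫ x in Ioo a1 b1, u (x, e) * iteratedDeriv μ ψ x)) := by
    refine tendsto_integral_of_dominated_convergence (fun x => C * ‖iteratedDeriv μ ψ x‖)
      (fun k => ContinuousOn.aestronglyMeasurable (ContinuousOn.mul ?_ hψμ.continuousOn)
        measurableSet_Ioo) ?_
      (fun k => (ae_restrict_iff' measurableSet_Ioo).2 (Filter.Eventually.of_forall fun x hx => ?_))
      ((ae_restrict_iff' measurableSet_Ioo).2 (Filter.Eventually.of_forall fun x hx =>
        Filter.Tendsto.mul_const _ ?_))
    · exact hu.comp (by fun_prop) fun x hx => ⟨Ioo_subset_Icc_self hx, hyI k⟩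
    · exact ((by fun_prop :
        Continuous fun x => C * ‖iteratedDeriv μ ψ x‖).continuousOn.integrableOn_compact
        isCompact_Icc).mono_set Ioo_subset_Icc_self
    · rw [norm_mul]
      exact mul_le_mul_of_nonneg_right (hC _ ⟨Ioo_subset_Icc_self hx, hyI k⟩) (norm_nonneg _)
    · have hc : ContinuousWithinAt (fun t => u (x, t)) (Icc a2 b2) e :=
        (hu.comp (by fun_prop) fun t ht => ⟨Ioo_subset_Icc_self hx, ht⟩) e hemem
      exact hc.tendsto.comp (tendsto_nhdsWithin_iff.2 ⟨hlim, Filter.Eventually.of_forall hyI⟩)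
  simp only [dualPair, e1, e2]
  exact (((Complex.continuous_re.tendsto _).comp (t.const_mul _)).const_mul 2).sub_const _

/-- Trace inequality for the tangential derivatives on two opposite edges of a rectangle. -/
theorem IsJet.trace_le {a1 b1 a2 b2 κ : ℝ} {D : ℕ → ℕ → ℝ × ℝ → ℂ}
    (hD : IsJet (Ioo a1 b1 ×ˢ Ioo a2 b2) D) (h1 : a1 < b1) (h2 : a2 < b2) (hκ : 0 < κ)
    {u : ℝ × ℝ → ℂ}
    (hu : ContinuousOn u (Icc a1 b1 ×ˢ Icc a2 b2)) (he : EqOn u (D 0 0) (Ioo a1 b1 ×ˢ Ioo a2 b2))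
    {M μ : ℕ} (hμ : μ ≤ M) {fB fT : ℝ → ℂ}
    (hfB : EqOn fB (fun x => u (x, a2)) (Icc a1 b1))
        (hfT : EqOn fT (fun x => u (x, b2)) (Icc a1 b1))
    (cB : ContDiffOn ℝ M fB (Icc a1 b1)) (cT : ContDiffOn ℝ M fT (Icc a1 b1))
    (hA : IntegrableOn (fun p => ‖D μ 0 p‖ ^ 2) (Ioo a1 b1 ×ˢ Ioo a2 b2))
    (hB : IntegrableOn (fun p => ‖D μ 1 p‖ ^ 2) (Ioo a1 b1 ×ˢ Ioo a2 b2)) :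
    (∫ x in a1..b1, ‖iteratedDerivWithin μ fB (Icc a1 b1) x‖ ^ 2) +
        ∫ x in a1..b1, ‖iteratedDerivWithin μ fT (Icc a1 b1) x‖ ^ 2 ≤
      (2 / (b2 - a2) + κ / 2) * (∫ p in Ioo a1 b1 ×ˢ Ioo a2 b2, ‖D μ 0 p‖ ^ 2) +
        2 / κ * ∫ p in Ioo a1 b1 ×ˢ Ioo a2 b2, ‖D μ 1 p‖ ^ 2 := by
  have hun := uniqueDiffOn_Icc h1
  have cont : ∀ {f : ℝ → ℂ}, ContDiffOn ℝ M f (Icc a1 b1) → ∀ i ≤ μ,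
      ContinuousOn (iteratedDerivWithin i f (Icc a1 b1)) (Icc a1 b1) := fun hf i hi =>
    hf.continuousOn_iteratedDerivWithin (by exact_mod_cast hi.trans hμ) hun
  have diff : ∀ {f : ℝ → ℂ}, ContDiffOn ℝ M f (Icc a1 b1) → ∀ i < μ, ∀ x ∈ Ioo a1 b1,
      HasDerivAt (iteratedDerivWithin i f (Icc a1 b1))
        (iteratedDerivWithin (i + 1) f (Icc a1 b1) x) x := by
    intro f hf i hi x hx
    rw [iteratedDerivWithin_succ]
    exact ((hf.differentiableOn_iteratedDerivWithin (by exact_mod_cast hi.trans_le hμ) hun) x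
      (Ioo_subset_Icc_self hx)).hasDerivWithinAt.hasDerivAt (Icc_mem_nhds hx.1 hx.2)
  obtain ⟨ψ, hψ, sψ, tψ⟩ := exists_dualPair_tendsto h1 (cont cB μ le_rfl)
  obtain ⟨χ, hχ, sχ, tχ⟩ := exists_dualPair_tendsto h1 (cont cT μ le_rfl)
  rw [intervalIntegral.integral_of_le h1.le, intervalIntegral.integral_of_le h1.le,
    integral_Ioc_eq_integral_Ioo, integral_Ioc_eq_integral_Ioo]
  refine le_of_tendsto (tψ.add tχ) ?_
  filter_upwards [sψ, sχ] with k hk hk'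
  obtain ⟨δ, hδ, hs⟩ := hk
  obtain ⟨δ', hδ', hs'⟩ := hk'
  set d := min δ δ' with hd
  have hd0 : 0 < d := lt_min hδ hδ'
  have hsd : ∀ x, x ∉ Icc (a1 + d) (b1 - d) → ψ k x = 0 := fun x hx => hs x fun h =>
    hx ⟨by linarith [h.1, min_le_left δ δ'], by linarith [h.2, min_le_left δ δ']⟩
  have hsd' : ∀ x, x ∉ Icc (a1 + d) (b1 - d) → χ k x = 0 := fun x hx => hs' x fun h =>
    hx ⟨by linarith [h.1, min_le_right δ δ'], by linarith [h.2, min_le_right δ δ']⟩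
  set L := b2 - a2 with hL
  have hL0 : 0 < L := sub_pos.2 h2
  set ε : ℕ → ℝ := fun n => L / 4 * (1 / ((n : ℝ) + 1)) with hε
  have hε0 : ∀ n, 0 < ε n := fun n => by simp only [hε]; positivity
  have hε1 : ∀ n, ε n ≤ L / 4 := by
    intro n
    have : 1 / ((n : ℝ) + 1) ≤ 1 := by
      rw [div_le_one (by positivity)]; linarith [(Nat.cast_nonneg n : (0 : ℝ) ≤ n)]
    simp only [hε]
    nlinarith
  have hεt : Filter.Tendsto ε Filter.atTop (nhds 0) := by
    have := (tendsto_one_div_add_atTop_nhds_zero_nat (𝕜 := ℝ)).const_mul (L / 4)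
    rwa [mul_zero] at this
  have tB : Filter.Tendsto (fun n => a2 + ε n) Filter.atTop (nhds a2) := by
    simpa using hεt.const_add a2
  have tT : Filter.Tendsto (fun n => b2 - ε n) Filter.atTop (nhds b2) := by
    simpa using hεt.const_sub b2
  have mB : ∀ n, a2 + ε n ∈ Ioo a2 b2 := fun n => ⟨by linarith [hε0 n], by linarith [hε1 n]⟩
  have mT : ∀ n, b2 - ε n ∈ Ioo a2 b2 := fun n => ⟨by linarith [hε1 n], by linarith [hε0 n]⟩
  have limB := hD.tendsto_dualPair hu he (left_mem_Icc.2 h2.le)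
    (F := fun i => iteratedDerivWithin i fB (Icc a1 b1))
    (fun x hx => by simpa using hfB (Ioo_subset_Icc_self hx)) (diff cB)
    (fun i hi => (cont cB i hi).mono Ioo_subset_Icc_self) (hψ k) hd0 hsd mB tB
  have limT := hD.tendsto_dualPair hu he (right_mem_Icc.2 h2.le)
    (F := fun i => iteratedDerivWithin i fT (Icc a1 b1))
    (fun x hx => by simpa using hfT (Ioo_subset_Icc_self hx)) (diff cT)
    (fun i hi => (cont cT i hi).mono Ioo_subset_Icc_self) (hχ k) hd0 hsd' mT tT
  have limR : Filter.Tendsto (fun n => (2 / ((b2 - ε n) - (a2 + ε n)) + κ / 2) *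
      (∫ p in Ioo a1 b1 ×ˢ Ioo a2 b2, ‖D μ 0 p‖ ^ 2) +
        2 / κ * ∫ p in Ioo a1 b1 ×ˢ Ioo a2 b2, ‖D μ 1 p‖ ^ 2) Filter.atTop
      (nhds ((2 / L + κ / 2) * (∫ p in Ioo a1 b1 ×ˢ Ioo a2 b2, ‖D μ 0 p‖ ^ 2) +
        2 / κ * ∫ p in Ioo a1 b1 ×ˢ Ioo a2 b2, ‖D μ 1 p‖ ^ 2)) :=
    (((tendsto_const_nhds.div (tT.sub tB) hL0.ne').add_const _).mul_const _).add_const _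
  refine le_of_tendsto_of_tendsto' (limB.add limT) limR fun n => ?_
  refine le_trans (add_le_add (dualPair_le hd0 ?_ (hψ k).continuous hsd)
    (dualPair_le hd0 ?_ (hχ k).continuous hsd')) (hD.trace_inner_le hκ μ hA hB (mB n).1 (mT n).2
      (by linarith [hε1 n]) (by linarith) (by linarith))
  · exact (hD.cont μ 0).comp (by fun_prop) fun x hx => ⟨hx, mB n⟩
  · exact (hD.cont μ 0).comp (by fun_prop) fun x hx => ⟨hx, mT n⟩

section trace

variable {κ h1 h2 : ℝ} {cells : Finset (ℤ × ℤ)} {Ω : Set (ℝ × ℝ)} {N M : ℕ} {u : ℝ × ℝ → ℂ}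

/-- The contribution of `∂₁^i ∂₂^j` to the squared weighted Sobolev norm. -/
def sobTerm (κ : ℝ) (D : Set (ℝ × ℝ)) (u : ℝ × ℝ → ℂ) (p : ℕ × ℕ) : ℝ :=
  (κ ^ (2 * (p.1 + p.2)))⁻¹ * ∫ x in D, ‖pdM p.1 p.2 u x‖ ^ 2

theorem sobTerm_nonneg (hκ : 0 < κ) (D : Set (ℝ × ℝ)) (u : ℝ × ℝ → ℂ) (p : ℕ × ℕ) :
    0 ≤ sobTerm κ D u p :=
  mul_nonneg (by positivity) (integral_nonneg fun _ => by positivity)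

theorem sobTerm_add_le (hκ : 0 < κ) (D : Set (ℝ × ℝ)) (u : ℝ × ℝ → ℂ) {m : ℕ} {p q : ℕ × ℕ}
    (hpq : p ≠ q) (hp : p ∈ idxLe m) (hq : q ∈ idxLe m) :
    sobTerm κ D u p + sobTerm κ D u q ≤ sobNormSq κ m D u := by
  rw [← Finset.sum_pair hpq]
  refine Finset.sum_le_sum_of_subset_of_nonneg ?_ fun p _ _ => sobTerm_nonneg hκ D u p
  rintro x hx
  rcases Finset.mem_insert.1 hx with rfl | hx
  · exact hp
  · rwa [Finset.mem_singleton.1 hx]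

theorem mem_idxLe {m : ℕ} {p : ℕ × ℕ} : p ∈ idxLe m ↔ p.1 + p.2 ≤ m := by
  simp only [idxLe, Finset.mem_filter, Finset.mem_product, Finset.mem_range]
  omega

theorem trace_const_le {A B L K κ : ℝ} {μ : ℕ} (hκ : 0 < κ) (hA : 0 ≤ A) (hB : 0 ≤ B)
    (hL : 1 / L ≤ K) (hK : κ ≤ K) :
    (κ ^ (2 * μ))⁻¹ * ((2 / L + κ / 2) * A + 2 / κ * B) ≤
      5 / 2 * K * ((κ ^ (2 * μ))⁻¹ * A + (κ ^ (2 * (μ + 1)))⁻¹ * B) := by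
  have hK0 : 0 < K := hκ.trans_le hK
  have e : (κ ^ (2 * μ))⁻¹ * ((2 / L + κ / 2) * A + 2 / κ * B) =
      (2 * (1 / L) + κ / 2) * ((κ ^ (2 * μ))⁻¹ * A) + 2 * κ * ((κ ^ (2 * (μ + 1)))⁻¹ * B) := by
    rw [mul_add 2, pow_add]
    field_simp
    ring
  have hA' : 0 ≤ (κ ^ (2 * μ))⁻¹ * A := by positivity
  have hB' : 0 ≤ (κ ^ (2 * (μ + 1)))⁻¹ * B := by positivity
  rw [e, mul_add (5 / 2 * K)]
  exact add_le_add (mul_le_mul_of_nonneg_right (by linarith) hA')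
    (mul_le_mul_of_nonneg_right (by linarith) hB')

theorem cellC_subset_closure (hT : IsTessellation h1 h2 cells Ω) {c : ℤ × ℤ} (hc : c ∈ cells) :
    cellC h1 h2 c ⊆ closure Ω := by
  rw [hT.2.2]
  exact subset_biUnion_of_mem (u := fun c => cellC h1 h2 c) hc

theorem isOpen_cellO (h1 h2 : ℝ) (c : ℤ × ℤ) : IsOpen (cellO h1 h2 c) :=
  isOpen_Ioo.prod isOpen_Ioo

/-- Trace inequality on a cell. -/
theorem SGlob.trace_le (hu : SGlob κ h1 h2 cells Ω N M u) (hT : IsTessellation h1 h2 cells Ω)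
    (hκ : 0 < κ) (hh1 : 0 < h1) (hh2 : 0 < h2) (hA : A0cond κ h1 h2) (hN : 1 ≤ N) (hM : 1 ≤ M)
    {μ : ℕ} (hμ : μ ≤ M) {c : ℤ × ℤ} (hc : c ∈ cells) (hS : MemSob (M + 1) (cellO h1 h2 c) u)
    {K : ℝ} (hK : κ ≤ K) (hK1 : 1 / h1 ≤ K) (hK2 : 1 / h2 ≤ K) :
    (κ ^ (2 * μ))⁻¹ * (hSemi h1 h2 μ u c + hSemi h1 h2 μ u (c.1, c.2 + 1) +
      vSemi h1 h2 μ u c + vSemi h1 h2 μ u (c.1 + 1, c.2)) ≤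
        5 * K * sobNormSq κ (μ + 1) (cellO h1 h2 c) u := by
  have hjet := hu.cellSer_isJet hκ hh1 hh2 hN hM hc
  have heq := hu.eqOn_cellSer hT hκ hh1 hh2 hA hN hM hc
  have hO := isOpen_cellO h1 h2 c
  have hpd := hjet.pdM_eq hO (heq.mono (cellO_subset h1 h2 c))
  set D := cellSer κ h1 h2 u c id
  have hInt : ∀ i j, i + j ≤ M + 1 → IntegrableOn (fun p => ‖D i j p‖ ^ 2) (cellO h1 h2 c) :=
    fun i j hij => (hS (i, j) (mem_idxLe.2 hij)).congr_fun
      (fun p hp => by simp only; rw [hpd i j hp]) hO.measurableSet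
  have hterm : ∀ i j, sobTerm κ (cellO h1 h2 c) u (i, j) =
      (κ ^ (2 * (i + j)))⁻¹ * ∫ p in cellO h1 h2 c, ‖D i j p‖ ^ 2 := by
    intro i j
    rw [sobTerm, setIntegral_congr_fun hO.measurableSet fun p hp => by rw [hpd i j hp]]
  have l1 := mul_lt_succ_mul hh1 (c.1 : ℝ)
  have l2 := mul_lt_succ_mul hh2 (c.2 : ℝ)
  have huc : ContinuousOn u (cellC h1 h2 c) := hu.cont.mono (cellC_subset_closure hT hc)
  have hnn : ∀ i j, 0 ≤ ∫ p in cellO h1 h2 c, ‖D i j p‖ ^ 2 := fun i j =>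
    integral_nonneg fun _ => by positivity
  have tH := hjet.trace_le l1 l2 hκ huc (heq.mono (cellO_subset h1 h2 c)) hμ
    (fB := fun t => u (t, (c.2 : ℝ) * h2)) (fT := fun t => u (t, ((c.2 + 1 : ℤ) : ℝ) * h2))
    (fun _ _ => rfl) (fun x _ => by simp) (hu.htraceReg c (mem_hEdges_bottom hc))
    (hu.htraceReg _ (mem_hEdges_top hc)) (hInt μ 0 (by omega)) (hInt μ 1 (by omega))
  have hjs := hjet.swap
  rw [cellO, preimage_swap_prod] at hjs
  have tV := hjs.trace_le l2 l1 hκ (u := fun p => u p.swap)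
    (huc.comp continuous_swap.continuousOn fun p hp => ⟨hp.2, hp.1⟩)
    (fun p hp => heq ⟨Ioo_subset_Icc_self hp.2, Ioo_subset_Icc_self hp.1⟩) hμ
    (fB := fun t => u ((c.1 : ℝ) * h1, t)) (fT := fun t => u (((c.1 + 1 : ℤ) : ℝ) * h1, t))
    (fun _ _ => rfl) (fun x _ => by simp) (hu.vtraceReg c (mem_vEdges_left hc))
    (hu.vtraceReg _ (mem_vEdges_right hc)) (integrableOn_swap (hInt 0 μ (by omega)))
    (integrableOn_swap (hInt 1 μ (by omega)))
  rw [setIntegral_swap _ _ fun p => ‖D 0 μ p‖ ^ 2, setIntegral_swap _ _ fun p =>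
    ‖D 1 μ p‖ ^ 2] at tV
  rw [succ_mul_sub] at tH tV
  have cH := trace_const_le (μ := μ) hκ (hnn μ 0) (hnn μ 1) hK2 hK
  have cV := trace_const_le (μ := μ) hκ (hnn 0 μ) (hnn 1 μ) hK1 hK
  have sH := sobTerm_add_le hκ (cellO h1 h2 c) u (m := μ + 1) (p := (μ, 0)) (q := (μ, 1)) (by simp)
    (mem_idxLe.2 (by simp)) (mem_idxLe.2 (by simp))
  have sV := sobTerm_add_le hκ (cellO h1 h2 c) u (m := μ + 1) (p := (0, μ)) (q := (1, μ)) (by simp)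
    (mem_idxLe.2 (by simp)) (mem_idxLe.2 (by simp; omega))
  rw [hterm, hterm, add_zero] at sH
  rw [hterm, hterm, zero_add, add_comm 1 μ] at sV
  have hp : 0 ≤ (κ ^ (2 * μ))⁻¹ := by positivity
  have hK0 : 0 < K := hκ.trans_le hK
  have fH := (mul_le_mul_of_nonneg_left tH hp).trans
    (cH.trans (mul_le_mul_of_nonneg_left sH (by positivity)))
  have fV := (mul_le_mul_of_nonneg_left tV hp).trans
    (cV.trans (mul_le_mul_of_nonneg_left sV (by positivity)))
  have e : (κ ^ (2 * μ))⁻¹ * (hSemi h1 h2 μ u c + hSemi h1 h2 μ u (c.1, c.2 + 1) +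
      vSemi h1 h2 μ u c + vSemi h1 h2 μ u (c.1 + 1, c.2)) =
      (κ ^ (2 * μ))⁻¹ * (hSemi h1 h2 μ u c + hSemi h1 h2 μ u (c.1, c.2 + 1)) +
      (κ ^ (2 * μ))⁻¹ * (vSemi h1 h2 μ u c + vSemi h1 h2 μ u (c.1 + 1, c.2)) := by ring
  rw [e]
  calc _ ≤ 5 / 2 * K * sobNormSq κ (μ + 1) (cellO h1 h2 c) u +
        5 / 2 * K * sobNormSq κ (μ + 1) (cellO h1 h2 c) u := add_le_add fH fV
    _ = _ := by ring

theorem traceConst_bounds (hκ : 0 < κ) (hh1 : 0 < h1) (hh2 : 0 < h2) :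
    κ ≤ max h1 h2 / min h1 h2 * max 1 (κ * max h1 h2) ^ 2 / max h1 h2 ∧
    1 / h1 ≤ max h1 h2 / min h1 h2 * max 1 (κ * max h1 h2) ^ 2 / max h1 h2 ∧
    1 / h2 ≤ max h1 h2 / min h1 h2 * max 1 (κ * max h1 h2) ^ 2 / max h1 h2 := by
  have hm := lt_min hh1 hh2
  have hH : 0 < max h1 h2 := lt_max_of_lt_left hh1
  have hmH : min h1 h2 ≤ max h1 h2 := min_le_max
  have e : max h1 h2 / min h1 h2 * max 1 (κ * max h1 h2) ^ 2 / max h1 h2 =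
      max 1 (κ * max h1 h2) ^ 2 / min h1 h2 := by field_simp
  have hX1 : 1 ≤ max 1 (κ * max h1 h2) := le_max_left _ _
  have hX2 : κ * max h1 h2 ≤ max 1 (κ * max h1 h2) := le_max_right _ _
  rw [e]
  refine ⟨?_, div_le_div₀ (by positivity) (by nlinarith) hm (min_le_left _ _),
    div_le_div₀ (by positivity) (by nlinarith) hm (min_le_right _ _)⟩
  rw [le_div_iff₀ hm]
  nlinarith [mul_le_mul_of_nonneg_left hmH hκ.le]

end trace

/-- Proposition 3.6, global edge-based approximation: under Assumption A1,
for `u ∈ S^{N,M}_κ(T_h)` and `ν_{N_e} ≥ √2`, the best-approximation error in the edge-based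
Trefftz space `V_{N_e}(Σ_h)`, measured in the broken norm `H^r_κ(T_h)`, is bounded by
`(2√2(r+1)/√(κ tanh(κh/ρ))) ν_{N_e}^{r−(μ+1/2)} |u|_{H^μ_κ(Σ_h)}`, and, if additionally
`u ∈ H^{M+1}_κ(K)` on every cell, by `C₁((r+1)/2) ν_{N_e}^{r−(μ+1/2)} ‖u‖_{H^{μ+1}_κ(T_h)}`. -/
theorem global_edge_approximation (κ h1 h2 : ℝ) (hκ : 0 < κ) (hh1 : 0 < h1) (hh2 : 0 < h2)
    (cells : Finset (ℤ × ℤ)) (Ω : Set (ℝ × ℝ)) (hT : IsTessellation h1 h2 cells Ω)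
    (hA1 : A0cond κ h1 h2)
    (N M : ℕ) (hN : 1 ≤ N) (hM : 1 ≤ M) (hNM : N ≤ (M + 1) / 2)
    (r μ : ℕ) (hrμ : r ≤ μ) (hμ : μ ≤ min (2 * N) M)
    (Ne : ℕ) (hNe : 1 ≤ Ne)
    (hnu : Real.sqrt 2 ≤ (Ne : ℝ) * π / (κ * max h1 h2))
    (u : ℝ × ℝ → ℂ) (hu : SGlob κ h1 h2 cells Ω N M u) :
    (sInf {E : ℝ | ∃ v ∈ edgeSpace κ h1 h2 cells Ne,
          E = Real.sqrt (brokenNormSq κ r h1 h2 cells (u - v))} ≤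
        (2 * Real.sqrt 2 * (r + 1) /
            Real.sqrt (κ * Real.tanh (κ * max h1 h2 / (max h1 h2 / min h1 h2)))) *
          ((Ne : ℝ) * π / (κ * max h1 h2)) ^ ((r : ℝ) - ((μ : ℝ) + 1 / 2)) *
          Real.sqrt (skelSemiSq κ h1 h2 cells μ u)) ∧
    ((∀ c ∈ cells, MemSob (M + 1) (cellO h1 h2 c) u) →
      sInf {E : ℝ | ∃ v ∈ edgeSpace κ h1 h2 cells Ne,
          E = Real.sqrt (brokenNormSq κ r h1 h2 cells (u - v))} ≤
        (8 * Real.sqrt (max h1 h2 / min h1 h2) * max 1 (κ * max h1 h2) /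
            Real.sqrt (κ * max h1 h2 *
              Real.tanh (κ * max h1 h2 / (max h1 h2 / min h1 h2)))) *
          (((r : ℝ) + 1) / 2) *
          ((Ne : ℝ) * π / (κ * max h1 h2)) ^ ((r : ℝ) - ((μ : ℝ) + 1 / 2)) *
          Real.sqrt (∑ c ∈ cells, sobNormSq κ (μ + 1) (cellO h1 h2 c) u)) := by
  have hμM := hμ.trans (min_le_right _ _)
  refine ⟨hu.sInf_le_skelSemiSq hT hκ hh1 hh2 hA1 hN hM hrμ hμ hnu, fun hS => ?_⟩
  obtain ⟨hK, hK1, hK2⟩ := traceConst_bounds hκ hh1 hh2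
  exact hu.sInf_le_of_trace hT hκ hh1 hh2 hA1 hN hM hrμ hμ hnu fun c hc =>
    hu.trace_le hT hκ hh1 hh2 hA1 hN hM hμM hc (hS c hc) hK hK1 hK2

end
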